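/- arXiv:1712.02526 — 7 statements merged into one kernel-verified Lean document; each statement's English description precedes it below -/
import Mathlib

section
/- Let X = (V,E) be a finite connected k-regular simple graph with k ≥ 1 and |V| ≥ 2. Then h(X)²/(2k²) ≤ λ₁(X). -/
open Finset

/-- The Cheeger constant of a finite graph: the minimum of `|E(A,B)|/min(|A|,|B|)`
over partitions `V = A ∪ B` into two nonempty disjoint sets. -/
noncomputable def cheegerConst {V : Type} [Fintype V] [DecidableEq V]
    (G : SimpleGraph V) [DecidableRel G.Adj] : ℝ :=
  sInf {r : ℝ | ∃ A B : Finset V, A.Nonempty ∧ B.Nonempty ∧ Disjoint A B ∧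
      A ∪ B = Finset.univ ∧
      r = (((A ×ˢ B).filter fun p => G.Adj p.1 p.2).card : ℝ) /
        min (A.card : ℝ) (B.card : ℝ)}

/-- `∑_{{u,v} ∈ E} (f u - f v)^2`. -/
noncomputable def edgeEnergy {V : Type} [Fintype V] [DecidableEq V]
    (G : SimpleGraph V) [DecidableRel G.Adj] (f : V → ℝ) : ℝ :=
  ∑ e ∈ G.edgeFinset, Sym2.lift ⟨fun u v => (f u - f v) ^ 2, fun u v => by ring⟩ e

/-- The spectral gap of a `k`-regular graph: the minimum of the Rayleigh quotient
`(∑_{{u,v}∈E} (f u - f v)^2)/(k ∑_v f v ^ 2)` over nonzero `f` with `∑_v f v = 0`. -/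
noncomputable def lambdaOne {V : Type} [Fintype V] [DecidableEq V]
    (G : SimpleGraph V) [DecidableRel G.Adj] (k : ℕ) : ℝ :=
  sInf {r : ℝ | ∃ f : V → ℝ, f ≠ 0 ∧ ∑ v, f v = 0 ∧
      r = edgeEnergy G f / (k * ∑ v, f v ^ 2)}

section

variable {V : Type} [Fintype V] (G : SimpleGraph V) [DecidableRel G.Adj]

lemma sum_adj_left {k : ℕ} (hreg : G.IsRegularOfDegree k) (f : V → ℝ) :
    ∑ u, ∑ v, (if G.Adj u v then f u else 0) = k * ∑ v, f v := by
  rw [mul_sum]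
  refine sum_congr rfl fun u _ => ?_
  rw [← sum_filter, sum_const, nsmul_eq_mul, ← hreg u, ← G.card_neighborFinset_eq_degree,
    G.neighborFinset_eq_filter]

lemma sum_adj_right {k : ℕ} (hreg : G.IsRegularOfDegree k) (f : V → ℝ) :
    ∑ u, ∑ v, (if G.Adj u v then f v else 0) = k * ∑ v, f v := by
  rw [sum_comm, ← sum_adj_left G hreg]
  simp only [G.adj_comm]

variable [DecidableEq V]

/-- Each edge is counted twice, once per orientation, in a sum over ordered adjacent pairs. -/
lemma sum_adj_eq_two_mul_sum_edgeFinset (F : Sym2 V → ℝ) :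
    ∑ u, ∑ v, (if G.Adj u v then F s(u, v) else 0) = 2 * ∑ e ∈ G.edgeFinset, F e := by
  rw [← Fintype.sum_prod_type' (f := fun u v => if G.Adj u v then F s(u, v) else 0),
    ← sum_filter,
    ← sum_fiberwise_of_maps_to (t := G.edgeFinset) (g := fun p : V × V => s(p.1, p.2))
      (by simp), mul_sum]
  refine sum_congr rfl fun e he => ?_
  induction e using Sym2.ind with
  | _ a b =>
  have hab : G.Adj a b := by simpa using he
  have hfiber : ((univ.filter fun p : V × V => G.Adj p.1 p.2).filter
      fun p => s(p.1, p.2) = s(a, b)) = {(a, b), (b, a)} := by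
    ext ⟨x, y⟩
    simp only [mem_filter, mem_univ, true_and, Sym2.eq_iff, mem_insert, mem_singleton,
      Prod.mk.injEq]
    constructor
    · exact fun h => h.2
    · rintro (⟨rfl, rfl⟩ | ⟨rfl, rfl⟩)
      · exact ⟨hab, Or.inl ⟨rfl, rfl⟩⟩
      · exact ⟨hab.symm, Or.inr ⟨rfl, rfl⟩⟩
  rw [hfiber, sum_pair (by simp [hab.ne]), Sym2.eq_swap (a := b), two_mul]

lemma two_mul_edgeEnergy (f : V → ℝ) :
    2 * edgeEnergy G f = ∑ u, ∑ v, if G.Adj u v then (f u - f v) ^ 2 else 0 := by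
  simp [edgeEnergy, ← sum_adj_eq_two_mul_sum_edgeFinset]

lemma cheegerConst_nonneg : 0 ≤ cheegerConst G := by
  refine Real.sInf_nonneg ?_
  rintro r ⟨A, B, -, -, -, -, rfl⟩
  positivity

lemma cheegerConst_mul_card_le {S : Finset V} (hS : S.Nonempty)
    (hcard : 2 * S.card ≤ Fintype.card V) :
    cheegerConst G * S.card ≤ ((S ×ˢ Sᶜ).filter fun p => G.Adj p.1 p.2).card := by
  have hpos := hS.card_pos
  have hcompl := card_compl S
  have hle : (S.card : ℝ) ≤ Sᶜ.card := by
    exact_mod_cast (by omega : S.card ≤ Sᶜ.card)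
  rw [← le_div_iff₀ (by exact_mod_cast hpos)]
  refine csInf_le ⟨0, ?_⟩ ⟨S, Sᶜ, hS, card_pos.mp (by omega), disjoint_compl_right,
    union_compl S, by rw [min_eq_left hle]⟩
  rintro r ⟨A, B, -, -, -, -, rfl⟩
  positivity

lemma sum_adj_abs_indicator_sub (S : Finset V) :
    ∑ u, ∑ v, (if G.Adj u v then
      |(if u ∈ S then (1 : ℝ) else 0) - (if v ∈ S then 1 else 0)| else 0) =
      2 * ((S ×ˢ Sᶜ).filter fun p => G.Adj p.1 p.2).card := by
  have hcut : (((S ×ˢ Sᶜ).filter fun p => G.Adj p.1 p.2).card : ℝ) =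
      ∑ u, ∑ v, if u ∈ S ∧ v ∉ S ∧ G.Adj u v then (1 : ℝ) else 0 := by
    rw [← Fintype.sum_prod_type'
      (f := fun u v => if u ∈ S ∧ v ∉ S ∧ G.Adj u v then (1 : ℝ) else 0), sum_boole]
    congr 2
    ext ⟨x, y⟩
    simp [and_assoc]
  have hswap : ∑ u, ∑ v, (if u ∈ S ∧ v ∉ S ∧ G.Adj u v then (1 : ℝ) else 0) =
      ∑ u, ∑ v, if v ∈ S ∧ u ∉ S ∧ G.Adj u v then (1 : ℝ) else 0 := by
    rw [sum_comm]
    simp only [G.adj_comm]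
  rw [two_mul, hcut]
  nth_rw 2 [hswap]
  simp only [← sum_add_distrib]
  refine sum_congr rfl fun u _ => sum_congr rfl fun v _ => ?_
  by_cases hu : u ∈ S <;> by_cases hv : v ∈ S <;> by_cases ha : G.Adj u v <;> simp [hu, hv, ha]

/-- The discrete co-area inequality. -/
lemma two_mul_cheegerConst_mul_sum_le (f : V → ℝ) (hf : ∀ v, 0 ≤ f v)
    (hcard : 2 * (univ.filter fun v => 0 < f v).card ≤ Fintype.card V) :
    2 * cheegerConst G * ∑ v, f v ≤ ∑ u, ∑ v, if G.Adj u v then |f u - f v| else 0 := by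
  induction hn : (univ.filter fun v => 0 < f v).card using Nat.strong_induction_on
    generalizing f with
  | _ n ih =>
  set S := univ.filter fun v => 0 < f v with hSdef
  have hmemS : ∀ v, v ∈ S ↔ 0 < f v := by simp [hSdef]
  rcases S.eq_empty_or_nonempty with hS | hS
  · have hzero : ∀ v, f v = 0 := fun v =>
      le_antisymm (not_lt.mp fun h => by simpa [hS] using (hmemS v).mpr h) (hf v)
    simp [hzero]
  obtain ⟨w, hwS, hw⟩ := exists_min_image S f hS
  have hwpos := (hmemS w).mp hwS
  let χ : V → ℝ := fun v => if v ∈ S then 1 else 0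
  let g : V → ℝ := fun v => f v - f w * χ v
  have hg : ∀ v, 0 ≤ g v := fun v => by
    by_cases hv : v ∈ S
    · simpa [g, χ, hv] using hw v hv
    · simpa [g, χ, hv] using hf v
  have hlt : (univ.filter fun v => 0 < g v).card < n := by
    rw [← hn]
    refine card_lt_card ((ssubset_iff_of_subset fun v hv => ?_).mpr ⟨w, hwS, by simp [g, χ, hwS]⟩)
    by_contra hvS
    have hfv := mt (hmemS v).mpr hvS
    simp [g, χ, hvS] at hv
    exact hfv hv
  have hrec := ih _ hlt g hg (by omega) rfl
  have hsum : ∑ v, f v = ∑ v, g v + f w * S.card := by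
    simp [g, χ, sum_sub_distrib, mul_comm]
  have habs : ∑ u, ∑ v, (if G.Adj u v then |f u - f v| else 0) =
      ∑ u, ∑ v, (if G.Adj u v then |g u - g v| else 0) +
        f w * ∑ u, ∑ v, (if G.Adj u v then |χ u - χ v| else 0) := by
    simp only [mul_sum, ← sum_add_distrib]
    refine sum_congr rfl fun u _ => sum_congr rfl fun v _ => ?_
    have hzero : ∀ x, x ∉ S → f x = 0 := fun x hx =>
      le_antisymm (not_lt.mp (mt (hmemS x).mpr hx)) (hf x)
    by_cases ha : G.Adj u v
    · by_cases hu : u ∈ S <;> by_cases hv : v ∈ S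
      · simp [g, χ, hu, hv, ha]
      · have := hw u hu
        simp only [g, χ, hu, hv, ha, hzero v hv, if_true, if_false]
        norm_num
        rw [abs_of_nonneg (hf u), abs_of_nonneg (by linarith)]
        ring
      · have := hw v hv
        simp only [g, χ, hu, hv, ha, hzero u hu, if_true, if_false]
        norm_num
        rw [abs_of_nonneg (hf v), abs_sub_comm, abs_of_nonneg (by linarith)]
        ring
      · simp [g, χ, hu, hv, ha]
    · simp [ha]
  have hcut := cheegerConst_mul_card_le G hS hcard
  rw [hsum, habs, sum_adj_abs_indicator_sub]
  nlinarith [mul_le_mul_of_nonneg_left hcut hwpos.le]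

/-- Cheeger's inequality for nonnegative functions supported on at most half of the vertices. -/
lemma cheegerConst_sq_mul_sum_sq_le {k : ℕ} (hreg : G.IsRegularOfDegree k) (f : V → ℝ)
    (hf : ∀ v, 0 ≤ f v)
    (hcard : 2 * (univ.filter fun v => 0 < f v).card ≤ Fintype.card V) :
    cheegerConst G ^ 2 * ∑ v, f v ^ 2 ≤ 2 * k * edgeEnergy G f := by
  set h := cheegerConst G
  set s := ∑ v, f v ^ 2
  have hh : 0 ≤ h := cheegerConst_nonneg G
  have hs0 : 0 ≤ s := by positivity
  have hsupp : (univ.filter fun v => 0 < f v ^ 2) = univ.filter fun v => 0 < f v := by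
    ext v
    simp [sq_pos_iff, (hf v).lt_iff_ne']
  have hcoarea := two_mul_cheegerConst_mul_sum_le G (fun v => f v ^ 2)
    (fun v => sq_nonneg _) (by simpa only [hsupp] using hcard)
  have hplus : ∑ u, ∑ v, (if G.Adj u v then (f u + f v) ^ 2 else 0) ≤ 4 * k * s := by
    calc ∑ u, ∑ v, (if G.Adj u v then (f u + f v) ^ 2 else 0)
        ≤ ∑ u, ∑ v, (2 * (if G.Adj u v then f u ^ 2 else 0) +
            2 * (if G.Adj u v then f v ^ 2 else 0)) := by
          gcongr with u _ v _
          split_ifs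
          · nlinarith [sq_nonneg (f u - f v)]
          · simp
      _ = 4 * k * s := by
          simp only [sum_add_distrib, ← mul_sum]
          rw [sum_adj_left G hreg fun v => f v ^ 2, sum_adj_right G hreg fun v => f v ^ 2]
          ring
  have hcs : (∑ u, ∑ v, if G.Adj u v then |f u ^ 2 - f v ^ 2| else 0) ^ 2 ≤
      (2 * edgeEnergy G f) * ∑ u, ∑ v, if G.Adj u v then (f u + f v) ^ 2 else 0 := by
    rw [two_mul_edgeEnergy]
    simp only [← Fintype.sum_prod_type']
    simp only [← sum_filter]
    have hfactor : ∀ a b : V, |f a ^ 2 - f b ^ 2| = |f a - f b| * (f a + f b) := fun a b => by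
      rw [sq_sub_sq, abs_mul, abs_of_nonneg (add_nonneg (hf a) (hf b)), mul_comm]
    simpa only [hfactor, sq_abs] using
      sum_mul_sq_le_sq_mul_sq (univ.filter fun p : V × V => G.Adj p.1 p.2)
        (fun p => |f p.1 - f p.2|) (fun p => f p.1 + f p.2)
  have hE : 0 ≤ 2 * edgeEnergy G f := by
    rw [two_mul_edgeEnergy]
    exact sum_nonneg fun u _ => sum_nonneg fun v _ => by split_ifs <;> positivity
  have hsq : (2 * h * s) ^ 2 ≤ (2 * edgeEnergy G f) * (4 * k * s) :=
    (pow_le_pow_left₀ (by positivity) hcoarea 2).trans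
      (hcs.trans (mul_le_mul_of_nonneg_left hplus hE))
  rcases hs0.eq_or_lt with h0 | hpos
  · rw [← h0, mul_zero]
    exact mul_nonneg (by positivity) (by linarith)
  · refine le_of_mul_le_mul_right ?_ hpos
    nlinarith

lemma exists_median [Nonempty V] (f : V → ℝ) :
    ∃ m : ℝ, 2 * (univ.filter fun v => m < f v).card ≤ Fintype.card V ∧
      2 * (univ.filter fun v => f v < m).card ≤ Fintype.card V := by
  let T := univ.filter fun w => 2 * (univ.filter fun v => f w < f v).card ≤ Fintype.card V
  have hT : T.Nonempty := by
    obtain ⟨w, -, hw⟩ := exists_max_image univ f univ_nonempty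
    refine ⟨w, mem_filter.mpr ⟨mem_univ w, ?_⟩⟩
    rw [filter_false_of_mem fun v hv => not_lt.mpr (hw v hv)]
    simp
  obtain ⟨w, hwT, hw⟩ := exists_min_image T f hT
  refine ⟨f w, (mem_filter.mp hwT).2, ?_⟩
  rcases (univ.filter fun v => f v < f w).eq_empty_or_nonempty with hL | hL
  · simp [hL]
  obtain ⟨x, hxL, hx⟩ := exists_max_image _ f hL
  have hxT : x ∉ T := fun hxT => not_lt.mpr (hw x hxT) (mem_filter.mp hxL).2
  have hgt : Fintype.card V < 2 * (univ.filter fun v => f x < f v).card := by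
    simpa [T] using hxT
  have hdisj : Disjoint (univ.filter fun v => f v < f w) (univ.filter fun v => f x < f v) := by
    rw [disjoint_left]
    intro v hv hv'
    exact not_lt.mpr (hx v hv) (mem_filter.mp hv').2
  have hle := card_le_univ
    ((univ.filter fun v => f v < f w) ∪ (univ.filter fun v => f x < f v))
  rw [card_union_of_disjoint hdisj] at hle
  omega

lemma posPart_sub_sq_add_negPart_sub_sq_le (a b : ℝ) :
    (max a 0 - max b 0) ^ 2 + (max (-a) 0 - max (-b) 0) ^ 2 ≤ (a - b) ^ 2 := by
  rcases le_total a 0 with ha | ha <;> rcases le_total b 0 with hb | hb <;>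
    simp [ha, hb] <;> nlinarith

/-- Cheeger's inequality in variational form, for functions of mean zero. -/
lemma cheegerConst_sq_mul_sum_sq_le_of_sum_eq_zero [Nonempty V] {k : ℕ}
    (hreg : G.IsRegularOfDegree k) (f : V → ℝ) (hf : ∑ v, f v = 0) :
    cheegerConst G ^ 2 * ∑ v, f v ^ 2 ≤ 2 * k * edgeEnergy G f := by
  obtain ⟨m, hgt, hlt⟩ := exists_median f
  let p : V → ℝ := fun v => max (f v - m) 0
  let q : V → ℝ := fun v => max (-(f v - m)) 0
  have hp := cheegerConst_sq_mul_sum_sq_le G hreg p (fun v => le_max_right _ _)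
    (by simpa [p] using hgt)
  have hq := cheegerConst_sq_mul_sum_sq_le G hreg q (fun v => le_max_right _ _)
    (by simpa [q] using hlt)
  have hsum : ∑ v, f v ^ 2 ≤ ∑ v, p v ^ 2 + ∑ v, q v ^ 2 := by
    calc ∑ v, f v ^ 2 ≤ ∑ v, f v ^ 2 - 2 * m * ∑ v, f v + ∑ _v : V, m ^ 2 := by
          rw [hf]
          have : 0 ≤ ∑ _v : V, m ^ 2 := by positivity
          linarith
      _ = ∑ v, (p v ^ 2 + q v ^ 2) := by
          rw [mul_sum, ← sum_sub_distrib, ← sum_add_distrib]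
          refine sum_congr rfl fun v _ => ?_
          rcases le_total (f v - m) 0 with h | h
          · simp only [p, q, max_eq_right h, max_eq_left (neg_nonneg.mpr h)]
            ring
          · simp only [p, q, max_eq_left h, max_eq_right (neg_nonpos.mpr h)]
            ring
      _ = _ := sum_add_distrib
  have henergy : edgeEnergy G p + edgeEnergy G q ≤ edgeEnergy G f := by
    simp only [edgeEnergy, ← sum_add_distrib]
    refine sum_le_sum fun e _ => ?_
    induction e using Sym2.ind with
    | _ a b =>
    simpa [p, q] using posPart_sub_sq_add_negPart_sub_sq_le (f a - m) (f b - m)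
  calc cheegerConst G ^ 2 * ∑ v, f v ^ 2
      ≤ cheegerConst G ^ 2 * (∑ v, p v ^ 2 + ∑ v, q v ^ 2) := by gcongr
    _ ≤ 2 * k * (edgeEnergy G p + edgeEnergy G q) := by linarith
    _ ≤ 2 * k * edgeEnergy G f := by gcongr

end

/-- for a finite connected `k`-regular graph, `h(X)^2/(2k^2) ≤ λ₁(X)`. -/
theorem cheeger_ineq_lower {V : Type} [Fintype V] [DecidableEq V]
    (G : SimpleGraph V) [DecidableRel G.Adj] (k : ℕ) (hk : 1 ≤ k)
    (hconn : G.Connected) (hreg : G.IsRegularOfDegree k)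
    (hcard : 2 ≤ Fintype.card V) :
    cheegerConst G ^ 2 / (2 * (k : ℝ) ^ 2) ≤ lambdaOne G k := by
  have : Nontrivial V := Fintype.one_lt_card_iff_nontrivial.mp hcard
  have hk0 : (0 : ℝ) < k := by exact_mod_cast hk
  refine le_csInf ?_ ?_
  · obtain ⟨a, b, hab⟩ := exists_pair_ne V
    refine ⟨_, Pi.single a 1 - Pi.single b 1, fun h => ?_, by simp, rfl⟩
    simpa [hab] using congrFun h a
  · rintro r ⟨f, hf0, hf, rfl⟩
    have hpos : 0 < ∑ v, f v ^ 2 := by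
      obtain ⟨v, hv⟩ := Function.ne_iff.mp hf0
      exact sum_pos' (fun v _ => sq_nonneg _) ⟨v, mem_univ v, sq_pos_of_ne_zero hv⟩
    rw [div_le_div_iff₀ (by positivity) (by positivity)]
    nlinarith [cheegerConst_sq_mul_sum_sq_le_of_sum_eq_zero G hreg f hf]
end

section
/- Let X = (V,E) be a finite connected k-regular simple graph with k ≥ 1 and |V| ≥ 2. Then λ₁(X) ≤ 2·h(X)/k. -/
open Finset

/-- The mean-zero test function of a partition `(A, B)`: `|B|` on `A` and `-|A|` on `B`. -/
def cutFunction {V : Type} [DecidableEq V] (A B : Finset V) (v : V) : ℝ :=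
  if v ∈ A then (B.card : ℝ) else -(A.card : ℝ)

theorem sum_eq_add_of_partition {V : Type} [Fintype V] [DecidableEq V] {A B : Finset V}
    (hd : Disjoint A B) (hU : A ∪ B = univ) (g : V → ℝ) :
    ∑ v, g v = ∑ v ∈ A, g v + ∑ v ∈ B, g v := by
  rw [← hU, sum_union hd]

theorem cutFunction_of_mem_left {V : Type} [DecidableEq V] {A : Finset V} (B : Finset V)
    {v : V} (hv : v ∈ A) : cutFunction A B v = B.card :=
  if_pos hv

theorem cutFunction_of_mem_right {V : Type} [DecidableEq V] {A B : Finset V}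
    (hd : Disjoint A B) {v : V} (hv : v ∈ B) : cutFunction A B v = -(A.card : ℝ) :=
  if_neg (disjoint_right.mp hd hv)

theorem sum_cutFunction {V : Type} [Fintype V] [DecidableEq V] {A B : Finset V}
    (hd : Disjoint A B) (hU : A ∪ B = univ) : ∑ v, cutFunction A B v = 0 := by
  rw [sum_eq_add_of_partition hd hU,
    sum_congr rfl fun v hv => cutFunction_of_mem_left B hv,
    sum_congr rfl fun v hv => cutFunction_of_mem_right hd hv]
  simp only [sum_const, nsmul_eq_mul]
  ring

theorem sum_cutFunction_sq {V : Type} [Fintype V] [DecidableEq V] {A B : Finset V}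
    (hd : Disjoint A B) (hU : A ∪ B = univ) :
    ∑ v, cutFunction A B v ^ 2 = (A.card : ℝ) * B.card * (A.card + B.card) := by
  rw [sum_eq_add_of_partition hd hU,
    sum_congr rfl fun v hv => congrArg (· ^ 2) (cutFunction_of_mem_left B hv),
    sum_congr rfl fun v hv => congrArg (· ^ 2) (cutFunction_of_mem_right hd hv)]
  simp only [sum_const, nsmul_eq_mul]
  ring

theorem edgeEnergy_nonneg {V : Type} [Fintype V] [DecidableEq V]
    (G : SimpleGraph V) [DecidableRel G.Adj] (f : V → ℝ) : 0 ≤ edgeEnergy G f := by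
  refine sum_nonneg fun e _ => ?_
  induction e using Sym2.ind with
  | _ u v => exact sq_nonneg (f u - f v)

theorem edgeEnergy_cutFunction_le {V : Type} [Fintype V] [DecidableEq V]
    (G : SimpleGraph V) [DecidableRel G.Adj] {A B : Finset V}
    (hd : Disjoint A B) (hU : A ∪ B = univ) :
    edgeEnergy G (cutFunction A B) ≤
      (((A ×ˢ B).filter fun p => G.Adj p.1 p.2).card : ℝ) * (A.card + B.card) ^ 2 := by
  set S := (A ×ˢ B).filter fun p => G.Adj p.1 p.2
  have hmem (v : V) : v ∈ A ∨ v ∈ B := by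
    rw [← mem_union, hU]
    exact mem_univ v
  have hsub : S.image (fun p => s(p.1, p.2)) ⊆ G.edgeFinset := by
    intro e he
    obtain ⟨p, hp, rfl⟩ := mem_image.mp he
    simpa using (mem_filter.mp hp).2
  unfold edgeEnergy
  rw [← sum_subset hsub]
  · refine (sum_le_card_nsmul _ _ (((A.card : ℝ) + B.card) ^ 2) ?_).trans ?_
    · intro e he
      obtain ⟨p, hp, rfl⟩ := mem_image.mp he
      obtain ⟨hpA, hpB⟩ := mem_product.mp (mem_filter.mp hp).1
      rw [Sym2.lift_mk]
      simp only [cutFunction_of_mem_left B hpA, cutFunction_of_mem_right hd hpB]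
      exact le_of_eq (by ring)
    · rw [nsmul_eq_mul]
      gcongr
      exact card_image_le
  · intro e
    induction e using Sym2.ind with
    | _ u v =>
      intro he hne
      rw [SimpleGraph.mem_edgeFinset, SimpleGraph.mem_edgeSet] at he
      rw [Sym2.lift_mk]
      rcases hmem u with hu | hu <;> rcases hmem v with hv | hv
      · simp [cutFunction_of_mem_left B hu, cutFunction_of_mem_left B hv]
      · have huv : (u, v) ∈ S := mem_filter.mpr ⟨mem_product.mpr ⟨hu, hv⟩, he⟩
        exact (hne (mem_image.mpr ⟨(u, v), huv, rfl⟩)).elim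
      · have hvu : (v, u) ∈ S := mem_filter.mpr ⟨mem_product.mpr ⟨hv, hu⟩, he.symm⟩
        exact (hne (mem_image.mpr ⟨(v, u), hvu, Sym2.eq_swap⟩)).elim
      · simp [cutFunction_of_mem_right hd hu, cutFunction_of_mem_right hd hv]

theorem lambdaOne_le {V : Type} [Fintype V] [DecidableEq V]
    (G : SimpleGraph V) [DecidableRel G.Adj] (k : ℕ) {f : V → ℝ} (hf : f ≠ 0)
    (hsum : ∑ v, f v = 0) : lambdaOne G k ≤ edgeEnergy G f / (k * ∑ v, f v ^ 2) := by
  refine csInf_le ⟨0, ?_⟩ ⟨f, hf, hsum, rfl⟩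
  rintro r ⟨g, -, -, rfl⟩
  have := edgeEnergy_nonneg G g
  positivity

theorem add_div_mul_le_two_div_min {a b : ℝ} (ha : 0 < a) (hb : 0 < b) :
    (a + b) / (a * b) ≤ 2 / min a b := by
  rw [div_le_div_iff₀ (mul_pos ha hb) (lt_min ha hb)]
  rcases le_total a b with h | h
  · rw [min_eq_left h]
    nlinarith
  · rw [min_eq_right h]
    nlinarith

theorem lambdaOne_le_of_partition {V : Type} [Fintype V] [DecidableEq V]
    (G : SimpleGraph V) [DecidableRel G.Adj] (k : ℕ) {A B : Finset V}
    (hA : A.Nonempty) (hB : B.Nonempty) (hd : Disjoint A B) (hU : A ∪ B = univ) :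
    lambdaOne G k ≤ 2 * ((((A ×ˢ B).filter fun p => G.Adj p.1 p.2).card : ℝ) /
      min (A.card : ℝ) (B.card : ℝ)) / k := by
  have ha : (0 : ℝ) < A.card := by exact_mod_cast hA.card_pos
  have hb : (0 : ℝ) < B.card := by exact_mod_cast hB.card_pos
  have hne : cutFunction A B ≠ 0 := by
    obtain ⟨v, hv⟩ := hA
    intro h
    have hv0 := congrFun h v
    rw [cutFunction_of_mem_left B hv] at hv0
    exact hb.ne' hv0
  refine (lambdaOne_le G k hne (sum_cutFunction hd hU)).trans ?_
  rw [sum_cutFunction_sq hd hU]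
  have hE := edgeEnergy_cutFunction_le G hd hU
  set a : ℝ := (A.card : ℝ)
  set b : ℝ := (B.card : ℝ)
  set c : ℝ := (((A ×ˢ B).filter fun p => G.Adj p.1 p.2).card : ℝ)
  calc edgeEnergy G (cutFunction A B) / (k * (a * b * (a + b)))
      ≤ c * (a + b) ^ 2 / (k * (a * b * (a + b))) := by gcongr
    _ = c * ((a + b) / (a * b)) / k := by field_simp
    _ ≤ c * (2 / min a b) / k := by
      gcongr c * ?_ / k
      exact add_div_mul_le_two_div_min ha hb
    _ = 2 * (c / min a b) / k := by ring

/-- for a finite connected `k`-regular graph, `λ₁(X) ≤ 2h(X)/k`. -/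
theorem cheeger_ineq_upper {V : Type} [Fintype V] [DecidableEq V]
    (G : SimpleGraph V) [DecidableRel G.Adj] (k : ℕ) (hk : 1 ≤ k)
    (hconn : G.Connected) (hreg : G.IsRegularOfDegree k)
    (hcard : 2 ≤ Fintype.card V) :
    lambdaOne G k ≤ 2 * cheegerConst G / (k : ℝ) := by
  have hk' : (0 : ℝ) < k := by exact_mod_cast hk
  suffices h : k * lambdaOne G k / 2 ≤ cheegerConst G by
    rw [le_div_iff₀ hk']
    linarith
  refine le_csInf ?_ ?_
  · obtain ⟨u, v, huv⟩ := Fintype.one_lt_card_iff.mp hcard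
    exact ⟨_, {u}, {u}ᶜ, singleton_nonempty u, ⟨v, by simpa using huv.symm⟩,
      disjoint_compl_right, union_compl _, rfl⟩
  · rintro r ⟨A, B, hA, hB, hd, hU, rfl⟩
    have h := lambdaOne_le_of_partition G k hA hB hd hU
    rw [le_div_iff₀ hk'] at h
    linarith
end

section
/- Let q ≥ 2 and let X = (V,E) be a finite connected (q+1)-regular simple graph with adjacency matrix A, and let μ(X) be the maximum of |λ| over eigenvalues λ of A with |λ| ≠ q+1. Let T be a (q+1)-regular tree and π : T → X a graph covering map. For f ∈ L²₀₀(X) and a fixed vertex t₀ of T, define f̃(t) = (1/|S_r|)·Σ_{s∈S_r} f(π(s)), where r = dist(t,t₀) and S_r is the set of vertices of T at distance r from t₀. Then for every real p ∈ [2,∞): μ(X) ≤ q^{1/p} + q^{(p-1)/p} if and only if for every f ∈ L²₀₀(X), every vertex t₀ of T, and every ε > 0, one has Σ_{t ∈ V(T)} |f̃(t)|^{p+ε} < ∞. -/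
open Finset
open scoped Classical

/-- `S` is one side of a bipartition of `G`: every edge goes between `S` and its complement. -/
def IsBipartitionSet {V : Type} (G : SimpleGraph V) (S : Set V) : Prop :=
  ∀ a b : V, G.Adj a b → (a ∈ S ↔ b ∉ S)

/-- Membership in `L²₀₀(X)`: if `X` is bipartite with parts `V₀, V₁`, the sum of `f`
over each part vanishes; if `X` is not bipartite, the total sum of `f` vanishes. -/
noncomputable def MemL200 {V : Type} [Fintype V] (G : SimpleGraph V) (f : V → ℝ) : Prop :=
  if ∃ S : Set V, IsBipartitionSet G S then
    ∀ S : Set V, IsBipartitionSet G S →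
      (∑ v ∈ Finset.univ.filter (· ∈ S), f v) = 0 ∧
      (∑ v ∈ Finset.univ.filter (· ∉ S), f v) = 0
  else ∑ v, f v = 0

/-- `μ(X)`: the maximum of `|λ|` over eigenvalues `λ` of the adjacency matrix
with `|λ| ≠ q + 1`. -/
noncomputable def muX {V : Type} [Fintype V] [DecidableEq V]
    (G : SimpleGraph V) [DecidableRel G.Adj] (q : ℕ) : ℝ :=
  sSup {r : ℝ | ∃ lam : ℝ, ∃ f : V → ℝ, f ≠ 0 ∧
    (G.adjMatrix ℝ).mulVec f = lam • f ∧ |lam| ≠ (q + 1 : ℝ) ∧ r = |lam|}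

/-- The averaging `f̃` of the lift of `f` along `π` over spheres around `t₀`:
`f̃(t) = (1/|S_r|) ∑_{s ∈ S_r} f(π s)` where `r = dist(t, t₀)`. -/
noncomputable def ftilde {V VT : Type} (T : SimpleGraph VT) (π : VT → V)
    (f : V → ℝ) (t₀ t : VT) : ℝ :=
  (1 / ({s : VT | T.dist s t₀ = T.dist t t₀}.ncard : ℝ)) *
    ∑ᶠ s ∈ {s : VT | T.dist s t₀ = T.dist t t₀}, f (π s)

namespace SimpleGraph

section Sphere

variable {W : Type} {T : SimpleGraph W}

/-- In a tree, every vertex other than the root has exactly one neighbor closer to the root. -/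
theorem IsTree.existsUnique_adj_dist_add_one (hT : T.IsTree) {t₀ u : W} (hu : u ≠ t₀) :
    ∃! w, T.Adj u w ∧ T.dist w t₀ + 1 = T.dist u t₀ := by
  obtain ⟨p, hp⟩ := hT.connected.exists_walk_length_eq_dist u t₀
  cases p with
  | nil => exact absurd rfl hu
  | @cons _ w _ h p' =>
    have key : ∀ v, T.Adj u v → T.dist v t₀ + 1 = T.dist u t₀ → v = w := by
      intro v hv hd
      obtain ⟨r, hr⟩ := hT.connected.exists_walk_length_eq_dist v t₀
      have h1 : (Walk.cons h p').IsPath := Walk.isPath_of_length_eq_dist _ hp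
      have h2 : (Walk.cons hv r).IsPath :=
        Walk.isPath_of_length_eq_dist _ (by rw [Walk.length_cons, hr, hd])
      have h3 := (hT.existsUnique_path u t₀).unique h2 h1
      have h4 := congrArg Walk.snd h3
      simpa using h4
    refine ⟨w, ⟨h, ?_⟩, fun v hv => key v hv.1 hv.2⟩
    have h1 : T.dist w t₀ ≤ p'.length := T.dist_le p'
    have h2 : T.dist u t₀ ≤ T.dist u w + T.dist w t₀ := hT.connected.dist_triangle
    rw [dist_eq_one_iff_adj.mpr h] at h2
    rw [Walk.length_cons] at hp
    omega

theorem Connected.finite_setOf_dist_eq (hT : T.Connected)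
    (hfin : ∀ t, (T.neighborSet t).Finite) (t₀ : W) (r : ℕ) :
    {s : W | T.dist s t₀ = r}.Finite := by
  induction r with
  | zero =>
    refine (Set.finite_singleton t₀).subset fun s hs => ?_
    exact (hT.dist_eq_zero_iff).mp hs
  | succ r ih =>
    refine (ih.biUnion fun t _ => hfin t).subset fun s hs => ?_
    obtain ⟨p, hp⟩ := hT.exists_walk_length_eq_dist s t₀
    have hs' : T.dist s t₀ = r + 1 := hs
    cases p with
    | nil => simp at hs'
    | @cons _ w _ h p' =>
      refine Set.mem_biUnion (x := w) ?_ h.symm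
      have h1 : T.dist w t₀ ≤ p'.length := T.dist_le p'
      have h2 : T.dist s t₀ ≤ T.dist s w + T.dist w t₀ := hT.dist_triangle
      rw [dist_eq_one_iff_adj.mpr h] at h2
      rw [Walk.length_cons] at hp
      change T.dist w t₀ = r
      omega

/-- The sum of `g` over the sphere of radius `r` around `t₀`. -/
noncomputable def sphereSum (T : SimpleGraph W) (t₀ : W) (g : W → ℝ) (r : ℕ) : ℝ :=
  ∑ᶠ s ∈ {s : W | T.dist s t₀ = r}, g s

variable {q : ℕ}

/-- In a `(q+1)`-regular tree, the number of neighbors away from the root. -/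
theorem IsTree.card_filter_dist_succ (hT : T.IsTree) [T.LocallyFinite]
    (hreg : T.IsRegularOfDegree (q + 1)) (t₀ u : W) :
    #{s ∈ T.neighborFinset u | T.dist s t₀ = T.dist u t₀ + 1} =
      if T.dist u t₀ = 0 then q + 1 else q := by
  have hsplit := Finset.card_filter_add_card_filter_not (s := T.neighborFinset u)
    (fun s => T.dist s t₀ = T.dist u t₀ + 1)
  rw [T.card_neighborFinset_eq_degree, hreg u] at hsplit
  have hnot : #{s ∈ T.neighborFinset u | ¬ T.dist s t₀ = T.dist u t₀ + 1} =
      if T.dist u t₀ = 0 then 0 else 1 := by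
    split_ifs with h0
    · rw [Finset.card_eq_zero, Finset.filter_eq_empty_iff]
      intro s hs
      rw [mem_neighborFinset] at hs
      have := hT.dist_eq_dist_add_one_of_adj t₀ hs
      rw [T.dist_comm (u := t₀), T.dist_comm (u := t₀)] at this
      omega
    · have hu : u ≠ t₀ := fun h => h0 (by simp [h])
      obtain ⟨w, hw, huniq⟩ := hT.existsUnique_adj_dist_add_one hu
      rw [Finset.card_eq_one]
      refine ⟨w, ?_⟩
      ext s
      simp only [Finset.mem_filter, mem_neighborFinset, Finset.mem_singleton]
      constructor
      · rintro ⟨hs, hd⟩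
        refine huniq s ⟨hs, ?_⟩
        have := hT.dist_eq_dist_add_one_of_adj t₀ hs
        rw [T.dist_comm (u := t₀), T.dist_comm (u := t₀)] at this
        omega
      · rintro rfl
        exact ⟨hw.1, by omega⟩
  rw [hnot] at hsplit
  split_ifs at hsplit ⊢ <;> omega

theorem IsTree.card_filter_dist_pred (hT : T.IsTree) [T.LocallyFinite] (t₀ u : W) (r : ℕ)
    (hu : T.dist u t₀ = r + 1) :
    #{s ∈ T.neighborFinset u | T.dist s t₀ = r} = 1 := by
  have hne : u ≠ t₀ := fun h => by simp [h] at hu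
  obtain ⟨w, hw, huniq⟩ := hT.existsUnique_adj_dist_add_one hne
  rw [Finset.card_eq_one]
  refine ⟨w, ?_⟩
  ext s
  simp only [Finset.mem_filter, mem_neighborFinset, Finset.mem_singleton]
  constructor
  · rintro ⟨hs, hd⟩
    exact huniq s ⟨hs, by omega⟩
  · rintro rfl
    exact ⟨hw.1, by omega⟩

theorem Connected.sphereSum_eq_sum (hT : T.Connected) (hfin : ∀ t, (T.neighborSet t).Finite)
    (t₀ : W) (g : W → ℝ) (r : ℕ) :
    T.sphereSum t₀ g r = ∑ s ∈ (hT.finite_setOf_dist_eq hfin t₀ r).toFinset, g s :=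
  finsum_mem_eq_finite_toFinset_sum _ _

theorem Connected.sphereSum_zero (hT : T.Connected) (t₀ : W) (g : W → ℝ) :
    T.sphereSum t₀ g 0 = g t₀ := by
  have : {s : W | T.dist s t₀ = 0} = {t₀} := by
    ext s
    exact hT.dist_eq_zero_iff
  rw [sphereSum, this, finsum_mem_singleton]

theorem sphereSum_one [T.LocallyFinite] (t₀ : W) (g : W → ℝ) :
    T.sphereSum t₀ g 1 = ∑ s ∈ T.neighborFinset t₀, g s := by
  rw [sphereSum]
  have : {s : W | T.dist s t₀ = 1} = (T.neighborFinset t₀ : Set W) := by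
    ext s
    simp [dist_eq_one_iff_adj, adj_comm]
  rw [this, finsum_mem_coe_finset]

theorem IsTree.sum_sphere_sum_neighborFinset (hT : T.IsTree) [T.LocallyFinite]
    (hreg : T.IsRegularOfDegree (q + 1)) (t₀ : W) (g : W → ℝ) (r : ℕ) :
    T.sphereSum t₀ (fun s => ∑ u ∈ T.neighborFinset s, g u) (r + 1) =
      T.sphereSum t₀ g (r + 2) + (if r = 0 then (q + 1 : ℝ) else q) * T.sphereSum t₀ g r := by
  have hfin : ∀ t, (T.neighborSet t).Finite := fun t => Set.toFinite _
  simp only [hT.connected.sphereSum_eq_sum hfin]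
  have hsplit : ∀ s ∈ (hT.connected.finite_setOf_dist_eq hfin t₀ (r + 1)).toFinset,
      ∑ u ∈ T.neighborFinset s, g u =
        ∑ u ∈ T.neighborFinset s with T.dist u t₀ = r + 2, g u +
        ∑ u ∈ T.neighborFinset s with T.dist u t₀ = r, g u := by
    intro s hs
    rw [Set.Finite.mem_toFinset, Set.mem_ofPred_eq] at hs
    rw [← Finset.sum_filter_add_sum_filter_not (T.neighborFinset s)
      (fun u => T.dist u t₀ = r + 2)]
    congr 1
    refine Finset.sum_congr (Finset.filter_congr fun u hu => ?_) fun _ _ => rfl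
    rw [mem_neighborFinset] at hu
    have := hT.dist_eq_dist_add_one_of_adj t₀ hu
    rw [T.dist_comm (u := t₀), T.dist_comm (u := t₀)] at this
    omega
  rw [Finset.sum_congr rfl hsplit, Finset.sum_add_distrib]
  congr 1
  · rw [Finset.sum_comm' (t' := (hT.connected.finite_setOf_dist_eq hfin t₀ (r + 2)).toFinset)
      (s' := fun u => {s ∈ T.neighborFinset u | T.dist s t₀ = r + 1})]
    · refine Finset.sum_congr rfl fun u hu => ?_
      rw [Set.Finite.mem_toFinset, Set.mem_ofPred_eq] at hu
      rw [Finset.sum_const, hT.card_filter_dist_pred t₀ u (r + 1) hu, one_smul]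
    · intro s u
      simp only [Set.Finite.mem_toFinset, Set.mem_ofPred_eq, Finset.mem_filter,
        mem_neighborFinset, T.adj_comm s u]
      tauto
  · rw [Finset.sum_comm' (t' := (hT.connected.finite_setOf_dist_eq hfin t₀ r).toFinset)
      (s' := fun u => {s ∈ T.neighborFinset u | T.dist s t₀ = r + 1}), Finset.mul_sum]
    · refine Finset.sum_congr rfl fun u hu => ?_
      rw [Set.Finite.mem_toFinset, Set.mem_ofPred_eq] at hu
      subst hu
      rw [Finset.sum_const, hT.card_filter_dist_succ hreg t₀ u, nsmul_eq_mul]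
      split_ifs <;> simp
    · intro s u
      simp only [Set.Finite.mem_toFinset, Set.mem_ofPred_eq, Finset.mem_filter,
        mem_neighborFinset, T.adj_comm s u]
      tauto

theorem IsTree.ncard_setOf_dist_eq (hT : T.IsTree) [T.LocallyFinite]
    (hreg : T.IsRegularOfDegree (q + 1)) (t₀ : W) (r : ℕ) :
    ({s : W | T.dist s t₀ = r + 1}.ncard : ℝ) = (q + 1) * q ^ r := by
  have hfin : ∀ t, (T.neighborSet t).Finite := fun t => Set.toFinite _
  have hcard : ∀ n, ({s : W | T.dist s t₀ = n}.ncard : ℝ) = T.sphereSum t₀ (fun _ => 1) n := by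
    intro n
    rw [hT.connected.sphereSum_eq_sum hfin, Finset.sum_const, nsmul_one,
      Set.ncard_eq_toFinset_card _ (hT.connected.finite_setOf_dist_eq hfin t₀ n)]
  rw [hcard]
  have hrec := hT.sum_sphere_sum_neighborFinset hreg t₀ (fun _ => 1)
  have h0 : T.sphereSum t₀ (fun _ => (1 : ℝ)) 0 = 1 := hT.connected.sphereSum_zero t₀ _
  have h1 : T.sphereSum t₀ (fun _ => (1 : ℝ)) 1 = q + 1 := by
    rw [sphereSum_one, Finset.sum_const, T.card_neighborFinset_eq_degree, hreg t₀]
    simp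
  have hconst : ∀ n, T.sphereSum t₀ (fun s => ∑ u ∈ T.neighborFinset s, (1 : ℝ)) n =
      (q + 1) * T.sphereSum t₀ (fun _ => (1 : ℝ)) n := by
    intro n
    simp only [hT.connected.sphereSum_eq_sum hfin, Finset.sum_const,
      T.card_neighborFinset_eq_degree, hreg.degree_eq]
    simp only [nsmul_eq_mul, mul_one]
    push_cast
    ring
  simp only [hconst] at hrec
  induction r using Nat.twoStepInduction with
  | zero => simpa using h1
  | one =>
    have := hrec 0
    rw [h0, zero_add, h1] at this
    simp at this ⊢
    linarith
  | more n ih1 ih2 =>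
    have := hrec (n + 1)
    rw [if_neg (Nat.succ_ne_zero n), ih1, show n + 1 + 1 = (n + 1) + 1 from rfl, ih2] at this
    rw [show n + 2 + 1 = n + 1 + 2 from rfl]
    rw [pow_succ (q : ℝ) (n + 1), pow_succ (q : ℝ) n] at *
    linear_combination -this

end Sphere

end SimpleGraph

namespace SimpleGraph

section Spectrum

variable {V : Type} {G : SimpleGraph V}

theorem Preconnected.forall_eq_of_forall_adj (hG : G.Preconnected) {α : Type*} {φ : V → α}
    (h : ∀ v w, G.Adj v w → φ v = φ w) (v w : V) : φ v = φ w := by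
  obtain ⟨p⟩ := hG v w
  induction p with
  | nil => rfl
  | cons hadj _ ih => exact (h _ _ hadj).trans ih

theorem _root_.MemL200.sum_eq_zero [Fintype V] {f : V → ℝ} (hf : MemL200 G f) : ∑ v, f v = 0 := by
  rw [MemL200] at hf
  split_ifs at hf with hbip
  · obtain ⟨S, hS⟩ := hbip
    obtain ⟨h1, h2⟩ := hf S hS
    rw [← Finset.sum_filter_add_sum_filter_not _ (· ∈ S), h1, h2, add_zero]
  · exact hf

variable [Fintype V] [DecidableRel G.Adj] {d : ℕ}

theorem IsRegularOfDegree.sum_sum_neighborFinset (hreg : G.IsRegularOfDegree d) (g : V → ℝ) :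
    ∑ v, ∑ w ∈ G.neighborFinset v, g w = d * ∑ v, g v := by
  rw [Finset.sum_comm' (t' := Finset.univ) (s' := fun w => G.neighborFinset w)
    (by intro x y; simp [G.adj_comm]), Finset.mul_sum]
  refine Finset.sum_congr rfl fun w _ => ?_
  rw [Finset.sum_const, G.card_neighborFinset_eq_degree, hreg w, nsmul_eq_mul]

theorem IsRegularOfDegree.sum_sum_neighborFinset_of_bipartition (hreg : G.IsRegularOfDegree d)
    {S : Set V} (hS : IsBipartitionSet G S) (g : V → ℝ) :
    ∑ v with v ∈ S, ∑ w ∈ G.neighborFinset v, g w = d * ∑ v with v ∉ S, g v := by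
  rw [Finset.sum_comm' (t' := Finset.univ.filter (· ∉ S)) (s' := fun w => G.neighborFinset w),
    Finset.mul_sum]
  · refine Finset.sum_congr rfl fun w _ => ?_
    rw [Finset.sum_const, G.card_neighborFinset_eq_degree, hreg w, nsmul_eq_mul]
  · intro x y
    simp only [Finset.mem_filter, Finset.mem_univ, true_and, mem_neighborFinset, G.adj_comm y x]
    constructor
    · rintro ⟨h1, h2⟩
      exact ⟨h2, (hS x y h2).mp h1⟩
    · rintro ⟨h1, h2⟩
      exact ⟨(hS x y h1).mpr h2, h1⟩

theorem IsRegularOfDegree.sum_sum_sub_sq (hreg : G.IsRegularOfDegree d) {f : V → ℝ} {lam : ℝ}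
    (hf : ∀ v, ∑ w ∈ G.neighborFinset v, f w = lam * f v) {σ : ℝ} (hσ : σ ^ 2 = 1) :
    ∑ v, ∑ w ∈ G.neighborFinset v, (f v - σ * f w) ^ 2 = 2 * (d - σ * lam) * ∑ v, f v ^ 2 := by
  have h1 : ∀ v, ∑ w ∈ G.neighborFinset v, (f v - σ * f w) ^ 2 =
      d * f v ^ 2 - 2 * σ * lam * f v ^ 2 + ∑ w ∈ G.neighborFinset v, f w ^ 2 := by
    intro v
    have : ∀ w, (f v - σ * f w) ^ 2 = f v ^ 2 - 2 * σ * f v * f w + f w ^ 2 := by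
      intro w
      linear_combination f w ^ 2 * hσ
    simp only [this, Finset.sum_add_distrib, Finset.sum_sub_distrib, ← Finset.mul_sum, hf v,
      Finset.sum_const, G.card_neighborFinset_eq_degree, hreg v, nsmul_eq_mul]
    ring
  simp only [h1, Finset.sum_add_distrib, Finset.sum_sub_distrib, ← Finset.mul_sum,
    hreg.sum_sum_neighborFinset (fun w => f w ^ 2)]
  ring

theorem IsRegularOfDegree.abs_eigenvalue_le (hreg : G.IsRegularOfDegree d) {f : V → ℝ} {lam : ℝ}
    (hf : ∀ v, ∑ w ∈ G.neighborFinset v, f w = lam * f v) (hne : f ≠ 0) : |lam| ≤ d := by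
  obtain ⟨v, hv⟩ := Function.ne_iff.mp hne
  have hpos : 0 < ∑ v, f v ^ 2 := Finset.sum_pos' (fun i _ => sq_nonneg _)
    ⟨v, Finset.mem_univ v, by positivity [show f v ≠ 0 from hv]⟩
  have key : ∀ σ : ℝ, σ ^ 2 = 1 → σ * lam ≤ d := by
    intro σ hσ
    have h := hreg.sum_sum_sub_sq hf hσ
    have h0 : 0 ≤ ∑ v, ∑ w ∈ G.neighborFinset v, (f v - σ * f w) ^ 2 :=
      Finset.sum_nonneg fun _ _ => Finset.sum_nonneg fun _ _ => sq_nonneg _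
    rw [h] at h0
    by_contra hlt
    push Not at hlt
    nlinarith
  rw [abs_le]
  constructor <;> linarith [key 1 (by norm_num), key (-1) (by norm_num)]

theorem IsRegularOfDegree.eq_mul_of_adj (hreg : G.IsRegularOfDegree d) {f : V → ℝ} {lam : ℝ}
    (hf : ∀ v, ∑ w ∈ G.neighborFinset v, f w = lam * f v) {σ : ℝ} (hσ : σ ^ 2 = 1)
    (hlam : σ * lam = d) {v w : V} (h : G.Adj v w) : f v = σ * f w := by
  have h0 := hreg.sum_sum_sub_sq hf hσ
  rw [hlam, sub_self, mul_zero, zero_mul,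
    Finset.sum_eq_zero_iff_of_nonneg fun _ _ => Finset.sum_nonneg fun _ _ => sq_nonneg _] at h0
  have h1 := h0 v (Finset.mem_univ v)
  rw [Finset.sum_eq_zero_iff_of_nonneg fun _ _ => sq_nonneg _] at h1
  have h2 := h1 w ((G.mem_neighborFinset v w).mpr h)
  have h3 := pow_eq_zero_iff (two_ne_zero) |>.mp h2
  linarith

theorem IsRegularOfDegree.memL200_of_eigenvector (hreg : G.IsRegularOfDegree d) {f : V → ℝ}
    {lam : ℝ} (hf : ∀ v, ∑ w ∈ G.neighborFinset v, f w = lam * f v) (hlam : |lam| ≠ d) :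
    MemL200 G f := by
  rw [MemL200]
  split_ifs with hbip
  · intro S hS
    have hSc : IsBipartitionSet G Sᶜ := by
      intro a b hab
      have := hS a b hab
      simp only [Set.mem_compl_iff]
      tauto
    have h1 := hreg.sum_sum_neighborFinset_of_bipartition hS f
    have h2 := hreg.sum_sum_neighborFinset_of_bipartition hSc f
    simp only [hf, ← Finset.mul_sum, Set.mem_compl_iff, not_not] at h1 h2
    have hsq : lam ^ 2 - (d : ℝ) ^ 2 ≠ 0 := by
      intro h
      refine hlam ?_
      have : |lam| ^ 2 = (d : ℝ) ^ 2 := by rw [sq_abs]; linarith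
      exact (pow_left_inj₀ (abs_nonneg _) (Nat.cast_nonneg _) two_ne_zero).mp this
    constructor
    · refine (mul_eq_zero_iff_left hsq).mp ?_
      linear_combination lam * h1 + d * h2
    · refine (mul_eq_zero_iff_left hsq).mp ?_
      linear_combination lam * h2 + d * h1
  · have h1 := hreg.sum_sum_neighborFinset f
    simp only [hf, ← Finset.mul_sum] at h1
    have : lam - d ≠ 0 := by
      intro h
      refine hlam ?_
      rw [sub_eq_zero.mp h, abs_of_nonneg (Nat.cast_nonneg _)]
    refine (mul_eq_zero_iff_left this).mp ?_
    linear_combination h1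

theorem IsRegularOfDegree.sum_mul_eq_zero_of_memL200 (hreg : G.IsRegularOfDegree d)
    (hconn : G.Preconnected) {f g : V → ℝ} {lam : ℝ} (hf : MemL200 G f)
    (hg : ∀ v, ∑ w ∈ G.neighborFinset v, g w = lam * g v) (hlam : |lam| = d) :
    ∑ v, g v * f v = 0 := by
  by_cases hg0 : g = 0
  · simp [hg0]
  obtain ⟨v₀, hv₀⟩ := Function.ne_iff.mp hg0
  simp only [Pi.zero_apply] at hv₀
  rcases abs_choice lam with habs | habs
  · have hadj : ∀ v w, G.Adj v w → g v = g w := fun v w h => by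
      simpa using hreg.eq_mul_of_adj hg (σ := 1) (by norm_num) (by linarith) h
    have hconst : ∀ v, g v = g v₀ := fun v => hconn.forall_eq_of_forall_adj hadj v v₀
    simp only [hconst, ← Finset.mul_sum, hf.sum_eq_zero, mul_zero]
  · have hadj : ∀ v w, G.Adj v w → g v = - g w := fun v w h => by
      simpa using hreg.eq_mul_of_adj hg (σ := -1) (by norm_num) (by linarith) h
    have hconst : ∀ v, |g v| = |g v₀| := fun v =>
      hconn.forall_eq_of_forall_adj (φ := fun v => |g v|)
        (fun v w h => by simp only [hadj v w h, abs_neg]) v v₀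
    have hne : ∀ v, g v ≠ 0 := fun v => by
      rw [← abs_pos, hconst v, abs_pos]
      exact hv₀
    have hS : IsBipartitionSet G {v | 0 < g v} := by
      intro a b hab
      have h1 := hadj a b hab
      have h2 := hne b
      simp only [Set.mem_ofPred_eq, not_lt]
      constructor
      · intro h
        linarith
      · intro h
        have := lt_of_le_of_ne h h2
        linarith
    rw [MemL200, if_pos ⟨_, hS⟩] at hf
    obtain ⟨h1, h2⟩ := hf _ hS
    rw [← Finset.sum_filter_add_sum_filter_not _ (· ∈ {v | 0 < g v})]
    have e1 : ∑ v with v ∈ {v | 0 < g v}, g v * f v =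
        |g v₀| * ∑ v with v ∈ {v | 0 < g v}, f v := by
      rw [Finset.mul_sum]
      refine Finset.sum_congr rfl fun v hv => ?_
      have : 0 < g v := by simpa using hv
      rw [← hconst v, abs_of_pos this]
    have e2 : ∑ v with v ∉ {v | 0 < g v}, g v * f v =
        -|g v₀| * ∑ v with v ∉ {v | 0 < g v}, f v := by
      rw [Finset.mul_sum]
      refine Finset.sum_congr rfl fun v hv => ?_
      have : g v ≤ 0 := by simpa using hv
      rw [← hconst v, abs_of_nonpos this, neg_neg]
    rw [e1, e2, h1, h2]
    simp

end Spectrum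

end SimpleGraph

section Recurrence

theorem norm_le_of_add_eq_of_mul_eq {a b lam : ℝ} (ha : 0 < a) (hab : a ≤ b)
    (hlam : |lam| ≤ a + b) {α β : ℂ} (hadd : α + β = lam) (hmul : α * β = (a * b : ℝ)) :
    ‖α‖ ≤ b := by
  have him : α.im + β.im = 0 := by simpa using congrArg Complex.im hadd
  have hre : α.re + β.re = lam := by simpa using congrArg Complex.re hadd
  have hmre : α.re * β.re - α.im * β.im = a * b := by
    have := congrArg Complex.re hmul
    rwa [Complex.mul_re, Complex.ofReal_re] at this
  have hmim : α.re * β.im + α.im * β.re = 0 := by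
    have := congrArg Complex.im hmul
    rwa [Complex.mul_im, Complex.ofReal_im] at this
  have hβ : β.im = - α.im := by linarith
  rw [hβ] at hmre hmim
  have h : α.im * (β.re - α.re) = 0 := by linarith
  have hb : 0 ≤ b := by linarith
  rcases mul_eq_zero.mp h with h | h
  · have hα : α = (α.re : ℂ) := by
      apply Complex.ext <;> simp [h]
    rw [hα, Complex.norm_real, Real.norm_eq_abs]
    by_contra! hlt
    have h1 : 0 < (|α.re| - a) * (|α.re| - b) := mul_pos (by linarith) (by linarith)
    have h2 : lam * α.re ≤ (a + b) * |α.re| :=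
      (le_abs_self _).trans (by rw [abs_mul]; gcongr)
    have h3 : |α.re| * |α.re| = α.re * α.re := abs_mul_abs_self _
    rw [h] at hmre
    rw [← hre] at h2
    nlinarith
  · have hsq : ‖α‖ ^ 2 ≤ b ^ 2 := by
      rw [Complex.sq_norm, Complex.normSq_apply]
      have : β.re = α.re := by linarith
      rw [this] at hmre
      nlinarith
    exact (pow_le_pow_iff_left₀ (norm_nonneg _) hb two_ne_zero).mp hsq

/-- Growth of solutions of a linear recurrence whose characteristic roots have norm at most `b`. -/
theorem exists_abs_le_of_recurrence {a b lam : ℝ} (ha : 0 < a) (hab : a ≤ b)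
    (hlam : |lam| ≤ a + b) {Q : ℕ → ℝ}
    (hQ : ∀ n, Q (n + 2) = lam * Q (n + 1) - a * b * Q n) :
    ∃ C : ℝ, 0 ≤ C ∧ ∀ n : ℕ, |Q n| ≤ C * (n + 1) * b ^ n := by
  obtain ⟨s, hs⟩ := IsAlgClosed.exists_pow_nat_eq ((lam : ℂ) ^ 2 - 4 * (a * b : ℝ)) two_pos
  set α : ℂ := (lam + s) / 2 with hα
  set β : ℂ := (lam - s) / 2 with hβ
  have hadd : α + β = lam := by rw [hα, hβ]; ring
  have hmul : α * β = (a * b : ℝ) := by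
    rw [hα, hβ]
    linear_combination (-1 / 4) * hs
  have hαb : ‖α‖ ≤ b := norm_le_of_add_eq_of_mul_eq ha hab hlam hadd hmul
  have hβb : ‖β‖ ≤ b :=
    norm_le_of_add_eq_of_mul_eq ha hab hlam (by rw [add_comm, hadd]) (by rw [mul_comm, hmul])
  have hb : 0 < b := by linarith
  have hD : ∀ n, (Q (n + 1) : ℂ) - α * Q n = β ^ n * (Q 1 - α * Q 0) := by
    intro n
    induction n with
    | zero => simp
    | succ n ih =>
      have h1 : (Q (n + 1 + 1) : ℂ) = lam * Q (n + 1) - (a * b : ℝ) * Q n := by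
        rw [show n + 1 + 1 = n + 2 from rfl, hQ n]
        push_cast
        ring
      rw [h1, ← hadd, ← hmul, pow_succ]
      linear_combination β * ih
  set D := ‖(Q 1 : ℂ) - α * Q 0‖
  have hD0 : 0 ≤ D := norm_nonneg _
  refine ⟨|Q 0| + D / b, by positivity, fun n => ?_⟩
  induction n with
  | zero =>
    have : 0 ≤ D / b := by positivity
    simpa using this
  | succ n ih =>
    have h1 : (Q (n + 1) : ℂ) = α * Q n + β ^ n * (Q 1 - α * Q 0) := by
      linear_combination hD n
    have h2 : |Q (n + 1)| ≤ b * |Q n| + b ^ n * D := by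
      rw [← Real.norm_eq_abs, ← Complex.norm_real, h1]
      refine (norm_add_le _ _).trans ?_
      rw [norm_mul, norm_mul, norm_pow, Complex.norm_real, Real.norm_eq_abs]
      gcongr
    have h3 : b ^ n * D = D / b * b ^ (n + 1) := by
      field_simp
      ring
    have h4 : b * |Q n| ≤ b * ((|Q 0| + D / b) * (n + 1) * b ^ n) := by gcongr
    have h5 : 0 ≤ |Q 0| * b ^ (n + 1) := by positivity
    rw [h3] at h2
    push_cast
    calc |Q (n + 1)| ≤ b * ((|Q 0| + D / b) * (n + 1) * b ^ n) + D / b * b ^ (n + 1) := by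
          linarith
      _ ≤ b * ((|Q 0| + D / b) * (n + 1) * b ^ n) + D / b * b ^ (n + 1) + |Q 0| * b ^ (n + 1) := by
          linarith
      _ = (|Q 0| + D / b) * (n + 1 + 1) * b ^ (n + 1) := by ring

theorem exists_add_eq_mul_eq_lt_abs {a b lam : ℝ} (ha : 0 < a) (hab : a ≤ b)
    (hlam : a + b < |lam|) : ∃ α β : ℝ, α + β = lam ∧ α * β = a * b ∧ b < |α| := by
  have key : ∀ l : ℝ, a + b < l → ∃ α β : ℝ, α + β = l ∧ α * β = a * b ∧ b < |α| := by
    intro l hl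
    have hdisc : 0 ≤ l ^ 2 - 4 * (a * b) := by nlinarith [sq_nonneg (a - b)]
    have hs := Real.sq_sqrt hdisc
    have hs0 := Real.sqrt_nonneg (l ^ 2 - 4 * (a * b))
    set s := √(l ^ 2 - 4 * (a * b))
    have hmul : (l + s) / 2 * ((l - s) / 2) = a * b := by linear_combination (-1 / 4) * hs
    refine ⟨(l + s) / 2, (l - s) / 2, by ring, hmul, lt_of_lt_of_le ?_ (le_abs_self _)⟩
    by_contra! hle
    have hpos : 0 < (l + s) / 2 := by linarith
    have h1 : a < (l - s) / 2 := by linarith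
    have h2 : a < (l + s) / 2 := by linarith
    nlinarith
  rcases abs_choice lam with h | h
  · rw [h] at hlam
    exact key lam hlam
  · rw [h] at hlam
    obtain ⟨α, β, h1, h2, h3⟩ := key _ hlam
    exact ⟨-α, -β, by linarith, by linarith, by rwa [abs_neg]⟩

theorem sub_mul_eq_of_recurrence {α β c lam : ℝ} (hadd : α + β = lam) (hmul : α * β = c)
    {Q : ℕ → ℝ} (hQ : ∀ n, Q (n + 2) = lam * Q (n + 1) - c * Q n) (n : ℕ) :
    Q (n + 1) - β * Q n = α ^ n * (Q 1 - β * Q 0) := by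
  induction n with
  | zero => simp
  | succ n ih =>
    rw [show n + 1 + 1 = n + 2 from rfl, hQ n, ← hadd, ← hmul, pow_succ]
    linear_combination α * ih

end Recurrence

section Summability

open Filter Topology

theorem mul_abs_div_rpow {M x s : ℝ} (hM : 0 < M) (hs : 0 < s) :
    M * |x / M| ^ s = (|x| * M ^ ((1 - s) / s)) ^ s := by
  rw [abs_div, abs_of_pos hM, Real.div_rpow (abs_nonneg _) hM.le,
    Real.mul_rpow (abs_nonneg _) (by positivity), ← Real.rpow_mul hM.le,
    div_mul_cancel₀ _ hs.ne', Real.rpow_sub hM, Real.rpow_one]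
  ring

theorem sphere_rpow {q : ℝ} (hq : 0 < q) (u : ℝ) (n : ℕ) :
    ((q + 1) * q ^ n) ^ u = (q + 1) ^ u * (q ^ u) ^ n := by
  rw [Real.mul_rpow (by positivity) (by positivity), ← Real.rpow_natCast, ← Real.rpow_mul hq.le,
    mul_comm (n : ℝ), Real.rpow_mul hq.le, Real.rpow_natCast]

/-- Summability over spheres for a sequence growing no faster than `(n + 1) * b ^ n`. -/
theorem summable_sphere_of_abs_le {q b C s : ℝ} (hq : 0 < q) (hb : 0 ≤ b) (hs : 0 < s)
    (hC : 0 ≤ C) (hlt : b * q ^ ((1 - s) / s) < 1) {F : ℕ → ℝ}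
    (hF : ∀ n : ℕ, |F n| ≤ C * (n + 1) * b ^ n) :
    Summable fun n : ℕ => (q + 1) * q ^ n * |F n / ((q + 1) * q ^ n)| ^ s := by
  set ρ := q ^ ((1 - s) / s) with hρ
  have hρ0 : 0 < ρ := by positivity
  set K := C * (q + 1) ^ ((1 - s) / s) with hK
  have hK0 : 0 ≤ K := by positivity
  set x := (b * ρ) ^ s with hx
  have hbρ : 0 ≤ b * ρ := by positivity
  have hx0 : 0 ≤ x := by positivity
  have hx1 : x < 1 := Real.rpow_lt_one hbρ hlt hs
  set k := ⌈s⌉₊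
  have hsum : Summable fun n : ℕ => K ^ s * (((n + 1 : ℕ) : ℝ) ^ k * x ^ n) := by
    refine Summable.mul_left _ ?_
    rcases hx0.eq_or_lt with h0 | hpos
    · rw [← summable_nat_add_iff 1]
      simp [← h0, summable_zero]
    · have := (summable_nat_add_iff 1).mpr (summable_pow_mul_geometric_of_norm_lt_one k
        (r := x) (by rwa [Real.norm_of_nonneg hx0]))
      refine (this.mul_right x⁻¹).congr fun n => ?_
      rw [pow_succ]
      field_simp
  refine hsum.of_nonneg_of_le (fun n => by positivity) fun n => ?_
  rw [mul_abs_div_rpow (by positivity) hs, sphere_rpow hq]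
  have hn : (1 : ℝ) ≤ ((n + 1 : ℕ) : ℝ) := by push_cast; linarith [Nat.cast_nonneg (α := ℝ) n]
  calc (|F n| * ((q + 1) ^ ((1 - s) / s) * ρ ^ n)) ^ s
      ≤ (C * (n + 1) * b ^ n * ((q + 1) ^ ((1 - s) / s) * ρ ^ n)) ^ s := by
        gcongr
        exact hF n
    _ = (K * (((n + 1 : ℕ) : ℝ) * (b * ρ) ^ n)) ^ s := by
        rw [hK, mul_pow]
        push_cast
        ring_nf
    _ = K ^ s * (((n + 1 : ℕ) : ℝ) ^ s * x ^ n) := by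
        have e : ((b * ρ) ^ n) ^ s = x ^ n := (Real.rpow_pow_comm hbρ s n).symm
        rw [Real.mul_rpow hK0 (by positivity), Real.mul_rpow (Nat.cast_nonneg _) (by positivity),
          e]
    _ ≤ K ^ s * (((n + 1 : ℕ) : ℝ) ^ k * x ^ n) := by
        gcongr
        rw [← Real.rpow_natCast]
        exact Real.rpow_le_rpow_of_exponent_le hn (Nat.le_ceil s)

theorem tendsto_of_summable_sphere {q s : ℝ} (hq : 0 < q) (hs : 0 < s) {F : ℕ → ℝ}
    (hF : Summable fun n : ℕ => (q + 1) * q ^ n * |F n / ((q + 1) * q ^ n)| ^ s) :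
    Tendsto (fun n => |F n| * (q ^ ((1 - s) / s)) ^ n) atTop (𝓝 0) := by
  have h1 := hF.tendsto_atTop_zero
  have h2 : Tendsto (fun n : ℕ => ((q + 1) * q ^ n * |F n / ((q + 1) * q ^ n)| ^ s) ^ s⁻¹)
      atTop (𝓝 (0 ^ s⁻¹)) := h1.rpow_const (Or.inr (by positivity))
  rw [Real.zero_rpow (by positivity)] at h2
  have h3 := h2.mul_const ((q + 1) ^ ((1 - s) / s))⁻¹
  rw [zero_mul] at h3
  refine h3.congr fun n => ?_
  have hpos : (0 : ℝ) < (q + 1) ^ ((1 - s) / s) := by positivity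
  rw [mul_abs_div_rpow (by positivity) hs, sphere_rpow hq,
    Real.rpow_rpow_inv (by positivity) hs.ne']
  field_simp

/-- A solution of the recurrence with a nonzero component along a root `α` with
`|α| ≥ q ^ ((s - 1) / s)` is not summable over spheres. -/
theorem not_summable_sphere {q s α β c : ℝ} (hq : 0 < q) (hs : 0 < s) (hc : c ≠ 0)
    (hα : 1 ≤ |α| * q ^ ((1 - s) / s)) {F : ℕ → ℝ}
    (hF : ∀ n, F (n + 1) - β * F n = α ^ n * c) :
    ¬ Summable fun n : ℕ => (q + 1) * q ^ n * |F n / ((q + 1) * q ^ n)| ^ s := by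
  intro hsum
  have h1 := tendsto_of_summable_sphere hq hs hsum
  set ρ := q ^ ((1 - s) / s)
  have hρ : 0 < ρ := by positivity
  have h2 := ((h1.comp (tendsto_add_atTop_nat 1)).mul_const ρ⁻¹).add (h1.const_mul |β|)
  simp only [zero_mul, mul_zero, add_zero] at h2
  have h3 : ∀ n, |c| ≤ |F (n + 1)| * ρ ^ (n + 1) * ρ⁻¹ + |β| * (|F n| * ρ ^ n) := by
    intro n
    calc |c| = 1 * |c| := (one_mul _).symm
      _ ≤ (|α| * ρ) ^ n * |c| := by
          gcongr
          exact one_le_pow₀ hα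
      _ = |α ^ n * c| * ρ ^ n := by rw [abs_mul, abs_pow, mul_pow]; ring
      _ = |F (n + 1) - β * F n| * ρ ^ n := by rw [hF n]
      _ ≤ (|F (n + 1)| + |β * F n|) * ρ ^ n := by
          gcongr
          exact abs_sub _ _
      _ = _ := by
          rw [abs_mul, pow_succ]
          field_simp
  have h4 := ge_of_tendsto' h2 h3
  exact hc (abs_eq_zero.mp (le_antisymm h4 (abs_nonneg c)))

theorem exists_pos_one_le_mul_rpow {q x p : ℝ} (hq : 0 < q) (hp : 0 < p)
    (hx : q ^ ((p - 1) / p) < x) :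
    ∃ ε : ℝ, 0 < ε ∧ 1 ≤ x * q ^ ((1 - (p + ε)) / (p + ε)) := by
  have hcont : ContinuousAt (fun ε : ℝ => x * q ^ ((1 - (p + ε)) / (p + ε))) 0 := by
    refine ContinuousAt.mul continuousAt_const (ContinuousAt.rpow continuousAt_const ?_
      (Or.inl hq.ne'))
    refine ContinuousAt.div (by fun_prop) (by fun_prop) ?_
    simpa using hp.ne'
  have h0 : 1 < x * q ^ ((1 - (p + 0)) / (p + 0)) := by
    have : (1 - (p + 0)) / (p + 0) = -((p - 1) / p) := by ring
    rw [this, Real.rpow_neg hq.le, ← div_eq_mul_inv, one_lt_div (by positivity)]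
    exact hx
  have hev := (hcont.eventually (lt_mem_nhds h0)).filter_mono
    (nhdsWithin_le_nhds (s := Set.Ioi 0))
  obtain ⟨ε, h1, h2⟩ := (hev.and self_mem_nhdsWithin).exists
  exact ⟨ε, h2, h1.le⟩

end Summability

namespace SimpleGraph

section Lift

variable {V W : Type} {G : SimpleGraph V} {T : SimpleGraph W} {π : W → V} {q : ℕ}

theorem surjective_of_bijOn_neighborSet (hG : G.Preconnected) [Nonempty W]
    (hcov : ∀ t, Set.BijOn π (T.neighborSet t) (G.neighborSet (π t))) :
    Function.Surjective π := by
  have hadj : ∀ v w, G.Adj v w → v ∈ Set.range π → w ∈ Set.range π := by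
    rintro _ w h ⟨t, rfl⟩
    obtain ⟨u, -, hu⟩ := (hcov t).surjOn h
    exact ⟨u, hu⟩
  intro v
  have := hG.forall_eq_of_forall_adj (φ := fun v => v ∈ Set.range π)
    (fun v w h => propext ⟨hadj v w h, hadj w v h.symm⟩) v (π (Classical.arbitrary W))
  exact this.mpr ⟨_, rfl⟩

theorem sum_neighborFinset_comp [T.LocallyFinite] [G.LocallyFinite]
    (hcov : ∀ t, Set.BijOn π (T.neighborSet t) (G.neighborSet (π t))) (f : V → ℝ) (t : W) :
    ∑ u ∈ T.neighborFinset t, f (π u) = ∑ w ∈ G.neighborFinset (π t), f w :=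
  Finset.sum_nbij π (fun u hu => by simpa using (hcov t).mapsTo (by simpa using hu))
    (by simpa using (hcov t).injOn) (by simpa using (hcov t).surjOn) fun _ _ => rfl

theorem sphereSum_one_comp [T.LocallyFinite] [G.LocallyFinite]
    (hcov : ∀ t, Set.BijOn π (T.neighborSet t) (G.neighborSet (π t))) {f : V → ℝ} {lam : ℝ}
    (hf : ∀ v, ∑ w ∈ G.neighborFinset v, f w = lam * f v) (t₀ : W) :
    T.sphereSum t₀ (f ∘ π) 1 = lam * f (π t₀) := by
  rw [sphereSum_one, ← hf]
  exact sum_neighborFinset_comp hcov f t₀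

/-- Sphere sums of a lifted eigenfunction satisfy a three-term recurrence. -/
theorem IsTree.sphereSum_comp_add_two (hT : T.IsTree) [T.LocallyFinite] [G.LocallyFinite]
    (hreg : T.IsRegularOfDegree (q + 1))
    (hcov : ∀ t, Set.BijOn π (T.neighborSet t) (G.neighborSet (π t))) {f : V → ℝ} {lam : ℝ}
    (hf : ∀ v, ∑ w ∈ G.neighborFinset v, f w = lam * f v) (t₀ : W) (r : ℕ) :
    T.sphereSum t₀ (f ∘ π) (r + 2) = lam * T.sphereSum t₀ (f ∘ π) (r + 1) -
      (if r = 0 then (q + 1 : ℝ) else q) * T.sphereSum t₀ (f ∘ π) r := by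
  have h := hT.sum_sphere_sum_neighborFinset hreg t₀ (f ∘ π) r
  have h1 : (fun s => ∑ u ∈ T.neighborFinset s, (f ∘ π) u) = fun s => lam * (f ∘ π) s := by
    funext s
    exact (sum_neighborFinset_comp hcov f s).trans (hf (π s))
  have hfin : ∀ t, (T.neighborSet t).Finite := fun t => Set.toFinite _
  have h2 : T.sphereSum t₀ (fun s => lam * (f ∘ π) s) (r + 1) =
      lam * T.sphereSum t₀ (f ∘ π) (r + 1) := by
    simp only [hT.connected.sphereSum_eq_sum hfin, Finset.mul_sum]
  rw [h1, h2] at h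
  linarith

theorem Connected.summable_comp_dist_iff (hT : T.Connected)
    (hfin : ∀ t, (T.neighborSet t).Finite) (t₀ : W) {h : ℕ → ℝ} (hh : ∀ n, 0 ≤ h n) :
    Summable (fun t => h (T.dist t t₀)) ↔
      Summable fun n => ({s : W | T.dist s t₀ = n}.ncard : ℝ) * h n := by
  rw [summable_partition (fun t => hh _) (s := fun n => {s : W | T.dist s t₀ = n})
    (fun t => ⟨T.dist t t₀, rfl, fun _ h => Eq.symm h⟩)]
  have hval : ∀ n, (fun x : {s : W | T.dist s t₀ = n} => h (T.dist x t₀)) = fun _ => h n := by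
    intro n
    funext x
    rw [show T.dist x t₀ = n from x.2]
  have hsum : ∀ n, Summable fun x : {s : W | T.dist s t₀ = n} => h (T.dist x t₀) := by
    intro n
    have := (hT.finite_setOf_dist_eq hfin t₀ n).to_subtype
    exact Summable.of_finite
  rw [and_iff_right hsum]
  refine summable_congr fun n => ?_
  rw [hval, tsum_const, nsmul_eq_mul, Nat.card_coe_set_eq]

theorem IsTree.summable_ftilde_iff (hT : T.IsTree) [T.LocallyFinite]
    (hreg : T.IsRegularOfDegree (q + 1)) (f : V → ℝ) (t₀ : W) (s : ℝ) :
    Summable (fun t => |ftilde T π f t₀ t| ^ s) ↔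
      Summable fun n : ℕ => (q + 1 : ℝ) * (q : ℝ) ^ n *
        |T.sphereSum t₀ (f ∘ π) (n + 1) / ((q + 1 : ℝ) * (q : ℝ) ^ n)| ^ s := by
  have hft : ∀ t, |ftilde T π f t₀ t| ^ s =
      (fun n => |T.sphereSum t₀ (f ∘ π) n / ({s : W | T.dist s t₀ = n}.ncard : ℝ)| ^ s)
        (T.dist t t₀) := by
    intro t
    simp only [ftilde, sphereSum, div_eq_inv_mul, mul_one, Function.comp_apply]
  simp only [hft]
  rw [hT.connected.summable_comp_dist_iff (fun t => Set.toFinite _) t₀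
    (h := fun n => |T.sphereSum t₀ (f ∘ π) n / ({s : W | T.dist s t₀ = n}.ncard : ℝ)| ^ s)
    (fun n => by positivity), ← summable_nat_add_iff 1]
  simp only [hT.ncard_setOf_dist_eq hreg]

end Lift

section Main

variable {V : Type} [Fintype V] {G : SimpleGraph V} [DecidableRel G.Adj]

theorem sum_neighborFinset_of_mulVec_eq {f : V → ℝ} {lam : ℝ}
    (hf : (G.adjMatrix ℝ).mulVec f = lam • f) (v : V) :
    ∑ w ∈ G.neighborFinset v, f w = lam * f v := by
  have := congrFun hf v
  rwa [adjMatrix_mulVec_apply] at this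

/-- Functions in `L²₀₀` are sums of eigenvectors with nontrivial eigenvalues. -/
theorem _root_.MemL200.exists_eq_sum [DecidableEq V] {d : ℕ} (hreg : G.IsRegularOfDegree d)
    (hconn : G.Preconnected) {f : V → ℝ} (hf : MemL200 G f) :
    ∃ (lam : V → ℝ) (g : V → V → ℝ), (∀ i, g i = 0 ∨ |lam i| ≠ d) ∧
      (∀ i v, ∑ w ∈ G.neighborFinset v, g i w = lam i * g i v) ∧
      ∀ v, f v = ∑ i, g i v := by
  have hA : (G.adjMatrix ℝ).IsHermitian := by
    rw [Matrix.IsHermitian, Matrix.conjTranspose_eq_transpose_of_trivial]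
    exact G.isSymm_adjMatrix
  set e := hA.eigenvectorBasis
  have heig : ∀ i v, ∑ w ∈ G.neighborFinset v, e i w = hA.eigenvalues i * e i v := fun i v =>
    sum_neighborFinset_of_mulVec_eq (hA.mulVec_eigenvectorBasis i) v
  have hinner : ∀ i, inner ℝ (e i) (WithLp.toLp 2 f) = ∑ v, e i v * f v := by
    intro i
    simp [PiLp.inner_apply, mul_comm]
  refine ⟨hA.eigenvalues, fun i v => inner ℝ (e i) (WithLp.toLp 2 f) * e i v, fun i => ?_,
    fun i v => ?_, fun v => ?_⟩
  · by_cases h : |hA.eigenvalues i| = d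
    · left
      funext v
      change inner ℝ (e i) (WithLp.toLp 2 f) * e i v = 0
      rw [hinner, hreg.sum_mul_eq_zero_of_memL200 hconn hf (heig i) h, zero_mul]
    · exact Or.inr h
  · rw [← Finset.mul_sum, heig]
    ring
  · have := congrArg (fun x : EuclideanSpace ℝ V => x v) (e.sum_repr' (WithLp.toLp 2 f))
    simpa using this.symm

theorem IsRegularOfDegree.abs_le_muX [DecidableEq V] {q : ℕ}
    (hreg : G.IsRegularOfDegree (q + 1)) {f : V → ℝ} {lam : ℝ}
    (hf : ∀ v, ∑ w ∈ G.neighborFinset v, f w = lam * f v) (hne : f ≠ 0)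
    (hlam : |lam| ≠ (q + 1 : ℝ)) : |lam| ≤ muX G q := by
  refine le_csSup ⟨q + 1, ?_⟩ ⟨lam, f, hne, ?_, hlam, rfl⟩
  · rintro _ ⟨l, g, hg, hl, -, rfl⟩
    simpa using hreg.abs_eigenvalue_le (sum_neighborFinset_of_mulVec_eq hl) hg
  · funext v
    rw [adjMatrix_mulVec_apply, hf, Pi.smul_apply, smul_eq_mul]

end Main

end SimpleGraph

/-- Kamber: for a finite connected `(q+1)`-regular graph `X` covered by the
`(q+1)`-regular tree `T` via `π`, and `p ∈ [2,∞)`:  `μ(X) ≤ q^{1/p} + q^{(p-1)/p}` iff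
for every `f ∈ L²₀₀(X)`, every `t₀` and every `ε > 0`, `∑_{t} |f̃(t)|^{p+ε} < ∞`. -/
theorem kamber_Lp_characterization (q : ℕ) (hq : 2 ≤ q)
    (V : Type) [Fintype V] [DecidableEq V] (G : SimpleGraph V) [DecidableRel G.Adj]
    (hGconn : G.Connected) (hGreg : G.IsRegularOfDegree (q + 1))
    (VT : Type) [Infinite VT] (T : SimpleGraph VT)
    (hTconn : T.Connected) (hTacyclic : T.IsAcyclic)
    (hTreg : ∀ t : VT, (T.neighborSet t).ncard = q + 1)
    (π : VT → V)
    (hcov : ∀ t : VT, Set.BijOn π (T.neighborSet t) (G.neighborSet (π t)))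
    (p : ℝ) (hp : 2 ≤ p) :
    muX G q ≤ (q : ℝ) ^ (1 / p) + (q : ℝ) ^ ((p - 1) / p) ↔
      ∀ f : V → ℝ, MemL200 G f → ∀ t₀ : VT, ∀ ε : ℝ, 0 < ε →
        Summable (fun t : VT => |ftilde T π f t₀ t| ^ (p + ε)) := by
  have hT : T.IsTree := ⟨hTconn, hTacyclic⟩
  have hfin : ∀ t, (T.neighborSet t).Finite := fun t =>
    Set.finite_of_ncard_ne_zero (by rw [hTreg t]; exact Nat.succ_ne_zero q)
  have : T.LocallyFinite := fun t => (hfin t).fintype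
  have hreg : T.IsRegularOfDegree (q + 1) := by
    intro t
    rw [← hTreg t, ← SimpleGraph.card_neighborSet_eq_degree, Set.ncard_eq_toFinset_card',
      Set.toFinset_card]
  have hq0 : (0 : ℝ) < q := by positivity
  have hq1 : (1 : ℝ) < q := by exact_mod_cast hq
  have hp0 : 0 < p := by linarith
  have ha : 0 < (q : ℝ) ^ (1 / p) := by positivity
  have hab : (q : ℝ) ^ (1 / p) ≤ (q : ℝ) ^ ((p - 1) / p) :=
    Real.rpow_le_rpow_of_exponent_le hq1.le (by gcongr; linarith)
  have hmul : (q : ℝ) ^ (1 / p) * (q : ℝ) ^ ((p - 1) / p) = q := by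
    rw [← Real.rpow_add hq0, ← add_div, add_sub_cancel, div_self hp0.ne', Real.rpow_one]
  have hrec : ∀ (f : V → ℝ) (lam : ℝ), (∀ v, ∑ w ∈ G.neighborFinset v, f w = lam * f v) →
      ∀ t₀ n, T.sphereSum t₀ (f ∘ π) (n + 2 + 1) = lam * T.sphereSum t₀ (f ∘ π) (n + 1 + 1) -
        q * T.sphereSum t₀ (f ∘ π) (n + 1) := by
    intro f lam hf t₀ n
    simpa using hT.sphereSum_comp_add_two hreg hcov hf t₀ (n + 1)
  constructor
  · intro hmu f hf t₀ ε hε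
    obtain ⟨lam, g, hne, hg, hfg⟩ := hf.exists_eq_sum hGreg hGconn.preconnected
    have hC : ∀ i, ∃ C : ℝ, 0 ≤ C ∧ ∀ n : ℕ, |T.sphereSum t₀ (g i ∘ π) (n + 1)| ≤
        C * (n + 1) * ((q : ℝ) ^ ((p - 1) / p)) ^ n := by
      intro i
      by_cases hi : g i = 0
      · refine ⟨0, le_rfl, fun n => ?_⟩
        simp [SimpleGraph.sphereSum, hi]
      · have hi' : |lam i| ≠ (q + 1 : ℝ) := by simpa using (hne i).resolve_left hi
        refine exists_abs_le_of_recurrence ha hab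
          ((hGreg.abs_le_muX (hg i) hi hi').trans hmu) fun n => ?_
        rw [hmul]
        exact hrec _ _ (hg i) t₀ n
    choose C hC0 hC using hC
    rw [hT.summable_ftilde_iff hreg]
    refine summable_sphere_of_abs_le (b := (q : ℝ) ^ ((p - 1) / p)) (C := ∑ i, C i) hq0
      (by positivity) (by linarith) (Finset.sum_nonneg fun i _ => hC0 i) ?_ fun n => ?_
    · rw [← Real.rpow_add hq0]
      refine Real.rpow_lt_one_of_one_lt_of_neg hq1 ?_
      have : (p - 1) / p + (1 - (p + ε)) / (p + ε) = -ε / (p * (p + ε)) := by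
        have : p + ε ≠ 0 := by positivity
        field_simp
        ring
      rw [this]
      exact div_neg_of_neg_of_pos (by linarith) (by positivity)
    · have hsum : T.sphereSum t₀ (f ∘ π) (n + 1) =
          ∑ i, T.sphereSum t₀ (g i ∘ π) (n + 1) := by
        simp only [hTconn.sphereSum_eq_sum hfin]
        rw [Finset.sum_comm]
        exact Finset.sum_congr rfl fun s _ => hfg (π s)
      rw [hsum, Finset.sum_mul, Finset.sum_mul]
      exact (Finset.abs_sum_le_sum_abs _ _).trans (Finset.sum_le_sum fun i _ => hC i n)
  · intro hsum
    by_contra! hlt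
    rw [muX] at hlt
    obtain ⟨_, ⟨lam, f, hf0, hf, hne, rfl⟩, hlam⟩ := exists_lt_of_lt_csSup (by
      by_contra hempty
      rw [Set.not_nonempty_iff_eq_empty.mp hempty, Real.sSup_empty] at hlt
      linarith) hlt
    have hf' := SimpleGraph.sum_neighborFinset_of_mulVec_eq hf
    have hmem : MemL200 G f := hGreg.memL200_of_eigenvector hf' (by simpa using hne)
    obtain ⟨v, hv⟩ := Function.ne_iff.mp hf0
    have := hTconn.nonempty
    obtain ⟨t₀, rfl⟩ :=
      SimpleGraph.surjective_of_bijOn_neighborSet hGconn.preconnected hcov v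
    obtain ⟨α, β, hadd, hαβ, hα⟩ := exists_add_eq_mul_eq_lt_abs ha hab hlam
    rw [hmul] at hαβ
    obtain ⟨ε, hε, hle⟩ := exists_pos_one_le_mul_rpow hq0 hp0 hα
    have hα1 : 1 < |α| := lt_of_le_of_lt
      (Real.one_le_rpow hq1.le (div_nonneg (by linarith) hp0.le)) hα
    have hc : T.sphereSum t₀ (f ∘ π) (1 + 1) - β * T.sphereSum t₀ (f ∘ π) (0 + 1) ≠ 0 := by
      have h1 := SimpleGraph.sphereSum_one_comp hcov hf' t₀
      have h2 := hT.sphereSum_comp_add_two hreg hcov hf' t₀ 0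
      rw [hTconn.sphereSum_zero, zero_add, zero_add, h1, if_pos rfl, Function.comp_apply] at h2
      rw [zero_add, one_add_one_eq_two, h1, h2]
      have : lam * (lam * f (π t₀)) - (q + 1) * f (π t₀) - β * (lam * f (π t₀)) =
          (α ^ 2 - 1) * f (π t₀) := by
        rw [← hadd, ← hαβ]
        ring
      rw [this]
      refine mul_ne_zero ?_ hv
      rw [← sq_abs]
      nlinarith
    exact not_summable_sphere hq0 (by linarith) hc hle
      (sub_mul_eq_of_recurrence hadd hαβ (Q := fun n => T.sphereSum t₀ (f ∘ π) (n + 1))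
        (hrec f lam hf' t₀))
      ((hT.summable_ftilde_iff hreg f t₀ (p + ε)).mp (hsum f hmem t₀ ε hε))
end

section
/- (Garland) Let X be a pure d-dimensional simplicial complex on a finite vertex set V with d ≥ 2, and let ε > 0. Suppose that for every face F ∈ X^{(d-2)}, the link graph lk_X(F) satisfies λ^{(0)}(lk_X(F)) ≥ ε. Then λ^{(d-1)}(X) ≥ 1 + d·ε − d. -/
open Finset
open scoped Classical

variable {V : Type}

/-- The `i`-cells of a simplicial complex `X`: faces of size `i+1`. -/
def cells (X : Finset (Finset V)) (i : ℕ) : Finset (Finset V) :=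
  X.filter fun F => F.card = i + 1

/-- `deg(F)`: the number of `d`-cells of `X` containing `F`. -/
def faceDeg [DecidableEq V] (X : Finset (Finset V)) (d : ℕ) (F : Finset V) : ℕ :=
  (X.filter fun G => G.card = d + 1 ∧ F ⊆ G).card

/-- The oriented incidence number `[F : G]`: if `G ⊆ F` and `F \ G = {v}` where `v`
is the `ℓ`-th smallest vertex of `F` (counting from 0), this equals `(-1)^ℓ`;
it is `0` if `G ⊄ F`. -/
noncomputable def incSign [LinearOrder V] (F G : Finset V) : ℝ :=
  if G ⊆ F then ∑ v ∈ F \ G, (-1 : ℝ) ^ (F.filter fun x => x < v).card else 0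

/-- The coboundary map `δ_i`: `(δ_i f)(F) = ∑_{G ∈ X^{(i)}} [F:G] f(G)`. -/
noncomputable def codelta [LinearOrder V] (X : Finset (Finset V)) (i : ℕ)
    (f : Finset V → ℝ) (F : Finset V) : ℝ :=
  ∑ G ∈ cells X i, incSign F G * f G

/-- The inner product on `C^i(X,ℝ)`: `⟨f,g⟩ = ∑_{F ∈ X^{(i)}} deg(F) f(F) g(F)`. -/
noncomputable def cinner [DecidableEq V] (X : Finset (Finset V)) (d i : ℕ)
    (f g : Finset V → ℝ) : ℝ :=
  ∑ F ∈ cells X i, (faceDeg X d F : ℝ) * f F * g F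

/-- Adjacency in the link of the face `F`: `u ~ v` iff `u ≠ v`, both avoid `F`,
and `{u,v} ∪ F ∈ X`. -/
def linkAdj [DecidableEq V] (X : Finset (Finset V)) (F : Finset V) (u v : V) : Prop :=
  u ≠ v ∧ u ∉ F ∧ v ∉ F ∧ insert u (insert v F) ∈ X

/-- The degree of `v` in the link graph of `F`. -/
noncomputable def linkDeg [Fintype V] [DecidableEq V] (X : Finset (Finset V))
    (F : Finset V) (v : V) : ℕ :=
  (Finset.univ.filter fun u => linkAdj X F u v).card

/-- The sign of `v` relative to `F`: `-1` to the number of elements of `F` below `v`. -/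
noncomputable def vertexSign [LinearOrder V] (v : V) (F : Finset V) : ℝ :=
  (-1) ^ (F.filter fun x => x < v).card

theorem vertexSign_sq [LinearOrder V] (v : V) (F : Finset V) : vertexSign v F ^ 2 = 1 := by
  rw [vertexSign, ← pow_mul, mul_comm, pow_mul]
  norm_num

theorem vertexSign_insert [LinearOrder V] {u v : V} {F : Finset V} (hu : u ∉ F) :
    vertexSign v (insert u F) = (if u < v then -1 else 1) * vertexSign v F := by
  unfold vertexSign
  rw [filter_insert]
  split_ifs with h
  · rw [card_insert_of_notMem (by simp [hu]), pow_succ]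
    ring
  · simp

theorem incSign_erase [LinearOrder V] {G : Finset V} {v : V} (hv : v ∈ G) :
    incSign G (G.erase v) = vertexSign v (G.erase v) := by
  rw [incSign, if_pos (erase_subset v G), sdiff_erase_self hv, sum_singleton, vertexSign,
    filter_erase, erase_eq_of_notMem (by simp)]

/-- The vertices of the link of `F`. -/
noncomputable def linkVertices [Fintype V] [DecidableEq V] (X : Finset (Finset V))
    (F : Finset V) : Finset V :=
  univ.filter fun v => v ∉ F ∧ insert v F ∈ X

theorem mem_linkVertices [Fintype V] [DecidableEq V] {X : Finset (Finset V)} {F : Finset V}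
    {v : V} : v ∈ linkVertices X F ↔ v ∉ F ∧ insert v F ∈ X := by
  simp [linkVertices]

theorem mem_cells {X : Finset (Finset V)} {i : ℕ} {F : Finset V} :
    F ∈ cells X i ↔ F ∈ X ∧ F.card = i + 1 := by
  simp [cells]

theorem insert_mem_cells [Fintype V] [DecidableEq V] {X : Finset (Finset V)} {k : ℕ}
    {F : Finset V} {v : V} (hF : F ∈ cells X k) (hv : v ∈ linkVertices X F) :
    insert v F ∈ cells X (k + 1) := by
  rw [mem_linkVertices] at hv
  rw [mem_cells] at hF ⊢
  exact ⟨hv.2, by rw [card_insert_of_notMem hv.1, hF.2]⟩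

theorem erase_mem_cells [DecidableEq V] {X : Finset (Finset V)}
    (hdown : ∀ F ∈ X, ∀ G ⊆ F, G ∈ X) {k : ℕ} {G : Finset V} {v : V}
    (hG : G ∈ cells X (k + 1)) (hv : v ∈ G) : G.erase v ∈ cells X k := by
  rw [mem_cells] at hG ⊢
  exact ⟨hdown G hG.1 _ (erase_subset v G), by rw [card_erase_of_mem hv, hG.2]; rfl⟩

/-- Double counting of the incidences between `k`-cells and `(k+1)`-cells. -/
theorem sum_cells_linkVertices [Fintype V] [DecidableEq V] {X : Finset (Finset V)}
    (hdown : ∀ F ∈ X, ∀ G ⊆ F, G ∈ X) (k : ℕ) (ψ : Finset V → V → ℝ) :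
    ∑ F ∈ cells X k, ∑ v ∈ linkVertices X F, ψ F v =
      ∑ G ∈ cells X (k + 1), ∑ v ∈ G, ψ (G.erase v) v := by
  rw [sum_sigma', sum_sigma']
  refine sum_bij' (fun p _ => ⟨insert p.2 p.1, p.2⟩) (fun p _ => ⟨p.1.erase p.2, p.2⟩)
    ?_ ?_ ?_ ?_ ?_
  · rintro ⟨F, v⟩ h
    rw [mem_sigma] at h ⊢
    exact ⟨insert_mem_cells h.1 h.2, mem_insert_self v F⟩
  · rintro ⟨G, v⟩ h
    rw [mem_sigma] at h ⊢
    refine ⟨erase_mem_cells hdown h.1 h.2, mem_linkVertices.2 ⟨notMem_erase v G, ?_⟩⟩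
    simp only at h ⊢
    rw [insert_erase h.2]
    exact (mem_cells.1 h.1).1
  · rintro ⟨F, v⟩ h
    have hv := (mem_linkVertices.1 (mem_sigma.1 h).2).1
    simp only at hv ⊢
    rw [erase_insert hv]
  · rintro ⟨G, v⟩ h
    have hv := (mem_sigma.1 h).2
    simp only at hv ⊢
    rw [insert_erase hv]
  · rintro ⟨F, v⟩ h
    have hv := (mem_linkVertices.1 (mem_sigma.1 h).2).1
    simp only at hv ⊢
    rw [erase_insert hv]

theorem codelta_eq_sum_erase [LinearOrder V] {X : Finset (Finset V)}
    (hdown : ∀ F ∈ X, ∀ G ⊆ F, G ∈ X) {k : ℕ} (g : Finset V → ℝ) {G : Finset V}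
    (hG : G ∈ cells X (k + 1)) :
    codelta X k g G = ∑ v ∈ G, vertexSign v (G.erase v) * g (G.erase v) := by
  have hinj : Set.InjOn (fun v => G.erase v) G := fun u hu v _ h => by
    by_contra huv
    have : u ∈ G.erase v := mem_erase.2 ⟨huv, hu⟩
    rw [← show G.erase u = G.erase v from h] at this
    exact notMem_erase u G this
  have hsub : G.image (fun v => G.erase v) ⊆ cells X k := by
    intro F hF
    obtain ⟨v, hv, rfl⟩ := mem_image.1 hF
    exact erase_mem_cells hdown hG hv
  rw [codelta, ← sum_subset hsub, sum_image hinj]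
  · exact sum_congr rfl fun v hv => by rw [incSign_erase hv]
  · intro F hF hn
    rw [incSign, if_neg, zero_mul]
    intro hFG
    apply hn
    have hcard : (G \ F).card = 1 := by
      rw [card_sdiff_of_subset hFG, (mem_cells.1 hG).2, (mem_cells.1 hF).2]
      omega
    obtain ⟨v, hv⟩ := card_eq_one.1 hcard
    have hvG : v ∈ G := (mem_sdiff.1 (hv ▸ mem_singleton_self v)).1
    refine mem_image.2 ⟨v, hvG, ?_⟩
    rw [erase_eq, ← hv, Finset.sdiff_sdiff_eq_self hFG]

theorem faceDeg_eq_card_linkVertices [Fintype V] [DecidableEq V] {X : Finset (Finset V)} {d : ℕ}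
    {F : Finset V} (hF : F.card = d) : faceDeg X d F = (linkVertices X F).card := by
  symm
  refine card_bij (fun v _ => insert v F) ?_ ?_ ?_
  · intro v hv
    rw [mem_linkVertices] at hv
    rw [mem_filter]
    exact ⟨hv.2, by rw [card_insert_of_notMem hv.1, hF], subset_insert v F⟩
  · intro u hu v hv h
    have hmem : u ∈ insert v F := h ▸ mem_insert_self u F
    exact (mem_insert.1 hmem).resolve_right (mem_linkVertices.1 hu).1
  · intro G hG
    obtain ⟨hGX, hGc, hFG⟩ := mem_filter.1 hG
    have hcard : (G \ F).card = 1 := by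
      rw [card_sdiff_of_subset hFG]
      omega
    obtain ⟨v, hv⟩ := card_eq_one.1 hcard
    have hvF : v ∉ F := (mem_sdiff.1 (hv ▸ mem_singleton_self v)).2
    have hins : insert v F = G := by
      rw [insert_eq, ← hv, sdiff_union_of_subset hFG]
    exact ⟨v, mem_linkVertices.2 ⟨hvF, hins ▸ hGX⟩, hins⟩

theorem linkAdj_iff [Fintype V] [DecidableEq V] {X : Finset (Finset V)}
    (hdown : ∀ F ∈ X, ∀ G ⊆ F, G ∈ X) {F : Finset V} {u v : V} :
    linkAdj X F u v ↔ v ∈ linkVertices X F ∧ u ∈ linkVertices X (insert v F) := by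
  rw [mem_linkVertices, mem_linkVertices, linkAdj, mem_insert]
  have := fun h => hdown (insert u (insert v F)) h _ (subset_insert u _)
  tauto

theorem sum_linkDeg_mul [Fintype V] [DecidableEq V] {X : Finset (Finset V)}
    (hdown : ∀ F ∈ X, ∀ G ⊆ F, G ∈ X) {d : ℕ} {F : Finset V} (hF : F.card + 1 = d)
    (φ : V → ℝ) :
    ∑ v, (linkDeg X F v : ℝ) * φ v =
      ∑ v ∈ linkVertices X F, (faceDeg X d (insert v F) : ℝ) * φ v := by
  rw [← sum_subset (subset_univ (linkVertices X F))]
  · refine sum_congr rfl fun v hv => ?_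
    rw [faceDeg_eq_card_linkVertices
      (by rw [card_insert_of_notMem (mem_linkVertices.1 hv).1, hF]), linkDeg]
    congr 3
    ext u
    simp [linkAdj_iff hdown, hv]
  · intro v _ hv
    have : linkDeg X F v = 0 := by
      rw [linkDeg, card_eq_zero, filter_eq_empty_iff]
      exact fun u _ h => hv ((linkAdj_iff hdown).1 h).1
    simp [this]

/-- The localization of the cochain `f` at the face `F`, a function on vertices. -/
noncomputable def localization [LinearOrder V] (f : Finset V → ℝ) (F : Finset V) (v : V) : ℝ :=
  vertexSign v F * f (insert v F)

theorem sum_linkDeg_mul_localization_eq_zero [Fintype V] [LinearOrder V]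
    {X : Finset (Finset V)} (hdown : ∀ F ∈ X, ∀ G ⊆ F, G ∈ X) {k : ℕ} {f : Finset V → ℝ}
    (horth : ∀ g : Finset V → ℝ, cinner X (k + 2) (k + 1) (codelta X k g) f = 0)
    {F : Finset V} (hF : F ∈ cells X k) :
    ∑ v, (linkDeg X F v : ℝ) * localization f F v = 0 := by
  have key : ∀ g : Finset V → ℝ, cinner X (k + 2) (k + 1) (codelta X k g) f =
      ∑ F ∈ cells X k, g F * ∑ v, (linkDeg X F v : ℝ) * localization f F v := by
    intro g
    have h := sum_cells_linkVertices hdown k fun F v =>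
      (faceDeg X (k + 2) (insert v F) : ℝ) * (vertexSign v F * g F) * f (insert v F)
    trans ∑ G ∈ cells X (k + 1), ∑ v ∈ G, (faceDeg X (k + 2) (insert v (G.erase v)) : ℝ) *
      (vertexSign v (G.erase v) * g (G.erase v)) * f (insert v (G.erase v))
    · refine sum_congr rfl fun G hG => ?_
      rw [codelta_eq_sum_erase hdown g hG, mul_sum, sum_mul]
      exact sum_congr rfl fun v hv => by rw [insert_erase hv]
    · rw [← h]
      refine sum_congr rfl fun F hF => ?_
      rw [sum_linkDeg_mul hdown (d := k + 2) (by rw [(mem_cells.1 hF).2]), mul_sum]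
      exact sum_congr rfl fun v _ => by rw [localization]; ring
  have h := horth (Pi.single F 1)
  rw [key, sum_eq_single F] at h
  · simpa using h
  · intro G _ hG
    simp [hG]
  · exact fun h => absurd hF h

theorem sum_linkDeg_mul_localization_sq [Fintype V] [LinearOrder V]
    {X : Finset (Finset V)} (hdown : ∀ F ∈ X, ∀ G ⊆ F, G ∈ X) (k : ℕ) (f : Finset V → ℝ) :
    ∑ F ∈ cells X k, ∑ v, (linkDeg X F v : ℝ) * localization f F v ^ 2 =
      (k + 2) * cinner X (k + 2) (k + 1) f f := by
  trans ∑ F ∈ cells X k, ∑ v ∈ linkVertices X F,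
    (faceDeg X (k + 2) (insert v F) : ℝ) * f (insert v F) ^ 2
  · refine sum_congr rfl fun F hF => ?_
    rw [sum_linkDeg_mul hdown (d := k + 2) (by rw [(mem_cells.1 hF).2])]
    exact sum_congr rfl fun v _ => by rw [localization, mul_pow, vertexSign_sq, one_mul]
  · rw [sum_cells_linkVertices hdown k fun F v =>
      (faceDeg X (k + 2) (insert v F) : ℝ) * f (insert v F) ^ 2, cinner, mul_sum]
    refine sum_congr rfl fun G hG => ?_
    rw [sum_congr rfl fun v hv => by rw [insert_erase hv], sum_const, (mem_cells.1 hG).2]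
    simp only [nsmul_eq_mul]
    push_cast
    ring

theorem cinner_self_eq_sum_erase [Fintype V] [DecidableEq V] {X : Finset (Finset V)}
    (hdown : ∀ F ∈ X, ∀ G ⊆ F, G ∈ X) (k : ℕ) (f : Finset V → ℝ) :
    cinner X (k + 1) k f f = ∑ H ∈ cells X (k + 1), ∑ v ∈ H, f (H.erase v) ^ 2 := by
  rw [← sum_cells_linkVertices hdown k fun F _ => f F ^ 2, cinner]
  refine sum_congr rfl fun F hF => ?_
  rw [faceDeg_eq_card_linkVertices (mem_cells.1 hF).2, sum_const, nsmul_eq_mul]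
  ring

theorem cinner_top_self [DecidableEq V] (X : Finset (Finset V)) (d : ℕ) (f : Finset V → ℝ) :
    cinner X d d f f = ∑ H ∈ cells X d, f H ^ 2 := by
  refine sum_congr rfl fun H hH => ?_
  have hdeg : faceDeg X d H = 1 := by
    rw [faceDeg, card_eq_one]
    refine ⟨H, ?_⟩
    ext G
    rw [mem_filter, mem_singleton]
    rw [mem_cells] at hH
    constructor
    · rintro ⟨_, hc, hs⟩
      exact (eq_of_subset_of_card_le hs (by omega)).symm
    · rintro rfl
      exact ⟨hH.1, hH.2, Subset.rfl⟩
  rw [hdeg]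
  push_cast
  ring

theorem sum_sum_erase_add_sq [DecidableEq V] (H : Finset V) (a : V → ℝ) :
    ∑ u ∈ H, ∑ v ∈ H.erase u, (a u + a v) ^ 2 =
      2 * (H.card - 2) * ∑ v ∈ H, a v ^ 2 + 2 * (∑ v ∈ H, a v) ^ 2 := by
  have h : ∀ u ∈ H, ∑ v ∈ H.erase u, (a u + a v) ^ 2 =
      (H.card - 4) * a u ^ 2 + 2 * (a u * ∑ v ∈ H, a v) + ∑ v ∈ H, a v ^ 2 := by
    intro u hu
    rw [← add_right_inj ((a u + a u) ^ 2), add_sum_erase H (fun v => (a u + a v) ^ 2) hu]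
    simp only [add_sq, sum_add_distrib, sum_const, nsmul_eq_mul, ← mul_sum, mul_assoc]
    ring
  rw [sum_congr rfl h, sum_add_distrib, sum_add_distrib, sum_const, nsmul_eq_mul, ← mul_sum,
    ← mul_sum, ← sum_mul]
  ring

theorem localization_sub_sq [LinearOrder V] (f : Finset V → ℝ) {H : Finset V} {u v : V}
    (hu : u ∈ H) (hv : v ∈ H) (huv : v ≠ u) :
    (localization f ((H.erase u).erase v) u - localization f ((H.erase u).erase v) v) ^ 2 =
      (vertexSign u (H.erase u) * f (H.erase u) +
        vertexSign v (H.erase v) * f (H.erase v)) ^ 2 := by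
  set F := (H.erase u).erase v with hF
  have huF : u ∉ F := by simp [F]
  have hvF : v ∉ F := by simp [F]
  have h1 : H.erase u = insert v F := (insert_erase (mem_erase.2 ⟨huv, hv⟩)).symm
  have h2 : H.erase v = insert u F := by
    rw [hF, erase_right_comm, insert_erase (mem_erase.2 ⟨huv.symm, hu⟩)]
  rw [h1, h2, vertexSign_insert huF, vertexSign_insert hvF, localization, localization]
  rcases lt_or_gt_of_ne huv with h | h
  · rw [if_pos h, if_neg h.asymm]
    linear_combination (f (insert u F) ^ 2 - f (insert v F) ^ 2) *
      (vertexSign_sq u F - vertexSign_sq v F)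
  · rw [if_neg h.asymm, if_pos h]
    linear_combination (f (insert u F) ^ 2 - f (insert v F) ^ 2) *
      (vertexSign_sq u F - vertexSign_sq v F)

theorem sum_link_energy [Fintype V] [LinearOrder V] {X : Finset (Finset V)}
    (hdown : ∀ F ∈ X, ∀ G ⊆ F, G ∈ X) (k : ℕ) (f : Finset V → ℝ) :
    ∑ F ∈ cells X k, (1 / 2) * ∑ u, ∑ v,
        (if linkAdj X F u v then (localization f F u - localization f F v) ^ 2 else 0) =
      (k + 1) * cinner X (k + 2) (k + 1) f f +
        cinner X (k + 2) (k + 2) (codelta X (k + 1) f) (codelta X (k + 1) f) := by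
  have h1 : ∀ F : Finset V, ∑ u, ∑ v,
      (if linkAdj X F u v then (localization f F u - localization f F v) ^ 2 else 0) =
      ∑ v ∈ linkVertices X F, ∑ u ∈ linkVertices X (insert v F),
        (localization f F u - localization f F v) ^ 2 := by
    intro F
    rw [sum_comm]
    simp only [linkAdj_iff hdown, ite_and]
    rw [← sum_filter_add_sum_filter_not univ (· ∈ linkVertices X F)]
    rw [sum_eq_zero (s := univ.filter fun v => ¬ v ∈ linkVertices X F), add_zero]
    · refine sum_congr (by ext; simp) fun v hv => ?_
      simp [hv]
    · intro v hv
      simp [(mem_filter.1 hv).2]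
  have h2 : ∀ H ∈ cells X (k + 2), ∑ u ∈ H, ∑ v ∈ H.erase u,
      (localization f ((H.erase u).erase v) u - localization f ((H.erase u).erase v) v) ^ 2 =
      2 * (k + 1) * ∑ v ∈ H, f (H.erase v) ^ 2 + 2 * codelta X (k + 1) f H ^ 2 := by
    intro H hH
    rw [sum_congr rfl fun u hu => sum_congr rfl fun v hv =>
      localization_sub_sq f hu (mem_of_mem_erase hv) (ne_of_mem_erase hv),
      sum_sum_erase_add_sq H fun v => vertexSign v (H.erase v) * f (H.erase v),
      codelta_eq_sum_erase hdown f hH, (mem_cells.1 hH).2]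
    simp only [mul_pow, vertexSign_sq, one_mul]
    push_cast
    ring
  simp only [h1]
  rw [← mul_sum, sum_cells_linkVertices hdown k fun F v =>
    ∑ u ∈ linkVertices X (insert v F), (localization f F u - localization f F v) ^ 2]
  rw [sum_congr rfl fun G hG => (sum_congr rfl fun v hv => by rw [insert_erase hv]).trans sum_comm,
    sum_cells_linkVertices hdown (k + 1) fun G u =>
      ∑ v ∈ G, (localization f (G.erase v) u - localization f (G.erase v) v) ^ 2,
    sum_congr rfl h2, sum_add_distrib, ← mul_sum, ← mul_sum, cinner_top_self,
    cinner_self_eq_sum_erase hdown]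
  ring

theorem cinner_self_pos [DecidableEq V] {X : Finset (Finset V)} {d i : ℕ}
    (hpure : ∀ F ∈ X, ∃ G ∈ X, G.card = d + 1 ∧ F ⊆ G) {f : Finset V → ℝ}
    (hf : ∃ F ∈ cells X i, f F ≠ 0) : 0 < cinner X d i f f := by
  obtain ⟨F, hF, hfF⟩ := hf
  refine sum_pos' (fun G _ => ?_) ⟨F, hF, ?_⟩
  · rw [mul_assoc]
    exact mul_nonneg (Nat.cast_nonneg _) (mul_self_nonneg _)
  · obtain ⟨G, hG, hGc, hFG⟩ := hpure F (mem_cells.1 hF).1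
    have hdeg : 0 < faceDeg X d F := card_pos.2 ⟨G, mem_filter.2 ⟨hG, hGc, hFG⟩⟩
    rw [mul_assoc]
    exact mul_pos (Nat.cast_pos.2 hdeg) (mul_self_pos.2 hfF)

/-- Garland: if `X` is a pure `d`-dimensional finite simplicial complex,
`d ≥ 2`, and every link of a `(d-2)`-face satisfies `λ⁽⁰⁾(lk_X F) ≥ ε`
(stated as: every admissible Rayleigh quotient of the link graph is `≥ ε`),
then `λ^{(d-1)}(X) ≥ 1 + dε − d` (stated as: every admissible Rayleigh quotient of
`Δ^up_{d-1}` on the orthogonal complement of `B^{d-1}` is `≥ 1 + dε − d`). -/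
theorem garland (V : Type) [Fintype V] [LinearOrder V]
    (X : Finset (Finset V)) (d : ℕ) (hd : 2 ≤ d)
    (hdown : ∀ F ∈ X, ∀ G ⊆ F, G ∈ X)
    (hpure : ∀ F ∈ X, ∃ G ∈ X, G.card = d + 1 ∧ F ⊆ G)
    (hne : (cells X d).Nonempty)
    (ε : ℝ) (hε : 0 < ε)
    (hlinks : ∀ F ∈ cells X (d - 2), ∀ f : V → ℝ,
      (∑ v, (linkDeg X F v : ℝ) * f v ^ 2) ≠ 0 →
      (∑ v, (linkDeg X F v : ℝ) * f v) = 0 →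
      ε ≤ ((1 / 2) * ∑ u, ∑ v, if linkAdj X F u v then (f u - f v) ^ 2 else 0) /
          (∑ v, (linkDeg X F v : ℝ) * f v ^ 2)) :
    ∀ f : Finset V → ℝ, (∃ F ∈ cells X (d - 1), f F ≠ 0) →
      (∀ g : Finset V → ℝ, cinner X d (d - 1) (codelta X (d - 2) g) f = 0) →
      1 + (d : ℝ) * ε - (d : ℝ) ≤
        cinner X d d (codelta X (d - 1) f) (codelta X (d - 1) f) /
          cinner X d (d - 1) f f := by
  intro f hf horth
  obtain ⟨k, rfl⟩ := Nat.exists_eq_add_of_le' hd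
  simp only [Nat.add_sub_cancel, show k + 2 - 1 = k + 1 from rfl] at *
  rw [le_div_iff₀ (cinner_self_pos hpure hf)]
  have hlocal : ∀ F ∈ cells X k,
      ε * ∑ v, (linkDeg X F v : ℝ) * localization f F v ^ 2 ≤
      (1 / 2) * ∑ u, ∑ v,
        (if linkAdj X F u v then (localization f F u - localization f F v) ^ 2 else 0) := by
    intro F hF
    have hnonneg : 0 ≤ ∑ v, (linkDeg X F v : ℝ) * localization f F v ^ 2 :=
      sum_nonneg fun v _ => by positivity
    rcases hnonneg.eq_or_lt' with h0 | hpos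
    · rw [h0, mul_zero]
      refine mul_nonneg (by norm_num) (sum_nonneg fun u _ => sum_nonneg fun v _ => ?_)
      split_ifs <;> positivity
    · exact (le_div_iff₀ hpos).1 (hlinks F hF _ hpos.ne'
        (sum_linkDeg_mul_localization_eq_zero hdown horth hF))
  have hsum := sum_le_sum hlocal
  rw [← mul_sum, sum_linkDeg_mul_localization_sq hdown, sum_link_energy hdown] at hsum
  push_cast
  linarith
end

section
/- Let X = (V,E) be a finite connected k-regular simple graph with |V| ≥ 2, viewed as a pure 1-dimensional simplicial complex. Then its 0-th coboundary expansion satisfies 𝓱₀(X) = (2/k)·h(X). -/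
open Finset

/-- The weighted norm of a 0-cochain `f ∈ C⁰(X,F₂)` of a graph viewed as a pure
1-dimensional complex: `‖f‖ = ∑_{v : f v ≠ 0} deg(v)/(2|E|)`. -/
noncomputable def normV {V : Type} [Fintype V] [DecidableEq V]
    (G : SimpleGraph V) [DecidableRel G.Adj] (f : V → ZMod 2) : ℝ :=
  ∑ v ∈ Finset.univ.filter (fun v => f v ≠ 0),
    (G.degree v : ℝ) / (2 * (G.edgeFinset.card : ℝ))

/-- The coboundary `δ₀ f` of a 0-cochain, as a function on edges: `(δ₀f){u,v} = f u + f v`. -/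
def gcoboundary {V : Type} (f : V → ZMod 2) : Sym2 V → ZMod 2 :=
  Sym2.lift ⟨fun u v => f u + f v, fun u v => add_comm (f u) (f v)⟩

/-- The weighted norm of a 1-cochain of a graph: each edge has weight `1/|E|`. -/
noncomputable def normE {V : Type} [Fintype V] [DecidableEq V]
    (G : SimpleGraph V) [DecidableRel G.Adj] (g : Sym2 V → ZMod 2) : ℝ :=
  ∑ _e ∈ G.edgeFinset.filter (fun e => g e ≠ 0), 1 / (G.edgeFinset.card : ℝ)

/-- `‖[f]‖`: the minimal norm over the coset `f + B⁰`, `B⁰` being the constants. -/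
noncomputable def normClass {V : Type} [Fintype V] [DecidableEq V]
    (G : SimpleGraph V) [DecidableRel G.Adj] (f : V → ZMod 2) : ℝ :=
  sInf {r : ℝ | ∃ c : ZMod 2, r = normV G (fun v => f v + c)}

/-- The 0-th coboundary expansion `𝓱₀(X)` of a graph viewed as a pure 1-dimensional
simplicial complex: the minimum over `f ∈ C⁰ \ B⁰` of `‖δ₀ f‖/‖[f]‖`. -/
noncomputable def coboundaryExp0 {V : Type} [Fintype V] [DecidableEq V]
    (G : SimpleGraph V) [DecidableRel G.Adj] : ℝ :=
  sInf {r : ℝ | ∃ f : V → ZMod 2, (¬ ∃ c : ZMod 2, ∀ v, f v = c) ∧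
      r = normE G (gcoboundary f) / normClass G f}

open scoped Pointwise

/-- The number of edges on which `δ₀ f` is nonzero is the number of edges between
the support of `f` and the zero set of `f`. -/
theorem card_filter_gcoboundary_ne_zero {V : Type} [Fintype V] [DecidableEq V]
    (G : SimpleGraph V) [DecidableRel G.Adj] (f : V → ZMod 2) :
    (G.edgeFinset.filter fun e => gcoboundary f e ≠ 0).card =
      (((univ.filter fun v => f v ≠ 0) ×ˢ (univ.filter fun v => f v = 0)).filter
        fun p => G.Adj p.1 p.2).card := by
  have key : ∀ a b : ZMod 2, a + b ≠ 0 ↔ (a ≠ 0 ∧ b = 0) ∨ (b ≠ 0 ∧ a = 0) := by decide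
  symm
  refine Finset.card_bij (fun p _ => s(p.1, p.2)) ?_ ?_ ?_
  · rintro ⟨u, v⟩ h
    simp only [mem_filter, mem_product, mem_univ, true_and] at h
    simp only [mem_filter, SimpleGraph.mem_edgeFinset, SimpleGraph.mem_edgeSet]
    exact ⟨h.2, (key _ _).2 (Or.inl h.1)⟩
  · rintro ⟨u, v⟩ h ⟨u', v'⟩ h' heq
    simp only [mem_filter, mem_product, mem_univ, true_and] at h h'
    rcases Sym2.eq_iff.1 heq with ⟨rfl, rfl⟩ | ⟨rfl, rfl⟩
    · rfl
    · exact absurd h'.1.2 h.1.1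
  · intro e
    induction e using Sym2.ind with
    | _ u v =>
      intro h
      simp only [mem_filter, SimpleGraph.mem_edgeFinset, SimpleGraph.mem_edgeSet] at h
      rcases (key (f u) (f v)).1 h.2 with h' | h'
      · exact ⟨(u, v), by simp [h', h.1], rfl⟩
      · exact ⟨(v, u), by simp [h', h.1.symm], Sym2.eq_swap⟩

/-- On a `k`-regular graph the norm of a 0-cochain is proportional to the size of its support. -/
theorem normV_eq_of_isRegularOfDegree {V : Type} [Fintype V] [DecidableEq V]
    (G : SimpleGraph V) [DecidableRel G.Adj] {k : ℕ} (hreg : G.IsRegularOfDegree k)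
    (f : V → ZMod 2) :
    normV G f = k / (2 * (G.edgeFinset.card : ℝ)) * (univ.filter fun v => f v ≠ 0).card := by
  simp only [normV, hreg.degree_eq, sum_const, nsmul_eq_mul]
  ring

/-- On a `k`-regular graph `‖[f]‖` is proportional to the smaller of the support and the
zero set of `f`. -/
theorem normClass_eq_of_isRegularOfDegree {V : Type} [Fintype V] [DecidableEq V]
    (G : SimpleGraph V) [DecidableRel G.Adj] {k : ℕ} (hreg : G.IsRegularOfDegree k)
    (f : V → ZMod 2) :
    normClass G f = k / (2 * (G.edgeFinset.card : ℝ)) *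
      min ((univ.filter fun v => f v ≠ 0).card : ℝ) ((univ.filter fun v => f v = 0).card : ℝ) := by
  have h1 : ∀ a : ZMod 2, a + 1 ≠ 0 ↔ a = 0 := by decide
  have hset : {r : ℝ | ∃ c : ZMod 2, r = normV G (fun v => f v + c)} =
      {normV G f, normV G (fun v => f v + 1)} := by
    ext r
    simp only [Set.mem_ofPred_eq, Set.mem_insert_iff, Set.mem_singleton_iff]
    constructor
    · rintro ⟨c, rfl⟩
      have hc : ∀ c : ZMod 2, c = 0 ∨ c = 1 := by decide
      rcases hc c with rfl | rfl
      · left; simp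
      · right; rfl
    · rintro (rfl | rfl)
      · exact ⟨0, by simp⟩
      · exact ⟨1, rfl⟩
  rw [normClass, hset, csInf_pair, normV_eq_of_isRegularOfDegree G hreg,
    normV_eq_of_isRegularOfDegree G hreg, mul_min_of_nonneg _ _ (by positivity)]
  simp only [h1]

/-- The expansion ratio of a 0-cochain on a regular graph with at least one edge is `2 / k`
times the Cheeger ratio of the induced partition. -/
theorem normE_div_normClass {V : Type} [Fintype V] [DecidableEq V]
    (G : SimpleGraph V) [DecidableRel G.Adj] {k : ℕ} (hreg : G.IsRegularOfDegree k)
    (hE : G.edgeFinset.card ≠ 0) (f : V → ZMod 2) :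
    normE G (gcoboundary f) / normClass G f = 2 / (k : ℝ) *
      (((((univ.filter fun v => f v ≠ 0) ×ˢ (univ.filter fun v => f v = 0)).filter
        fun p => G.Adj p.1 p.2).card : ℝ) /
      min ((univ.filter fun v => f v ≠ 0).card : ℝ)
        ((univ.filter fun v => f v = 0).card : ℝ)) := by
  rw [normClass_eq_of_isRegularOfDegree G hreg, normE, sum_const, nsmul_eq_mul,
    card_filter_gcoboundary_ne_zero]
  have hE' : (G.edgeFinset.card : ℝ) ≠ 0 := by exact_mod_cast hE
  field_simp

/-- for a finite connected `k`-regular graph with at least two vertices,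
`𝓱₀(X) = (2/k)·h(X)`. -/
theorem coboundary_expansion_eq_cheeger {V : Type} [Fintype V] [DecidableEq V]
    (G : SimpleGraph V) [DecidableRel G.Adj] (k : ℕ)
    (hconn : G.Connected) (hreg : G.IsRegularOfDegree k)
    (hcard : 2 ≤ Fintype.card V) :
    coboundaryExp0 G = (2 / (k : ℝ)) * cheegerConst G := by
  have hE : G.edgeFinset.card ≠ 0 := by
    have := hconn.card_vert_le_card_edgeSet_add_one
    rw [Nat.card_eq_fintype_card, Nat.card_eq_fintype_card, ← SimpleGraph.edgeFinset_card] at this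
    omega
  rw [coboundaryExp0, cheegerConst, ← smul_eq_mul, ← Real.sInf_smul_of_nonneg (by positivity)]
  congr 1
  ext r
  simp only [Set.mem_smul_set, Set.mem_ofPred_eq, smul_eq_mul]
  constructor
  · rintro ⟨f, hf, rfl⟩
    refine ⟨_, ⟨univ.filter fun v => f v ≠ 0, univ.filter fun v => f v = 0, ?_, ?_, ?_, ?_, rfl⟩,
      (normE_div_normClass G hreg hE f).symm⟩
    · by_contra h
      refine hf ⟨0, fun v => ?_⟩
      simpa using filter_eq_empty_iff.1 (not_nonempty_iff_eq_empty.1 h) (mem_univ v)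
    · by_contra h
      refine hf ⟨1, fun v => ?_⟩
      have h1 : ∀ a : ZMod 2, a ≠ 0 → a = 1 := by decide
      exact h1 _ (filter_eq_empty_iff.1 (not_nonempty_iff_eq_empty.1 h) (mem_univ v))
    · exact (disjoint_filter_filter_not _ _ _).symm
    · rw [union_comm]
      exact filter_union_filter_not_eq _ _
  · rintro ⟨_, ⟨A, B, ⟨a, ha⟩, ⟨b, hb⟩, hd, hu, rfl⟩, rfl⟩
    have hB : B = Aᶜ := (IsCompl.of_eq hd.eq_bot hu).compl_eq.symm
    subst hB
    refine ⟨fun v => if v ∈ A then 1 else 0, ?_, ?_⟩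
    · rintro ⟨c, hc⟩
      have h := (hc a).trans (hc b).symm
      simp [ha, mem_compl.1 hb] at h
    · have h1 : (univ.filter fun v => (if v ∈ A then (1 : ZMod 2) else 0) ≠ 0) = A := by
        ext v; simp
      have h2 : (univ.filter fun v => (if v ∈ A then (1 : ZMod 2) else 0) = 0) = Aᶜ := by
        ext v; simp
      rw [normE_div_normClass G hreg hE, h1, h2]
end

section
/- (Gromov's topological overlap theorem) For every d ≥ 1 there exists a constant c_d > 0 such that for every n ≥ d+1 and every continuous map f : |Δ_n^{(d)}| → ℝ^d, there exists a point z ∈ ℝ^d such that z ∈ f(|σ|) for at least c_d·C(n,d+1) of the (d+1)-element subsets σ of {1,…,n}. -/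
open Finset
open scoped Classical

/-- The geometric realization of the complete `d`-dimensional complex `Δₙ^{(d)}` on `n`
vertices, as a subset of `ℝⁿ`: convex coefficient vectors supported on at most `d+1`
vertices. -/
def completeRealization (n d : ℕ) : Set (Fin n → ℝ) :=
  {x | (∀ v, 0 ≤ x v) ∧ (∑ v, x v) = 1 ∧
    (Finset.univ.filter fun v => x v ≠ 0).card ≤ d + 1}

/-- `|σ|`: the points of the realization supported on the face `σ`. -/
def completeFaceReal (n d : ℕ) (σ : Finset (Fin n)) : Set (Fin n → ℝ) :=
  {x ∈ completeRealization n d | ∀ v, x v ≠ 0 → v ∈ σ}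

/-! ### A cubical form of Kuhn's labelling lemma -/

section Kuhn

variable {ι : Type*}

lemma sum_sum_erase_comm {M : Type*} [AddCommMonoid M] (S : Finset ι) (a : ι → ι → M) :
    ∑ i ∈ S, ∑ j ∈ S.erase i, a i j = ∑ i ∈ S, ∑ j ∈ S.erase i, a j i := by
  refine Finset.sum_comm' fun i j => ?_
  simp only [Finset.mem_erase]
  tauto

lemma sum_sum_erase_eq_zero_of_symm (S : Finset ι) (a : ι → ι → ZMod 2)
    (ha : ∀ i j, a i j = a j i) : ∑ i ∈ S, ∑ j ∈ S.erase i, a i j = 0 := by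
  rw [Finset.sum_sigma']
  refine Finset.sum_involution (fun p _ => ⟨p.2, p.1⟩) ?_ ?_ ?_ ?_
  · rintro ⟨i, j⟩ _
    simp only [ha i j]
    exact CharTwo.add_self_eq_zero _
  · rintro ⟨i, j⟩ hp _ h
    simp only [Finset.mem_sigma, Finset.mem_erase] at hp
    simp only [Sigma.mk.injEq, heq_eq_eq] at h
    exact hp.2.1 h.1
  · rintro ⟨i, j⟩ hp
    simp only [Finset.mem_sigma, Finset.mem_erase] at hp ⊢
    exact ⟨hp.2.2, fun h => hp.2.1 h.symm, hp.1⟩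
  · rintro ⟨i, j⟩ _
    rfl

/-- The cup product modulo 2 of the coboundaries of the functions `F i`, `i ∈ L`, evaluated on the
unit cube with base point `x` and directions `S`. -/
noncomputable def cupCoboundary (F : ι → (ι → ℕ) → ZMod 2) : List ι → Finset ι → (ι → ℕ) → ZMod 2
  | [], S, _ => if S = ∅ then 1 else 0
  | k :: L, S, x => ∑ i ∈ S, (F k (x + Pi.single i 1) + F k x) *
      cupCoboundary F L (S.erase i) (x + Pi.single i 1)

variable (F : ι → (ι → ℕ) → ZMod 2)

lemma cupCoboundary_closed (L : List ι) (S : Finset ι) (x : ι → ℕ) :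
    ∑ i ∈ S, (cupCoboundary F L (S.erase i) (x + Pi.single i 1) +
      cupCoboundary F L (S.erase i) x) = 0 := by
  induction L generalizing S x with
  | nil => exact Finset.sum_eq_zero fun i _ => CharTwo.add_self_eq_zero _
  | cons k L ih =>
    set e : ι → ι → ℕ := fun i => Pi.single i 1 with he
    set W : ι → ι → (ι → ℕ) → ZMod 2 := fun i j y => cupCoboundary F L ((S.erase i).erase j) y
      with hW
    have hWs : ∀ i j, W i j = W j i := fun i j => by
      simp only [hW, Finset.erase_right_comm]
    have ih' : ∀ i y, ∑ j ∈ S.erase i, W i j (y + e j) = ∑ j ∈ S.erase i, W i j y := by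
      intro i y
      have := ih (S.erase i) y
      rwa [Finset.sum_add_distrib, CharTwo.add_eq_zero] at this
    have h1 : ∑ i ∈ S, ∑ j ∈ S.erase i, F k (x + e i + e j) * W i j (x + e i + e j) = 0 :=
      sum_sum_erase_eq_zero_of_symm S _ fun i j => by
        rw [hWs i j, add_right_comm]
    have h2 : ∑ i ∈ S, ∑ j ∈ S.erase i, F k (x + e i) * W i j (x + e i + e j) =
        ∑ i ∈ S, ∑ j ∈ S.erase i, F k (x + e j) * W i j (x + e j) := by
      rw [sum_sum_erase_comm S (fun i j => F k (x + e j) * W i j (x + e j))]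
      refine Finset.sum_congr rfl fun i _ => ?_
      rw [← Finset.mul_sum, ← Finset.mul_sum, ih']
      simp only [hWs]
    have h3 : ∑ i ∈ S, ∑ j ∈ S.erase i, F k x * W i j (x + e j) = 0 := by
      have : ∀ i ∈ S, ∑ j ∈ S.erase i, F k x * W i j (x + e j) =
          ∑ j ∈ S.erase i, F k x * W i j x := fun i _ => by
        rw [← Finset.mul_sum, ← Finset.mul_sum, ih']
      rw [Finset.sum_congr rfl this]
      exact sum_sum_erase_eq_zero_of_symm S _ fun i j => by rw [hWs i j]
    have h4 : ∀ a : ZMod 2, a + a = 0 := CharTwo.add_self_eq_zero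
    calc _ = ∑ i ∈ S, ∑ j ∈ S.erase i, F k (x + e i + e j) * W i j (x + e i + e j) +
          ∑ i ∈ S, ∑ j ∈ S.erase i, F k (x + e i) * W i j (x + e i + e j) +
          (∑ i ∈ S, ∑ j ∈ S.erase i, F k (x + e j) * W i j (x + e j) +
          ∑ i ∈ S, ∑ j ∈ S.erase i, F k x * W i j (x + e j)) := by
            simp only [← Finset.sum_add_distrib, cupCoboundary]
            refine Finset.sum_congr rfl fun i _ => ?_
            refine Finset.sum_congr rfl fun j _ => ?_
            ring
      _ = 0 := by rw [h1, h2, h3, zero_add, add_zero, h4]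

lemma cupCoboundary_eq_zero {m : ℕ}
    (hF : ∀ i x y, (x i = 0 ∧ y i = 0 ∨ x i = m ∧ y i = m) → F i x = F i y)
    {i : ι} {L : List ι} (hi : i ∈ L) {S : Finset ι} (hS : i ∉ S) {x : ι → ℕ}
    (hx : x i = 0 ∨ x i = m) : cupCoboundary F L S x = 0 := by
  induction L generalizing S x with
  | nil => simp at hi
  | cons k L ih =>
    refine Finset.sum_eq_zero fun j hj => ?_
    have hij : i ≠ j := fun h => hS (h ▸ hj)
    have hxj : (x + Pi.single j 1 : ι → ℕ) i = x i := by simp [Pi.single_eq_of_ne hij]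
    rcases List.mem_cons.1 hi with rfl | hi
    · rw [hF i (x + Pi.single j 1) x (by rw [hxj]; tauto), CharTwo.add_self_eq_zero, zero_mul]
    · rw [ih hi (fun h => hS (Finset.mem_of_mem_erase h)) (by rwa [hxj]), mul_zero]

lemma exists_ne_of_cupCoboundary_ne_zero {L : List ι} {S : Finset ι} {x : ι → ℕ}
    (h : cupCoboundary F L S x ≠ 0) {i : ι} (hi : i ∈ L) :
    ∃ y z : ι → ℕ, (∀ j, x j ≤ y j ∧ y j ≤ x j + if j ∈ S then 1 else 0) ∧
      (∀ j, x j ≤ z j ∧ z j ≤ x j + if j ∈ S then 1 else 0) ∧ F i y ≠ F i z := by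
  induction L generalizing S x with
  | nil => simp at hi
  | cons k L ih =>
    obtain ⟨j, hj, hne⟩ := Finset.exists_ne_zero_of_sum_ne_zero h
    have hs : ∀ l, (Pi.single j 1 : ι → ℕ) l + (if l ∈ S.erase j then 1 else 0) =
        if l ∈ S then 1 else 0 := fun l => by
      by_cases hl : l = j
      · subst hl; simp [hj]
      · simp [hl]
    rcases List.mem_cons.1 hi with rfl | hi
    · refine ⟨x + Pi.single j 1, x, fun l => ?_, fun l => by omega, fun heq => ?_⟩
      · have := hs l
        simp only [Pi.add_apply]
        omega
      · rw [heq, CharTwo.add_self_eq_zero, zero_mul] at hne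
        exact hne rfl
    · obtain ⟨y, z, hy, hz, hyz⟩ := ih (right_ne_zero_of_mul hne) hi
      refine ⟨y, z, fun l => ?_, fun l => ?_, hyz⟩
      · have := hs l
        have := hy l
        simp only [Pi.add_apply] at this
        omega
      · have := hs l
        have := hz l
        simp only [Pi.add_apply] at this
        omega

variable [Fintype ι]

/-- Base points of the unit cubes in the face of `[0, m]^ι` where coordinates outside `S` are
`m`. -/
noncomputable def faceBasePoints (m : ℕ) (S : Finset ι) : Finset (ι → ℕ) :=
  Fintype.piFinset fun i => if i ∈ S then Finset.range m else {m}

lemma sum_faceBasePoints (m : ℕ) {S : Finset ι} {i : ι} (hi : i ∈ S)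
    (h : (ι → ℕ) → ZMod 2) :
    ∑ x ∈ faceBasePoints m S, (h (x + Pi.single i 1) + h x) =
      ∑ y ∈ faceBasePoints m (S.erase i), (h y + h (Function.update y i 0)) := by
  have key : ∀ g : (ι → ℕ) → ZMod 2, ∑ x ∈ faceBasePoints m S, g x =
      ∑ y ∈ faceBasePoints m (S.erase i), ∑ t ∈ Finset.range m, g (Function.update y i t) := by
    intro g
    rw [Finset.sum_sigma']
    refine Finset.sum_bij' (fun x _ => ⟨Function.update x i m, x i⟩)
      (fun p _ => Function.update p.1 i p.2) ?_ ?_ ?_ ?_ ?_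
    · intro x hx
      simp only [faceBasePoints, Fintype.mem_piFinset, Finset.mem_sigma] at hx ⊢
      refine ⟨fun j => ?_, by simpa [hi] using hx i⟩
      by_cases hj : j = i
      · subst hj; simp
      · simpa [hj] using hx j
    · rintro ⟨y, t⟩ hp
      simp only [faceBasePoints, Fintype.mem_piFinset, Finset.mem_sigma] at hp ⊢
      intro j
      by_cases hj : j = i
      · subst hj; simpa [hi] using hp.2
      · simpa [hj] using hp.1 j
    · intro x _
      simp
    · rintro ⟨y, t⟩ hp
      simp only [faceBasePoints, Fintype.mem_piFinset, Finset.mem_sigma] at hp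
      have : y i = m := by simpa using hp.1 i
      simp [← this]
    · intro x _
      simp
  rw [key]
  refine Finset.sum_congr rfl fun y hy => ?_
  simp only [faceBasePoints, Fintype.mem_piFinset] at hy
  have hym : y i = m := by simpa using hy i
  have hstep : ∀ t, Function.update y i t + Pi.single i 1 = Function.update y i (t + 1) := by
    intro t
    ext j
    by_cases hj : j = i
    · subst hj; simp
    · simp [hj]
  simp only [hstep, ← CharTwo.sub_eq_add]
  rw [Finset.sum_range_sub (fun t => h (Function.update y i t)), ← hym, Function.update_eq_self]

lemma sum_cupCoboundary_eq_one {m : ℕ} (h0 : ∀ i x, x i = 0 → F i x = 0)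
    (h1 : ∀ i x, x i = m → F i x = 1) (L : List ι) (hL : L.Nodup) :
    ∑ x ∈ faceBasePoints m L.toFinset, cupCoboundary F L L.toFinset x = 1 := by
  have hF : ∀ i x y, (x i = 0 ∧ y i = 0 ∨ x i = m ∧ y i = m) → F i x = F i y := by
    rintro i x y (⟨hx, hy⟩ | ⟨hx, hy⟩)
    · rw [h0 i x hx, h0 i y hy]
    · rw [h1 i x hx, h1 i y hy]
  induction L with
  | nil => simp [faceBasePoints, cupCoboundary]
  | cons k L ih =>
    rw [List.nodup_cons] at hL
    set S := (k :: L).toFinset with hS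
    have hkS : k ∈ S := by simp [hS]
    have hSk : S.erase k = L.toFinset := by
      ext j
      simp only [hS, List.toFinset_cons, Finset.mem_erase, Finset.mem_insert, List.mem_toFinset]
      constructor
      · tauto
      · exact fun h => ⟨fun hj => hL.1 (hj ▸ h), Or.inr h⟩
    have hexp : ∀ x, cupCoboundary F (k :: L) S x =
        ∑ i ∈ S, (F k (x + Pi.single i 1) * cupCoboundary F L (S.erase i) (x + Pi.single i 1) +
          F k x * cupCoboundary F L (S.erase i) x) := by
      intro x
      have hc := cupCoboundary_closed F L S x
      rw [Finset.sum_add_distrib, CharTwo.add_eq_zero] at hc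
      simp only [cupCoboundary, add_mul, Finset.sum_add_distrib, ← Finset.mul_sum, hc]
    simp only [hexp]
    rw [Finset.sum_comm, Finset.sum_eq_single_of_mem k hkS]
    · rw [sum_faceBasePoints m hkS (fun x => F k x * cupCoboundary F L (S.erase k) x), hSk,
        ← ih hL.2]
      refine Finset.sum_congr rfl fun y hy => ?_
      simp only [faceBasePoints, Fintype.mem_piFinset] at hy
      have hym : y k = m := by simpa [hL.1] using hy k
      rw [h1 k y hym, h0 k (Function.update y k 0) (by simp)]
      simp
    · intro i hi hik
      have hiL : i ∈ L := by
        rw [hS, List.toFinset_cons, Finset.mem_insert, List.mem_toFinset] at hi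
        tauto
      rw [sum_faceBasePoints m hi (fun x => F k x * cupCoboundary F L (S.erase i) x)]
      refine Finset.sum_eq_zero fun y hy => ?_
      simp only [faceBasePoints, Fintype.mem_piFinset] at hy
      have hym : y i = m := by simpa using hy i
      rw [cupCoboundary_eq_zero F hF hiL (Finset.notMem_erase i S) (Or.inr hym),
        cupCoboundary_eq_zero F hF hiL (Finset.notMem_erase i S) (Or.inl (by simp))]
      simp

/-- **Kuhn's lemma**: some cell of the grid `[0, m]^ι` meets both values of every label. -/
theorem exists_cell_forall_label_ne {m : ℕ} (h0 : ∀ i x, x i = 0 → F i x = 0)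
    (h1 : ∀ i x, x i = m → F i x = 1) :
    ∃ x : ι → ℕ, (∀ j, x j < m) ∧ ∀ i, ∃ y z : ι → ℕ,
      (∀ j, x j ≤ y j ∧ y j ≤ x j + 1) ∧
      (∀ j, x j ≤ z j ∧ z j ≤ x j + 1) ∧ F i y ≠ F i z := by
  have h := sum_cupCoboundary_eq_one F h0 h1 (Finset.univ : Finset ι).toList
    (Finset.nodup_toList _)
  rw [Finset.toList_toFinset] at h
  obtain ⟨x, hx, hne⟩ := Finset.exists_ne_zero_of_sum_ne_zero (h ▸ one_ne_zero)
  refine ⟨x, fun j => by simpa [faceBasePoints] using Fintype.mem_piFinset.1 hx j, fun i => ?_⟩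
  simpa using exists_ne_of_cupCoboundary_ne_zero F hne (Finset.mem_toList.2 (Finset.mem_univ i))

end Kuhn

/-- **Poincaré–Miranda theorem** on the unit cube. -/
theorem exists_eq_zero_of_sign_on_faces {ι : Type*} [Fintype ι] {g : (ι → ℝ) → ι → ℝ}
    (hg : ContinuousOn g (Set.Icc 0 1))
    (h0 : ∀ x ∈ Set.Icc (0 : ι → ℝ) 1, ∀ i, x i = 0 → g x i ≤ 0)
    (h1 : ∀ x ∈ Set.Icc (0 : ι → ℝ) 1, ∀ i, x i = 1 → 0 ≤ g x i) :
    ∃ x ∈ Set.Icc (0 : ι → ℝ) 1, g x = 0 := by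
  by_contra! hne
  have hK : IsCompact (Set.Icc (0 : ι → ℝ) 1) := isCompact_Icc
  obtain ⟨x₀, hx₀, hmin⟩ := hK.exists_isMinOn (Set.nonempty_Icc.2 zero_le_one) hg.norm
  set δ := ‖g x₀‖ with hδ
  have hδ0 : 0 < δ := norm_pos_iff.2 (hne x₀ hx₀)
  obtain ⟨η, hη, hu⟩ := Metric.uniformContinuousOn_iff.1
    (hK.uniformContinuousOn_of_continuous hg) δ hδ0
  obtain ⟨m', hm'⟩ := exists_nat_one_div_lt hη
  set m := m' + 1 with hm
  have hmpos : (0 : ℝ) < m := by positivity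
  have hmη : 1 / (m : ℝ) < η := by rw [hm]; push_cast; exact hm'
  set p : (ι → ℕ) → ι → ℝ := fun y j => (y j : ℝ) / m with hp
  let F : ι → (ι → ℕ) → ZMod 2 := fun i y =>
    if y i = 0 then 0 else if y i = m then 1 else if 0 ≤ g (p y) i then 1 else 0
  obtain ⟨x, hxm, hx⟩ := exists_cell_forall_label_ne F (m := m)
    (fun i y hy => by simp [F, hy]) (fun i y hy => by simp [F, hy, hm])
  have hpmem : ∀ y : ι → ℕ, (∀ j, y j ≤ x j + 1) → p y ∈ Set.Icc (0 : ι → ℝ) 1 := by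
    intro y hy
    refine ⟨fun j => by simp only [hp, Pi.zero_apply]; positivity, fun j => ?_⟩
    have : y j ≤ m := (hy j).trans (hxm j)
    simp only [hp, Pi.one_apply]
    exact (div_le_one hmpos).2 (by exact_mod_cast this)
  have hclose : ∀ y : ι → ℕ, (∀ j, x j ≤ y j ∧ y j ≤ x j + 1) → ∀ i,
      |g (p y) i - g (p x) i| < δ := by
    intro y hy i
    have hd : dist (p y) (p x) < η := by
      refine lt_of_le_of_lt ((dist_pi_le_iff (by positivity)).2 fun j => ?_) hmη
      simp only [hp]
      rw [Real.dist_eq, ← sub_div, abs_div, abs_of_pos hmpos]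
      refine div_le_div_of_nonneg_right ?_ hmpos.le
      have h1 : (x j : ℝ) ≤ y j := by exact_mod_cast (hy j).1
      have h2 : (y j : ℝ) ≤ x j + 1 := by exact_mod_cast (hy j).2
      rw [abs_le]
      constructor <;> linarith
    have := hu _ (hpmem y fun j => (hy j).2) _ (hpmem x fun j => Nat.le_succ _) hd
    exact lt_of_le_of_lt (dist_le_pi_dist (g (p y)) (g (p x)) i) this
  have hF1 : ∀ i (y : ι → ℕ), (∀ j, y j ≤ x j + 1) → F i y = 1 → 0 ≤ g (p y) i := by
    intro i y hy h
    by_cases hy0 : y i = 0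
    · simp [F, hy0] at h
    by_cases hym : y i = m
    · exact h1 _ (hpmem y hy) i (by simp [hp, hym, hmpos.ne'])
    by_contra hgy
    simp [F, hy0, hym, hgy] at h
  have hF0 : ∀ i (y : ι → ℕ), (∀ j, y j ≤ x j + 1) → F i y ≠ 1 → g (p y) i ≤ 0 := by
    intro i y hy h
    by_cases hy0 : y i = 0
    · exact h0 _ (hpmem y hy) i (by simp [hp, hy0])
    by_cases hym : y i = m
    · simp [F, hym, hm] at h
    by_contra hgy
    simp [F, hy0, hym, (not_le.1 hgy).le] at h
  have hnorm : δ ≤ ‖g (p x)‖ := hmin (hpmem x fun j => Nat.le_succ _)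
  have hi : ∃ i, δ ≤ |g (p x) i| := by
    by_contra! hlt
    exact absurd ((pi_norm_lt_iff hδ0).2 hlt) (not_lt.2 hnorm)
  obtain ⟨i, hi⟩ := hi
  have hsign : ∃ y z : ι → ℕ, (∀ j, x j ≤ y j ∧ y j ≤ x j + 1) ∧
      (∀ j, x j ≤ z j ∧ z j ≤ x j + 1) ∧ 0 ≤ g (p y) i ∧ g (p z) i ≤ 0 := by
    obtain ⟨y, z, hy, hz, hyz⟩ := hx i
    by_cases h : F i y = 1
    · exact ⟨y, z, hy, hz, hF1 i y (fun j => (hy j).2) h,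
        hF0 i z (fun j => (hz j).2) fun h' => hyz (h.trans h'.symm)⟩
    · refine ⟨z, y, hz, hy, hF1 i z (fun j => (hz j).2) ?_, hF0 i y (fun j => (hy j).2) h⟩
      generalize F i y = a at *
      generalize F i z = c at *
      revert a c
      decide
  obtain ⟨y, z, hy, hz, hgy, hgz⟩ := hsign
  have hy' := abs_lt.1 (hclose y hy i)
  have hz' := abs_lt.1 (hclose z hz i)
  rcases le_abs.1 hi with h | h <;> linarith

/-! ### Covering the cube by `d + 1` families of disjoint small bricks -/

section Brick

variable {d N : ℕ}

/-- The open cube of side `1 / N` with lower corner `(τ.2 - τ.1 / (d + 1)) / N`; the first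
component of `τ` is the colour of the brick. -/
def brick (τ : Fin (d + 1) × (Fin d → Fin (N + 1))) : Set (Fin d → ℝ) :=
  {z | ∀ i, (τ.2 i : ℝ) < N * z i + τ.1 / (d + 1) ∧ N * z i + τ.1 / (d + 1) < τ.2 i + 1}

/-- The positions of two bricks differ by at most one in each coordinate. -/
def BrickAdj (τ τ' : Fin (d + 1) × (Fin d → Fin (N + 1))) : Prop :=
  ∀ i, (τ.2 i : ℕ) ≤ τ'.2 i + 1 ∧ (τ'.2 i : ℕ) ≤ τ.2 i + 1

lemma isOpen_brick (τ : Fin (d + 1) × (Fin d → Fin (N + 1))) : IsOpen (brick τ) := by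
  have : brick τ = ⋂ i, {z : Fin d → ℝ | (τ.2 i : ℝ) < N * z i + τ.1 / (d + 1)} ∩
      {z | N * z i + τ.1 / (d + 1) < τ.2 i + 1} := by
    ext z
    simp [brick]
  rw [this]
  exact isOpen_iInter_of_finite fun i =>
    (isOpen_lt continuous_const (by fun_prop)).inter (isOpen_lt (by fun_prop) continuous_const)

lemma brickAdj_of_mem {τ τ' : Fin (d + 1) × (Fin d → Fin (N + 1))} {z : Fin d → ℝ}
    (h : z ∈ brick τ) (h' : z ∈ brick τ') : BrickAdj τ τ' := by
  have hk : ∀ k : Fin (d + 1), (0 : ℝ) ≤ (k : ℝ) / (d + 1) ∧ (k : ℝ) / (d + 1) < 1 := fun k =>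
    ⟨by positivity, (div_lt_one (by positivity)).2 (by exact_mod_cast k.2)⟩
  have aux : ∀ {σ σ' : Fin (d + 1) × (Fin d → Fin (N + 1))}, z ∈ brick σ → z ∈ brick σ' →
      ∀ i, (σ.2 i : ℕ) ≤ σ'.2 i + 1 := by
    intro σ σ' hσ hσ' i
    have h1 := (hσ i).1
    have h2 := (hσ' i).2
    have : ((σ.2 i : ℕ) : ℝ) < (σ'.2 i : ℕ) + 2 := by linarith [hk σ.1, hk σ'.1]
    have : (σ.2 i : ℕ) < σ'.2 i + 2 := by exact_mod_cast this
    omega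
  exact fun i => ⟨aux h h' i, aux h' h i⟩

lemma eq_of_mem_brick {τ τ' : Fin (d + 1) × (Fin d → Fin (N + 1))} {z : Fin d → ℝ}
    (h : z ∈ brick τ) (h' : z ∈ brick τ') (hc : τ.1 = τ'.1) : τ = τ' := by
  refine Prod.ext hc (funext fun i => Fin.ext ?_)
  have h1 := h i
  have h2 := h' i
  rw [hc] at h1
  have a : ((τ.2 i : ℕ) : ℝ) < (τ'.2 i : ℕ) + 1 := h1.1.trans h2.2
  have b : ((τ'.2 i : ℕ) : ℝ) < (τ.2 i : ℕ) + 1 := h2.1.trans h1.2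
  norm_cast at a b
  omega

lemma exists_mem_brick {z : Fin d → ℝ} (hz : z ∈ Set.Icc (0 : Fin d → ℝ) 1) :
    ∃ τ : Fin (d + 1) × (Fin d → Fin (N + 1)), z ∈ brick τ := by
  have hgood : ∃ k : Fin (d + 1), ∀ i, ∀ a : ℤ, (N : ℝ) * z i + k / (d + 1) ≠ a := by
    by_contra! hbad
    choose i a hia using hbad
    obtain ⟨k, k', hne, hkk⟩ := Fintype.exists_ne_map_eq_of_card_lt i (by simp)
    have h1 := hia k
    have h2 := hia k'
    rw [hkk] at h1
    have hd : (0 : ℝ) < d + 1 := by positivity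
    have h3 : ((k : ℕ) : ℝ) - (k' : ℕ) = (d + 1) * (a k - a k') := by
      have : ((k : ℕ) : ℝ) / (d + 1) - (k' : ℕ) / (d + 1) = a k - a k' := by linarith
      rw [← this]
      field_simp
    have h4 : ((k : ℕ) : ℤ) - (k' : ℕ) = (d + 1) * (a k - a k') := by exact_mod_cast h3
    have h5 : ((k : ℕ) : ℤ) - (k' : ℕ) = 0 :=
      Int.eq_zero_of_abs_lt_dvd (m := (d : ℤ) + 1) ⟨_, h4⟩ (by rw [abs_lt]; omega)
    exact hne (Fin.ext (by omega))
  obtain ⟨k, hk⟩ := hgood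
  have hpos : ∀ i, 0 ≤ (N : ℝ) * z i + k / (d + 1) := fun i => by
    have := hz.1 i
    simp only [Pi.zero_apply] at this
    positivity
  have hlt : ∀ i, (N : ℝ) * z i + k / (d + 1) < (N + 1 : ℕ) := fun i => by
    have h1 : (N : ℝ) * z i ≤ N := mul_le_of_le_one_right (by positivity) (hz.2 i)
    have h2 : ((k : ℕ) : ℝ) / (d + 1) < 1 :=
      (div_lt_one (by positivity)).2 (by exact_mod_cast k.2)
    push_cast
    linarith
  refine ⟨(k, fun i => ⟨⌊(N : ℝ) * z i + k / (d + 1)⌋₊, (Nat.floor_lt (hpos i)).2 (hlt i)⟩),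
    fun i => ⟨lt_of_le_of_ne (Nat.floor_le (hpos i)) fun h => ?_, Nat.lt_floor_add_one _⟩⟩
  exact hk i (⌊(N : ℝ) * z i + k / (d + 1)⌋₊ : ℤ) (by rw [Int.cast_natCast]; exact h.symm)

lemma card_brickAdj_le (τ : Fin (d + 1) × (Fin d → Fin (N + 1))) :
    #{τ' | BrickAdj τ τ'} ≤ (d + 1) * 3 ^ d := by
  calc #{τ' | BrickAdj τ τ'}
      ≤ #((Finset.univ : Finset (Fin (d + 1))) ×ˢ Fintype.piFinset fun i =>
          {a : Fin (N + 1) | (τ.2 i : ℕ) ≤ a + 1 ∧ (a : ℕ) ≤ τ.2 i + 1}) := by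
        refine Finset.card_le_card fun τ' h => ?_
        rw [Finset.mem_product, Fintype.mem_piFinset]
        exact ⟨Finset.mem_univ _, fun i =>
          Finset.mem_filter.2 ⟨Finset.mem_univ _, (Finset.mem_filter.1 h).2 i⟩⟩
    _ ≤ (d + 1) * 3 ^ d := by
        rw [Finset.card_product, Fintype.card_piFinset, Finset.card_univ, Fintype.card_fin]
        refine Nat.mul_le_mul_left _ ((Finset.prod_le_pow_card _ _ 3 fun i _ => ?_).trans (by simp))
        refine (Finset.card_le_card_of_injOn (t := Finset.Icc ((τ.2 i : ℕ) - 1) (τ.2 i + 1))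
          (fun a : Fin (N + 1) => (a : ℕ)) (fun a ha => ?_) Fin.val_injective.injOn).trans ?_
        · have := (Finset.mem_filter.1 ha).2
          rw [Finset.mem_coe, Finset.mem_Icc]
          show (τ.2 i : ℕ) - 1 ≤ (a : ℕ) ∧ (a : ℕ) ≤ τ.2 i + 1
          omega
        · rw [Nat.card_Icc]
          omega

lemma dist_le_of_mem_brick (hN : 0 < N) {τ : Fin (d + 1) × (Fin d → Fin (N + 1))}
    {z z' : Fin d → ℝ} (h : z ∈ brick τ) (h' : z' ∈ brick τ) : dist z z' ≤ 1 / N := by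
  have hN' : (0 : ℝ) < N := by exact_mod_cast hN
  refine (dist_pi_le_iff (by positivity)).2 fun i => ?_
  rw [Real.dist_eq, abs_sub_le_iff, le_div_iff₀ hN', le_div_iff₀ hN']
  have h1 := h i
  have h2 := h' i
  constructor <;> linarith

end Brick

/-! ### Robustly good sets of vertices -/

section Robust

variable {V : Type*} [Fintype V] [DecidableEq V] {b : Finset V → Prop} {ε : ℝ}

/-- `IsRobust b ε k S`: all but an `ε` fraction of the vertices `u` are such that all but an `ε`
fraction of the vertices `u'` are such that … the set obtained from `S` by adding `k` vertices in
this way does not satisfy `b`. -/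
def IsRobust (b : Finset V → Prop) (ε : ℝ) : ℕ → Finset V → Prop
  | 0, S => ¬ b S
  | k + 1, S => (#{u | ¬ IsRobust b ε k (insert u S)} : ℝ) ≤ ε * Fintype.card V

lemma IsRobust.not_bad [Nonempty V] (hb : Monotone b) (hε : ε < 1) {k : ℕ} {S : Finset V}
    (h : IsRobust b ε k S) : ¬ b S := by
  induction k generalizing S with
  | zero => exact h
  | succ k ih =>
    have hV : (0 : ℝ) < Fintype.card V := by exact_mod_cast Fintype.card_pos
    obtain ⟨u, hu⟩ : ∃ u, IsRobust b ε k (insert u S) := by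
      by_contra! hall
      simp only [IsRobust, hall, not_false_eq_true, Finset.filter_true, Finset.card_univ] at h
      nlinarith
    exact fun hS => ih hu (hb (Finset.subset_insert u S) hS)

lemma le_card_of_not_isRobust (hε : 0 ≤ ε) {k : ℕ} {S : Finset V} (h : ¬ IsRobust b ε k S) :
    (ε * Fintype.card V) ^ k ≤ #{x : Fin k → V | b (S ∪ Finset.univ.image x)} := by
  induction k generalizing S with
  | zero =>
    simp only [IsRobust, not_not] at h
    simp [h]
  | succ k ih =>
    set B : Finset V := {u | ¬ IsRobust b ε k (insert u S)} with hB
    have hBc : ε * Fintype.card V ≤ #B := (not_le.1 h).le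
    set T : V → Finset (Fin k → V) :=
      fun u => {x | b (insert u S ∪ Finset.univ.image x)} with hT
    have hle : ∑ u ∈ B, #(T u) ≤ #{x : Fin (k + 1) → V | b (S ∪ Finset.univ.image x)} := by
      rw [← Finset.card_sigma]
      refine Finset.card_le_card_of_injOn (fun p => Fin.cons p.1 p.2) ?_ ?_
      · rintro ⟨u, x⟩ hp
        simp only [Finset.mem_coe, Finset.mem_sigma, hT, Finset.mem_filter, Finset.mem_univ,
          true_and] at hp ⊢
        convert hp.2 using 1
        ext w
        simp only [Finset.mem_union, Finset.mem_image, Finset.mem_univ, true_and,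
          Finset.mem_insert, Fin.exists_fin_succ, Fin.cons_zero, Fin.cons_succ]
        tauto
      · rintro ⟨u, x⟩ _ ⟨u', x'⟩ _ h
        obtain ⟨h1, h2⟩ := Fin.cons_inj.1 h
        simp only at h1 h2
        subst h1 h2
        rfl
    calc (ε * Fintype.card V) ^ (k + 1) = ε * Fintype.card V * (ε * Fintype.card V) ^ k := by ring
      _ ≤ #B * (ε * Fintype.card V) ^ k := by gcongr
      _ = ∑ u ∈ B, (ε * Fintype.card V) ^ k := by simp
      _ ≤ ∑ u ∈ B, (#(T u) : ℝ) := Finset.sum_le_sum fun u hu => ih (Finset.mem_filter.1 hu).2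
      _ ≤ _ := by exact_mod_cast hle

lemma pow_succ_le_mul_descFactorial_add (n k : ℕ) (hk : k ≤ n) :
    n ^ (k + 1) ≤ n * n.descFactorial k + k ^ 2 * n ^ k := by
  induction k with
  | zero => simp
  | succ k ih =>
    have ih := ih (by omega)
    obtain ⟨t, rfl⟩ := Nat.exists_eq_add_of_le (show k ≤ n by omega)
    rw [Nat.descFactorial_succ, Nat.add_sub_cancel_left]
    set n := k + t
    have hkn : n ^ (k + 1) = (k + t) * n ^ k := pow_succ' _ _
    have h2 : n ^ (k + 1 + 1) = n * n ^ (k + 1) := pow_succ' _ _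
    calc n ^ (k + 1 + 1) = t * n ^ (k + 1) + k * n ^ (k + 1) := by rw [h2]; ring
      _ ≤ t * (n * n.descFactorial k + k ^ 2 * n ^ k) + k * n ^ (k + 1) := by gcongr
      _ ≤ _ := by
        rw [hkn]
        have : 0 ≤ n ^ k := Nat.zero_le _
        nlinarith [Nat.zero_le (k * k * k * n ^ k), Nat.zero_le (k * n ^ k * t),
          Nat.zero_le (n ^ k * t), Nat.zero_le (n ^ k * k), Nat.zero_le (k * k * n ^ k)]

lemma card_tuples_le (b : Finset V → Prop) (k : ℕ) (hk : k ≤ Fintype.card V) :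
    Fintype.card V * #{x : Fin k → V | b (Finset.univ.image x)} ≤
      Fintype.card V * (k ^ k * #{σ : Finset V | #σ = k ∧ b σ}) +
        k ^ 2 * Fintype.card V ^ k := by
  set n := Fintype.card V with hn
  have hinj : #{x : Fin k → V | Function.Injective x} = n.descFactorial k := by
    have := Fintype.card_embedding_eq (α := Fin k) (β := V)
    rw [Fintype.card_fin, ← Fintype.card_congr (Equiv.subtypeInjectiveEquivEmbedding (Fin k) V),
      Fintype.card_subtype] at this
    exact this
  have hall : #{x : Fin k → V | Function.Injective x} +
      #{x : Fin k → V | ¬ Function.Injective x} = n ^ k := by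
    rw [Finset.card_filter_add_card_filter_not]
    simp [hn]
  have hni : n * #{x : Fin k → V | ¬ Function.Injective x} ≤ k ^ 2 * n ^ k := by
    have h1 := pow_succ_le_mul_descFactorial_add n k hk
    rw [pow_succ', ← hall, hinj] at h1
    rw [← hall, hinj]
    nlinarith
  have hbad : #{x : Fin k → V | Function.Injective x ∧ b (Finset.univ.image x)} ≤
      k ^ k * #{σ : Finset V | #σ = k ∧ b σ} := by
    refine (Finset.card_le_mul_card_image_of_maps_to (f := fun x => Finset.univ.image x) ?_ (k ^ k)
      ?_)
    · intro x hx
      simp only [Finset.mem_filter, Finset.mem_univ, true_and] at hx ⊢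
      exact ⟨by rw [Finset.card_image_of_injective _ hx.1]; simp, hx.2⟩
    · intro σ hσ
      simp only [Finset.mem_filter, Finset.mem_univ, true_and] at hσ
      calc _ ≤ #(Fintype.piFinset fun _ : Fin k => σ) := by
            refine Finset.card_le_card fun x hx => ?_
            simp only [Finset.mem_filter] at hx
            exact Fintype.mem_piFinset.2 fun i =>
              hx.2 ▸ Finset.mem_image_of_mem _ (Finset.mem_univ i)
        _ = k ^ k := by simp [hσ.1]
  have hsplit : #{x : Fin k → V | b (Finset.univ.image x)} ≤
      #{x : Fin k → V | Function.Injective x ∧ b (Finset.univ.image x)} +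
        #{x : Fin k → V | ¬ Function.Injective x} := by
    refine (Finset.card_le_card fun x hx => ?_).trans (Finset.card_union_le _ _)
    simp only [Finset.mem_filter, Finset.mem_univ, true_and, Finset.mem_union] at hx ⊢
    tauto
  calc _ ≤ n * (k ^ k * #{σ : Finset V | #σ = k ∧ b σ} +
        #{x : Fin k → V | ¬ Function.Injective x}) := by gcongr; exact hsplit.trans (by gcongr)
    _ ≤ _ := by rw [mul_add]; gcongr

/-- Greedy choice, colour by colour, of vertices labelling a graph `adj` of bounded degree so that
every properly coloured clique gets a robust set of labels. -/
theorem exists_robust_labelling [Nonempty V] {P : Type*} [Fintype P] {D : ℕ} {color : P → ℕ}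
    (hcol : ∀ τ, color τ < D) {adj : P → P → Prop} {K : ℕ} (hK : ∀ τ, #{τ' | adj τ τ'} ≤ K)
    {b : P → Finset V → Prop} (hε : 0 ≤ ε) (hεK : K * 2 ^ K * ε < 1)
    (hb : ∀ ρ, IsRobust (b ρ) ε D ∅) :
    ∃ v : P → V, ∀ ρ, ∀ C : Finset P, (∀ τ ∈ C, adj τ ρ) → (∀ τ ∈ C, ∀ τ' ∈ C, adj τ τ') →
      Set.InjOn color C → IsRobust (b ρ) ε (D - #C) (C.image v) := by
  suffices H : ∀ k, ∃ v : P → V, ∀ ρ, ∀ C : Finset P, (∀ τ ∈ C, adj τ ρ) →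
      (∀ τ ∈ C, ∀ τ' ∈ C, adj τ τ') → Set.InjOn color C → (∀ τ ∈ C, color τ < k) →
      IsRobust (b ρ) ε (D - #C) (C.image v) by
    obtain ⟨v, hv⟩ := H D
    exact ⟨v, fun ρ C h1 h2 h3 => hv ρ C h1 h2 h3 fun τ _ => hcol τ⟩
  intro k
  induction k with
  | zero =>
    refine ⟨fun _ => Classical.arbitrary V, fun ρ C _ _ _ h => ?_⟩
    obtain rfl : C = ∅ := Finset.eq_empty_of_forall_notMem fun τ hτ => absurd (h τ hτ) (by simp)
    simpa using hb ρ
  | succ k ih =>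
    obtain ⟨v, hv⟩ := ih
    have hV : (0 : ℝ) < Fintype.card V := by exact_mod_cast Fintype.card_pos
    have hchoose : ∀ τ, ∃ u, ∀ ρ, ∀ C : Finset P, adj τ ρ → (∀ τ' ∈ C, adj τ τ') →
        ∀ j, IsRobust (b ρ) ε (j + 1) (C.image v) → j + 1 = D - #C →
        IsRobust (b ρ) ε j (insert u (C.image v)) := by
      intro τ
      set Nb : Finset P := {τ' | adj τ τ'} with hNb
      set Q : Finset (P × Finset P) := (Nb ×ˢ Nb.powerset).filter fun q =>
        ∃ j, IsRobust (b q.1) ε (j + 1) (q.2.image v) ∧ j + 1 = D - #q.2 with hQ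
      set Bd : P × Finset P → Finset V := fun q =>
        {u | ¬ IsRobust (b q.1) ε (D - #q.2 - 1) (insert u (q.2.image v))} with hBd
      have hcard : (#(Q.biUnion Bd) : ℝ) < Fintype.card V := by
        have h1 : ∀ q ∈ Q, (#(Bd q) : ℝ) ≤ ε * Fintype.card V := by
          intro q hq
          obtain ⟨-, j, hj, hjD⟩ := Finset.mem_filter.1 hq
          have : D - #q.2 - 1 = j := by omega
          simp only [hBd, this]
          exact hj
        have h2 : (#Q : ℝ) ≤ K * 2 ^ K := by
          have : #Q ≤ K * 2 ^ K := by
            refine (Finset.card_filter_le _ _).trans ?_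
            rw [Finset.card_product, Finset.card_powerset]
            exact Nat.mul_le_mul (hK τ) (Nat.pow_le_pow_right (by norm_num) (hK τ))
          exact_mod_cast this
        calc (#(Q.biUnion Bd) : ℝ) ≤ ∑ q ∈ Q, (#(Bd q) : ℝ) := by
              exact_mod_cast Finset.card_biUnion_le
          _ ≤ ∑ q ∈ Q, ε * Fintype.card V := Finset.sum_le_sum h1
          _ = #Q * (ε * Fintype.card V) := by simp
          _ ≤ K * 2 ^ K * (ε * Fintype.card V) := by gcongr
          _ = K * 2 ^ K * ε * Fintype.card V := by ring
          _ < Fintype.card V := by nlinarith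
      obtain ⟨u, hu⟩ : ∃ u, u ∉ Q.biUnion Bd := by
        by_contra! hall
        rw [Finset.eq_univ_iff_forall.2 hall, Finset.card_univ] at hcard
        exact lt_irrefl _ hcard
      refine ⟨u, fun ρ C hρ hC j hj hjD => ?_⟩
      by_contra hbad
      refine hu (Finset.mem_biUnion.2 ⟨(ρ, C), ?_, ?_⟩)
      · simp only [hQ, Finset.mem_filter, Finset.mem_product, Finset.mem_powerset, hNb,
          Finset.mem_univ, true_and]
        exact ⟨⟨hρ, fun τ' h => by simpa using hC τ' h⟩, j, hj, hjD⟩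
      · have : D - #C - 1 = j := by omega
        simpa [hBd, this] using hbad
    choose u hu using hchoose
    refine ⟨fun τ => if color τ = k then u τ else v τ, fun ρ C hρ hC hinj hlt => ?_⟩
    have himg : ∀ C' : Finset P, (∀ τ ∈ C', color τ < k) →
        C'.image (fun τ => if color τ = k then u τ else v τ) = C'.image v := fun C' h =>
      Finset.image_congr fun τ hτ => by simp [(h τ hτ).ne]
    by_cases hex : ∃ τ ∈ C, color τ = k
    · obtain ⟨τ, hτ, hτk⟩ := hex
      have hC' : ∀ τ' ∈ C.erase τ, color τ' < k := by
        intro τ' h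
        obtain ⟨hne, hm⟩ := Finset.mem_erase.1 h
        have : color τ' ≠ k := fun h' => hne (hinj hm hτ (h'.trans hτk.symm))
        have := hlt τ' hm
        omega
      have hsub := Finset.erase_subset τ C
      have hcardC : #(C.erase τ) ≤ k := by
        have := Finset.card_le_card_of_injOn (s := C.erase τ) (t := Finset.range k) color
          (fun τ' h => Finset.mem_coe.2 (Finset.mem_range.2 (hC' τ' h)))
          (hinj.mono (Finset.coe_subset.2 hsub))
        simpa using this
      have hkD : k < D := hτk ▸ hcol τ
      have hcardτ := Finset.card_erase_add_one hτ
      have hprev := hv ρ (C.erase τ) (fun τ' h => hρ τ' (hsub h))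
        (fun τ' h τ'' h' => hC τ' (hsub h) τ'' (hsub h'))
        (hinj.mono (Finset.coe_subset.2 hsub)) hC'
      have hD : D - #(C.erase τ) = D - #C + 1 := by omega
      have hnew := hu τ ρ (C.erase τ) (hρ τ hτ) (fun τ' h => hC τ hτ τ' (hsub h)) (D - #C)
        (hD ▸ hprev) hD.symm
      rw [← Finset.insert_erase hτ, Finset.image_insert, himg _ hC', if_pos hτk,
        Finset.insert_erase hτ]
      exact hnew
    · push Not at hex
      have hlt' : ∀ τ ∈ C, color τ < k := fun τ h => by
        have := hlt τ h
        have := hex τ h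
        omega
      rw [himg C hlt']
      exact hv ρ C hρ hC hinj hlt'

end Robust

/-! ### Overlap -/

lemma completeFaceReal_mono {n d : ℕ} {σ τ : Finset (Fin n)} (h : σ ⊆ τ) :
    completeFaceReal n d σ ⊆ completeFaceReal n d τ :=
  fun _ hx => ⟨hx.1, fun v hv => h (hx.2 v hv)⟩

lemma isCompact_completeFaceReal {n d : ℕ} {σ : Finset (Fin n)} (hσ : #σ = d + 1) :
    IsCompact (completeFaceReal n d σ) := by
  have heq : completeFaceReal n d σ =
      Set.Icc 0 1 ∩ ({x | ∑ v, x v = 1} ∩ ⋂ v ∈ {v | v ∉ σ}, {x : Fin n → ℝ | x v = 0}) := by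
    ext x
    simp only [completeFaceReal, completeRealization, Set.mem_inter_iff, Set.mem_ofPred_eq,
      Set.mem_iInter, Set.mem_Icc]
    constructor
    · rintro ⟨⟨h0, h1, -⟩, h3⟩
      refine ⟨⟨h0, fun v => ?_⟩, h1, fun v hv => by_contra fun h => hv (h3 v h)⟩
      rw [Pi.one_apply, ← h1]
      exact Finset.single_le_sum (fun w _ => h0 w) (Finset.mem_univ v)
    · rintro ⟨⟨h0, -⟩, h1, h3⟩
      have hsupp : ∀ v, x v ≠ 0 → v ∈ σ := fun v hv => by_contra fun h => hv (h3 v h)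
      refine ⟨⟨h0, h1, hσ ▸ Finset.card_le_card fun v hv => ?_⟩, hsupp⟩
      exact hsupp v (Finset.mem_filter.1 hv).2
  rw [heq]
  refine isCompact_Icc.inter_right (IsClosed.inter ?_ ?_)
  · exact isClosed_eq (by fun_prop) continuous_const
  · exact isClosed_biInter fun v _ => isClosed_eq (continuous_apply v) continuous_const

lemma completeRealization_eq_iUnion {n d : ℕ} (hn : d + 1 ≤ n) :
    completeRealization n d =
      ⋃ σ ∈ {σ : Finset (Fin n) | #σ = d + 1}, completeFaceReal n d σ := by
  ext x
  simp only [Set.mem_iUnion, exists_prop, Set.mem_ofPred_eq]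
  refine ⟨fun hx => ?_, fun ⟨σ, _, h⟩ => h.1⟩
  obtain ⟨σ, hσ, hc⟩ := Finset.exists_superset_card_eq hx.2.2 (by simpa using hn)
  exact ⟨σ, hc, hx, fun v hv => hσ (by simpa using hv)⟩

/-- The `d`-cells whose image under `f` contains `z`. -/
noncomputable def coveringCells {n d : ℕ} (f : (Fin n → ℝ) → Fin d → ℝ) (z : Fin d → ℝ) :
    Finset (Finset (Fin n)) :=
  {σ | #σ = d + 1 ∧ z ∈ f '' completeFaceReal n d σ}

lemma eventually_coveringCells_subset {n d : ℕ} {f : (Fin n → ℝ) → Fin d → ℝ}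
    (hf : ContinuousOn f (completeRealization n d)) (z : Fin d → ℝ) :
    ∀ᶠ z' in nhds z, coveringCells f z' ⊆ coveringCells f z := by
  have : ∀ σ : Finset (Fin n), ∀ᶠ z' in nhds z, σ ∈ coveringCells f z' → σ ∈ coveringCells f z := by
    intro σ
    by_cases h : σ ∈ coveringCells f z
    · exact Filter.Eventually.of_forall fun _ _ => h
    by_cases hσ : #σ = d + 1
    · have hz : z ∉ f '' completeFaceReal n d σ := fun hz =>
        h (Finset.mem_filter.2 ⟨Finset.mem_univ σ, hσ, hz⟩)
      have hcl : IsClosed (f '' completeFaceReal n d σ) :=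
        ((isCompact_completeFaceReal hσ).image_of_continuousOn
          (hf.mono fun _ hx => hx.1)).isClosed
      filter_upwards [hcl.isOpen_compl.mem_nhds hz] with z' hz' h'
      exact absurd (Finset.mem_filter.1 h').2.2 hz'
    · exact Filter.Eventually.of_forall fun z' h' => absurd (Finset.mem_filter.1 h').2.1 hσ
  filter_upwards [Filter.eventually_all.2 this] with z' h σ hσ using h σ hσ

theorem exists_large_coveringCells {n d : ℕ} {ε : ℝ} (hn : d + 1 ≤ n) (hε0 : 0 ≤ ε) (hε1 : ε < 1)
    (hε : ((d + 1) * 3 ^ d : ℕ) * 2 ^ ((d + 1) * 3 ^ d) * ε < 1)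
    {f : (Fin n → ℝ) → Fin d → ℝ} (hf : ContinuousOn f (completeRealization n d))
    (hmaps : Set.MapsTo f (completeRealization n d) (Set.Icc 0 1)) :
    ∃ z, (n : ℝ) * (ε * n) ^ (d + 1) ≤
      n * ((d + 1) ^ (d + 1) * #(coveringCells f z)) + (d + 1) ^ 2 * n ^ (d + 1) := by
  by_contra! hsmall
  have : Nonempty (Fin n) := ⟨⟨0, by omega⟩⟩
  have hn0 : (0 : ℝ) < n := by exact_mod_cast (by omega : 0 < n)
  obtain ⟨δ, hδ, hleb⟩ := lebesgue_number_lemma_of_metric (isCompact_Icc (a := (0 : Fin d → ℝ))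
    (b := 1)) (c := fun z => interior {z' | coveringCells f z' ⊆ coveringCells f z})
    (fun _ => isOpen_interior) fun z _ => Set.mem_iUnion.2
      ⟨z, mem_interior_iff_mem_nhds.2 (eventually_coveringCells_subset hf z)⟩
  obtain ⟨N', hN'⟩ := exists_nat_one_div_lt hδ
  set N := N' + 1 with hN
  have hNδ : 1 / (N : ℝ) < δ := by rw [hN]; push_cast; exact hN'
  set b : Fin (d + 1) × (Fin d → Fin (N + 1)) → Finset (Fin n) → Prop := fun ρ S =>
    ∃ z ∈ Set.Icc (0 : Fin d → ℝ) 1 ∩ brick ρ, z ∈ f '' completeFaceReal n d S with hb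
  have hbmono : ∀ ρ, Monotone (b ρ) := fun ρ S T hST ⟨z, hz, hzS⟩ =>
    ⟨z, hz, Set.image_mono (completeFaceReal_mono hST) hzS⟩
  have hbz : ∀ ρ, ∃ z, ({σ | #σ = d + 1 ∧ b ρ σ} : Finset (Finset (Fin n))) ⊆
      coveringCells f z := by
    intro ρ
    by_cases hne : (Set.Icc (0 : Fin d → ℝ) 1 ∩ brick ρ).Nonempty
    · obtain ⟨x, hx⟩ := hne
      obtain ⟨z, hz⟩ := hleb x hx.1
      refine ⟨z, fun σ hσ => ?_⟩
      obtain ⟨hσc, z', hz', hz'σ⟩ := (Finset.mem_filter.1 hσ).2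
      have hmem := hz (Metric.mem_ball.2
        ((dist_le_of_mem_brick (Nat.succ_pos N') hz'.2 hx.2).trans_lt hNδ))
      exact interior_subset hmem (Finset.mem_filter.2 ⟨Finset.mem_univ _, hσc, hz'σ⟩)
    · refine ⟨0, fun σ hσ => ?_⟩
      obtain ⟨-, z', hz', -⟩ := (Finset.mem_filter.1 hσ).2
      exact absurd ⟨z', hz'⟩ hne
  have hrob : ∀ ρ, IsRobust (b ρ) ε (d + 1) ∅ := by
    intro ρ
    by_contra hnot
    have h1 := le_card_of_not_isRobust hε0 hnot
    obtain ⟨z, hz⟩ := hbz ρ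
    have h2 := card_tuples_le (b ρ) (d + 1) (by simpa using hn)
    simp only [Finset.empty_union, Fintype.card_fin] at h1 h2
    have h3 : (n : ℝ) * #{x : Fin (d + 1) → Fin n | b ρ (Finset.univ.image x)} ≤
        n * ((d + 1) ^ (d + 1) * #({σ | #σ = d + 1 ∧ b ρ σ} : Finset (Finset (Fin n)))) +
          (d + 1) ^ 2 * n ^ (d + 1) := by exact_mod_cast h2
    have h4 : (#({σ | #σ = d + 1 ∧ b ρ σ} : Finset (Finset (Fin n))) : ℝ) ≤
        #(coveringCells f z) := by exact_mod_cast Finset.card_le_card hz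
    refine absurd (hsmall z) (not_lt.2 ?_)
    calc (n : ℝ) * (ε * n) ^ (d + 1)
        ≤ n * #{x : Fin (d + 1) → Fin n | b ρ (Finset.univ.image x)} := by gcongr
      _ ≤ _ := h3
      _ ≤ _ := by gcongr
  obtain ⟨v, hv⟩ := exists_robust_labelling (color := fun τ => (τ.1 : ℕ)) (fun τ => τ.1.2)
    card_brickAdj_le hε0 hε hrob
  obtain ⟨φ, hφ⟩ := PartitionOfUnity.exists_isSubordinate (isClosed_Icc (a := (0 : Fin d → ℝ))
    (b := 1)) (brick (d := d) (N := N)) isOpen_brick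
    fun z hz => Set.mem_iUnion.2 (exists_mem_brick hz)
  set s : (Fin d → ℝ) → Fin n → ℝ := fun z => ∑ τ, φ τ z • Pi.single (v τ) 1 with hs
  have hscont : Continuous s := continuous_finsetSum _ fun τ _ =>
    (φ τ).continuous.smul continuous_const
  set C : (Fin d → ℝ) → Finset (Fin (d + 1) × (Fin d → Fin (N + 1))) :=
    fun z => {τ | φ τ z ≠ 0} with hC
  have hCmem : ∀ z, ∀ τ ∈ C z, z ∈ brick τ := fun z τ hτ =>
    hφ τ (subset_tsupport _ (Finset.mem_filter.1 hτ).2)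
  have hinj : ∀ z, Set.InjOn (fun τ => (τ.1 : ℕ)) (C z : Set (Fin (d + 1) × _)) :=
    fun z τ hτ τ' hτ' h => eq_of_mem_brick (hCmem z τ hτ) (hCmem z τ' hτ') (Fin.ext h)
  have hCcard : ∀ z, #(C z) ≤ d + 1 := fun z => by
    simpa using Finset.card_le_card_of_injOn (t := Finset.range (d + 1)) _
      (fun τ _ => Finset.mem_coe.2 (Finset.mem_range.2 τ.1.2)) (hinj z)
  have hsapply : ∀ z w, s z w = ∑ τ, φ τ z * if w = v τ then 1 else 0 := fun z w => by
    simp [hs, Finset.sum_apply, Pi.single_apply]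
  have hssupp : ∀ z w, s z w ≠ 0 → w ∈ (C z).image v := by
    intro z w hw
    rw [hsapply] at hw
    obtain ⟨τ, -, hτ⟩ := Finset.exists_ne_zero_of_sum_ne_zero hw
    have h1 := left_ne_zero_of_mul hτ
    have h2 : w = v τ := by_contra fun h => right_ne_zero_of_mul hτ (if_neg h)
    exact h2 ▸ Finset.mem_image_of_mem v (by simpa [hC] using h1)
  have hsum : ∀ z ∈ Set.Icc (0 : Fin d → ℝ) 1, ∑ τ, φ τ z = 1 := fun z hz => by
    rw [← finsum_eq_sum_of_fintype]
    exact φ.sum_eq_one hz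
  have hsreal : ∀ z ∈ Set.Icc (0 : Fin d → ℝ) 1, s z ∈ completeFaceReal n d ((C z).image v) := by
    intro z hz
    refine ⟨⟨fun w => ?_, ?_, ?_⟩, hssupp z⟩
    · rw [hsapply]
      exact Finset.sum_nonneg fun τ _ => mul_nonneg (φ.nonneg τ z) (by split_ifs <;> simp)
    · simp only [hsapply]
      rw [Finset.sum_comm]
      simpa using hsum z hz
    · refine (Finset.card_le_card (t := (C z).image v) fun w hw => ?_).trans
        (Finset.card_image_le.trans (hCcard z))
      exact hssupp z w (Finset.mem_filter.1 hw).2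
  obtain ⟨z, hz, hfix⟩ := exists_eq_zero_of_sign_on_faces (g := fun z => z - f (s z))
    (continuousOn_id.sub (hf.comp hscont.continuousOn fun z hz => (hsreal z hz).1))
    (fun z hz i hi => by simpa [hi] using (hmaps (hsreal z hz).1).1 i)
    (fun z hz i hi => by simpa [hi] using (hmaps (hsreal z hz).1).2 i)
  obtain ⟨ρ, hρ⟩ : (C z).Nonempty := by
    by_contra hempty
    rw [Finset.not_nonempty_iff_eq_empty] at hempty
    have : ∑ τ, φ τ z = 0 := Finset.sum_eq_zero fun τ _ => by_contra fun h =>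
      Finset.notMem_empty τ (hempty ▸ Finset.mem_filter.2 ⟨Finset.mem_univ τ, h⟩)
    rw [hsum z hz] at this
    exact one_ne_zero this
  have hadj : ∀ τ ∈ C z, ∀ τ' ∈ C z, BrickAdj τ τ' := fun τ hτ τ' hτ' =>
    brickAdj_of_mem (hCmem z τ hτ) (hCmem z τ' hτ')
  exact (hv ρ (C z) (fun τ hτ => hadj τ hτ ρ hρ) hadj (hinj z)).not_bad (hbmono ρ) hε1
    ⟨z, ⟨hz, hCmem z ρ hρ⟩, s z, hsreal z hz, (sub_eq_zero.1 hfix).symm⟩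

lemma exists_large_coveringCells_of_continuousOn {n d : ℕ} {ε : ℝ} (hn : d + 1 ≤ n) (hε0 : 0 ≤ ε)
    (hε1 : ε < 1) (hε : ((d + 1) * 3 ^ d : ℕ) * 2 ^ ((d + 1) * 3 ^ d) * ε < 1)
    {f : (Fin n → ℝ) → Fin d → ℝ} (hf : ContinuousOn f (completeRealization n d)) :
    ∃ z, (n : ℝ) * (ε * n) ^ (d + 1) ≤
      n * ((d + 1) ^ (d + 1) * #(coveringCells f z)) + (d + 1) ^ 2 * n ^ (d + 1) := by
  have hcomp : IsCompact (completeRealization n d) := by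
    rw [completeRealization_eq_iUnion hn]
    exact (Set.toFinite _).isCompact_biUnion fun σ hσ => isCompact_completeFaceReal hσ
  obtain ⟨R, hR, hfR⟩ := (hcomp.image_of_continuousOn hf).isBounded.exists_pos_norm_le
  have hbound : ∀ x ∈ completeRealization n d, ∀ i, |f x i| ≤ R := fun x hx i =>
    (norm_le_pi_norm (f x) i).trans (hfR _ (Set.mem_image_of_mem f hx))
  obtain ⟨z, hz⟩ := exists_large_coveringCells hn hε0 hε1 hε
    (f := fun x i => (f x i + R) / (2 * R))
    (continuousOn_pi.2 fun i => ((continuousOn_pi.1 hf i).add continuousOn_const).div_const _)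
    fun x hx => ⟨fun i => div_nonneg (by linarith [(abs_le.1 (hbound x hx i)).1]) (by positivity),
      fun i => (div_le_one (by positivity)).2 (by linarith [(abs_le.1 (hbound x hx i)).2])⟩
  refine ⟨fun i => 2 * R * z i - R, hz.trans ?_⟩
  gcongr
  intro σ hσ
  obtain ⟨-, hσc, x, hx, rfl⟩ := Finset.mem_filter.1 hσ
  refine Finset.mem_filter.2 ⟨Finset.mem_univ _, hσc, x, hx, funext fun i => ?_⟩
  field_simp
  ring

lemma exists_coveringCells_nonempty {n d : ℕ} (hn : d + 1 ≤ n) (f : (Fin n → ℝ) → Fin d → ℝ) :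
    ∃ z, (coveringCells f z).Nonempty := by
  set v : Fin n := ⟨0, by omega⟩
  obtain ⟨σ, hσ, hc⟩ := Finset.exists_superset_card_eq (s := {v}) (n := d + 1) (by simp)
    (by simpa using hn)
  have hsupp : ∀ w, (Pi.single v 1 : Fin n → ℝ) w ≠ 0 → w = v := fun w hw =>
    by_contra fun h => hw (Pi.single_eq_of_ne h 1)
  refine ⟨f (Pi.single v 1), σ, Finset.mem_filter.2 ⟨Finset.mem_univ _, hc,
    Set.mem_image_of_mem f ⟨⟨fun w => ?_, by simp, ?_⟩, fun w hw => ?_⟩⟩⟩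
  · rw [Pi.single_apply]
    split_ifs <;> simp
  · refine (Finset.card_le_card (t := {v}) fun w hw => ?_).trans (by simp)
    exact Finset.mem_singleton.2 (hsupp w (Finset.mem_filter.1 hw).2)
  · exact hσ (Finset.mem_singleton.2 (hsupp w hw))

theorem exists_overlap_constant (d : ℕ) :
    ∃ c : ℝ, 0 < c ∧ ∀ n : ℕ, d + 1 ≤ n → ∀ f : (Fin n → ℝ) → Fin d → ℝ,
      ContinuousOn f (completeRealization n d) →
        ∃ z, c * (n.choose (d + 1) : ℝ) ≤ #(coveringCells f z) := by
  set K := (d + 1) * 3 ^ d with hK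
  have hK1 : 1 ≤ K := Nat.mul_pos (Nat.succ_pos d) (by positivity)
  set A : ℝ := K * 2 ^ K with hA
  have hA1 : 1 ≤ A := by
    have h1 : (1 : ℝ) ≤ K := by exact_mod_cast hK1
    have h2 : (1 : ℝ) ≤ 2 ^ K := one_le_pow₀ (by norm_num)
    nlinarith
  set ε : ℝ := 1 / (2 * A) with hε
  have hε0 : 0 < ε := by positivity
  have hAε : A * ε = 1 / 2 := by rw [hε]; field_simp
  have hε1 : ε < 1 := by nlinarith
  set M : ℝ := (d + 1) ^ (d + 1) with hM
  have hM0 : 0 < M := by positivity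
  set β : ℝ := ε ^ (d + 1) with hβ
  have hβ0 : 0 < β := by positivity
  obtain ⟨n₀, hn₀⟩ := exists_nat_ge (2 * (d + 1) ^ 2 / β : ℝ)
  refine ⟨min (β / (2 * M)) (1 / (n₀.choose (d + 1) + 1)), by positivity, fun n hn f hf => ?_⟩
  rcases le_total n₀ n with hle | hle
  · obtain ⟨z, hz⟩ := exists_large_coveringCells_of_continuousOn hn hε0.le hε1
      (by rw [← hK, ← hA, hAε]; norm_num) hf
    refine ⟨z, ?_⟩
    have hn0 : (0 : ℝ) < n := by exact_mod_cast (by omega : 0 < n)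
    have h1 : 2 * (d + 1) ^ 2 ≤ β * n := by
      have : (n₀ : ℝ) ≤ n := by exact_mod_cast hle
      have := (div_le_iff₀ hβ0).1 (hn₀.trans this)
      linarith
    rw [mul_pow, ← hβ, ← hM] at hz
    have hpow : (0 : ℝ) < (n : ℝ) ^ (d + 1) := by positivity
    have h2 : (n : ℝ) * (β / 2 * n ^ (d + 1)) ≤ n * (M * #(coveringCells f z)) := by
      nlinarith [mul_le_mul_of_nonneg_right h1 hpow.le]
    have h3 : β / 2 * (n : ℝ) ^ (d + 1) ≤ M * #(coveringCells f z) := le_of_mul_le_mul_left h2 hn0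
    have h4 : (n.choose (d + 1) : ℝ) ≤ (n : ℝ) ^ (d + 1) := by
      exact_mod_cast Nat.choose_le_pow n (d + 1)
    calc _ ≤ β / (2 * M) * (n : ℝ) ^ (d + 1) := by
          gcongr
          exact min_le_left _ _
      _ = β / 2 * (n : ℝ) ^ (d + 1) / M := by field_simp
      _ ≤ _ := by rwa [div_le_iff₀' hM0]
  · obtain ⟨z, hz⟩ := exists_coveringCells_nonempty hn f
    refine ⟨z, ?_⟩
    have h1 : (1 : ℝ) ≤ #(coveringCells f z) := by exact_mod_cast hz.card_pos
    have h2 : (n.choose (d + 1) : ℝ) ≤ n₀.choose (d + 1) := by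
      exact_mod_cast Nat.choose_le_choose (d + 1) hle
    calc _ ≤ 1 / (n₀.choose (d + 1) + 1) * (n₀.choose (d + 1) : ℝ) := by
          gcongr
          exact min_le_right _ _
      _ ≤ 1 := by
          rw [one_div_mul_eq_div, div_le_one (by positivity)]
          linarith
      _ ≤ _ := h1

/-- Gromov's topological overlap theorem: for every `d ≥ 1` there is
`c_d > 0` such that for every `n ≥ d+1` and every continuous `f : |Δₙ^{(d)}| → ℝ^d`
there is `z ∈ ℝ^d` covered by the images of at least `c_d·C(n,d+1)` of the `d`-cells. -/
theorem gromov_topological_overlap (d : ℕ) (hd : 1 ≤ d) :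
    ∃ c : ℝ, 0 < c ∧
      ∀ n : ℕ, d + 1 ≤ n →
        ∀ f : (Fin n → ℝ) → (Fin d → ℝ), ContinuousOn f (completeRealization n d) →
          ∃ z : Fin d → ℝ,
            c * (n.choose (d + 1) : ℝ) ≤
              ({σ : Finset (Fin n) | σ.card = d + 1 ∧
                  z ∈ f '' completeFaceReal n d σ}).ncard := by
  obtain ⟨c, hc, h⟩ := exists_overlap_constant d
  refine ⟨c, hc, fun n hn f hf => ?_⟩
  obtain ⟨z, hz⟩ := h n hn f hf
  refine ⟨z, hz.trans_eq ?_⟩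
  rw [← Set.ncard_coe_finset, coveringCells, Finset.coe_filter_univ]
end

section
/- (Bárány) For every d ≥ 1 there exists a constant C_d > 0 such that for every finite set P ⊆ ℝ^d with |P| = n, there exists a point z ∈ ℝ^d such that z lies in the convex hull of S for at least C_d·C(n,d+1) of the (d+1)-element subsets S of P. -/
open Module in
/-- **Centerpoint theorem**: some point lies in the convex hull of every subset of `P` containing
more than the fraction `d / (d + 1)` of the points of `P`, where `d` is the dimension. -/
theorem exists_centerpoint {E : Type*} [AddCommGroup E] [Module ℝ E] [FiniteDimensional ℝ E]
    (P : Finset E) :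
    ∃ z : E, ∀ Q ⊆ P, finrank ℝ E * P.card < (finrank ℝ E + 1) * Q.card →
      z ∈ convexHull ℝ (Q : Set E) := by
  classical
  set d := finrank ℝ E with hd
  have key := Convex.helly_theorem' (𝕜 := ℝ) (F := fun Q : Finset E ↦ convexHull ℝ (Q : Set E))
    (s := P.powerset.filter fun Q ↦ d * P.card < (d + 1) * Q.card)
    (fun Q _ ↦ convex_convexHull ℝ _) ?_
  · obtain ⟨z, hz⟩ := key
    refine ⟨z, fun Q hQ hcard ↦ ?_⟩
    exact Set.mem_iInter₂.1 hz Q (by simp [hQ, hcard])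
  · intro I hI hIcard
    obtain rfl | hne := I.eq_empty_or_nonempty
    · simp
    have hI' : ∀ Q ∈ I, Q ⊆ P ∧ d * P.card < (d + 1) * Q.card := fun Q hQ ↦ by
      simpa using hI hQ
    have hlt : (I.biUnion fun Q ↦ P \ Q).card < P.card := by
      have h1 : ∀ Q ∈ I, (d + 1) * (P \ Q).card < P.card := fun Q hQ ↦ by
        have h := Finset.card_sdiff_add_card_eq_card (hI' Q hQ).1
        have h' := (hI' Q hQ).2
        nlinarith
      have h2 : (d + 1) * (I.biUnion fun Q ↦ P \ Q).card < (d + 1) * P.card :=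
        calc (d + 1) * (I.biUnion fun Q ↦ P \ Q).card
            ≤ (d + 1) * ∑ Q ∈ I, (P \ Q).card := Nat.mul_le_mul_left _ Finset.card_biUnion_le
          _ = ∑ Q ∈ I, (d + 1) * (P \ Q).card := Finset.mul_sum _ _ _
          _ < ∑ _Q ∈ I, P.card := Finset.sum_lt_sum_of_nonempty hne h1
          _ = I.card * P.card := by simp
          _ ≤ (d + 1) * P.card := Nat.mul_le_mul_right _ hIcard
      exact lt_of_mul_lt_mul_left' h2
    obtain ⟨p, hpP, hp⟩ := Finset.exists_mem_notMem_of_card_lt_card hlt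
    refine ⟨p, Set.mem_iInter₂.2 fun Q hQ ↦ subset_convexHull ℝ _ ?_⟩
    by_contra hpQ
    exact hp (Finset.mem_biUnion.2 ⟨Q, hQ, Finset.mem_sdiff.2 ⟨hpP, hpQ⟩⟩)

open Module in
/-- A weak form of **Tverberg's theorem**: a set of at least `r * (d + 1) ^ 2` points in dimension
`d` contains `r` pairwise disjoint subsets whose convex hulls have a common point. -/
theorem exists_pairwise_disjoint_mem_convexHull {E ι : Type*} [AddCommGroup E] [Module ℝ E]
    [FiniteDimensional ℝ E] [Fintype ι] (P : Finset E)
    (hP : Fintype.card ι * (finrank ℝ E + 1) ^ 2 ≤ P.card) :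
    ∃ (z : E) (M : ι → Finset E), Pairwise (Function.onFun Disjoint M) ∧
      ∀ i, M i ⊆ P ∧ z ∈ convexHull ℝ (M i : Set E) := by
  classical
  set d := finrank ℝ E with hd
  obtain ⟨z, hz⟩ := exists_centerpoint P
  suffices H : ∀ s : Finset ι, ∃ M : ι → Finset E, (s : Set ι).PairwiseDisjoint M ∧
      ∀ i ∈ s, M i ⊆ P ∧ (M i).card ≤ d + 1 ∧ z ∈ convexHull ℝ (M i : Set E) by
    obtain ⟨M, hdisj, hM⟩ := H Finset.univ
    exact ⟨z, M, fun i j hij ↦ hdisj (by simp) (by simp) hij,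
      fun i ↦ ⟨(hM i (by simp)).1, (hM i (by simp)).2.2⟩⟩
  intro s
  induction s using Finset.induction_on with
  | empty => exact ⟨fun _ ↦ ∅, by simp, by simp⟩
  | insert a s ha ih =>
    obtain ⟨M, hdisj, hM⟩ := ih
    have hused : (s.biUnion M).card ≤ s.card * (d + 1) :=
      Finset.card_biUnion_le_card_mul _ _ _ fun i hi ↦ (hM i hi).2.1
    have hs : s.card + 1 ≤ Fintype.card ι := by
      rw [← Finset.card_insert_of_notMem ha]
      exact Finset.card_le_univ _
    have hsub : s.biUnion M ⊆ P := Finset.biUnion_subset.2 fun i hi ↦ (hM i hi).1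
    have hcard := Finset.card_sdiff_add_card_eq_card hsub
    have hzQ : z ∈ convexHull ℝ ((P \ s.biUnion M : Finset E) : Set E) := by
      refine hz _ Finset.sdiff_subset ?_
      have h1 : (d + 1) * (s.biUnion M).card ≤ s.card * (d + 1) ^ 2 :=
        (Nat.mul_le_mul_left _ hused).trans_eq (by ring)
      have h2 : (s.card + 1) * (d + 1) ^ 2 ≤ P.card := (Nat.mul_le_mul_right _ hs).trans hP
      have h3 : 0 < (d + 1) ^ 2 := by positivity
      rw [← hd]
      nlinarith
    rw [convexHull_eq_union] at hzQ
    simp only [Set.mem_iUnion] at hzQ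
    obtain ⟨t, htQ, hind, hzt⟩ := hzQ
    have htQ' : t ⊆ P \ s.biUnion M := by exact_mod_cast htQ
    have htcard : t.card ≤ d + 1 := by
      have := hind.card_le_finrank_succ
      rw [Fintype.card_coe] at this
      exact this.trans (Nat.add_le_add_right (Submodule.finrank_le _) 1)
    have hdt : ∀ i ∈ s, Disjoint t (M i) := fun i hi ↦
      (Finset.disjoint_sdiff.symm.mono_left htQ').mono_right (Finset.subset_biUnion_of_mem M hi)
    have hupd : ∀ i ∈ s, Function.update M a t i = M i := fun i hi ↦
      Function.update_of_ne (ne_of_mem_of_not_mem hi ha) _ _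
    refine ⟨Function.update M a t, ?_, ?_⟩
    · rw [Finset.coe_insert, Set.pairwiseDisjoint_insert_of_notMem (by simpa using ha)]
      refine ⟨fun i hi j hj hij ↦ ?_, fun i hi ↦ ?_⟩
      · simpa [Function.onFun, hupd i hi, hupd j hj] using hdisj hi hj hij
      · simpa [hupd i hi] using hdt i hi
    · intro i hi
      obtain rfl | hi := Finset.mem_insert.1 hi
      · simpa using ⟨htQ'.trans Finset.sdiff_subset, htcard, hzt⟩
      · rw [hupd i hi]
        exact hM i hi

/-- A point `y` of the convex hull of a family at which the linear functional `g` is minimal is in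
the hull of those members of the family on which `g` takes the value `g y`. -/
theorem mem_convexHull_image_of_forall_le {E ι : Type*} [AddCommGroup E] [Module ℝ E] [Fintype ι]
    {f : ι → E} {y : E} (hy : y ∈ convexHull ℝ (Set.range f)) (g : E →ₗ[ℝ] ℝ)
    (hg : ∀ i, g y ≤ g (f i)) : y ∈ convexHull ℝ (f '' {i | g (f i) = g y}) := by
  classical
  rw [convexHull_range_eq_exists_affineCombination] at hy
  obtain ⟨s, w, hw0, hw1, rfl⟩ := hy
  rw [Finset.affineCombination_eq_linear_combination _ _ _ hw1] at hg ⊢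
  set y := ∑ i ∈ s, w i • f i with hy
  have hsum : ∑ i ∈ s, w i * (g (f i) - g y) = 0 := by
    have : g y = ∑ i ∈ s, w i * g (f i) := by simp [hy]
    simp only [mul_sub, Finset.sum_sub_distrib, ← Finset.sum_mul, hw1, ← this]
    ring
  have hzero := (Finset.sum_eq_zero_iff_of_nonneg fun i hi ↦
    mul_nonneg (hw0 i hi) (sub_nonneg.2 (hg i))).1 hsum
  have hmem : ∀ i ∈ s, w i ≠ 0 → g (f i) = g y := fun i hi hwi ↦
    sub_eq_zero.1 ((mul_eq_zero.1 (hzero i hi)).resolve_left hwi)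
  have hfilter : ∑ i ∈ s with w i ≠ 0, w i = 1 := by rw [Finset.sum_filter_ne_zero, hw1]
  have hy' : y = ∑ i ∈ s with w i ≠ 0, w i • f i := by
    rw [hy, Finset.sum_filter_of_ne]
    intro i _ h h0
    simp [h0] at h
  rw [hy']
  refine (convex_convexHull ℝ _).sum_mem (fun i hi ↦ hw0 i (Finset.mem_filter.1 hi).1) hfilter
    fun i hi ↦ subset_convexHull ℝ _ ⟨i, ?_, rfl⟩
  rw [← hy']
  exact hmem i (Finset.mem_filter.1 hi).1 (Finset.mem_filter.1 hi).2

/-- A point in the convex hull of an affinely dependent family is in the hull of the family with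
one member removed. -/
theorem exists_mem_convexHull_image_compl {E ι : Type*} [AddCommGroup E] [Module ℝ E] [Fintype ι]
    {f : ι → E} (hf : ¬ AffineIndependent ℝ f) {y : E} (hy : y ∈ convexHull ℝ (Set.range f)) :
    ∃ i, y ∈ convexHull ℝ (f '' {i}ᶜ) := by
  classical
  by_cases hinj : Function.Injective f
  · have hT : ((Finset.univ.image f : Finset E) : Set E) = Set.range f := by simp
    have hdep : ¬ AffineIndependent ℝ (Subtype.val : ↥(Finset.univ.image f) → E) := by
      intro h
      let e : ι ↪ (Finset.univ.image f : Finset E) :=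
        ⟨fun i ↦ ⟨f i, by simp⟩, fun i j hij ↦ hinj (congrArg Subtype.val hij)⟩
      exact hf (h.comp_embedding e)
    obtain ⟨⟨p, hp⟩, hyp⟩ := Caratheodory.mem_convexHull_erase hdep (hT ▸ hy)
    obtain ⟨i, rfl⟩ : p ∈ Set.range f := hT ▸ hp
    refine ⟨i, convexHull_mono ?_ hyp⟩
    intro q hq
    obtain ⟨hq1, hq2⟩ := Finset.mem_erase.1 (Finset.mem_coe.1 hq)
    obtain ⟨j, -, rfl⟩ := Finset.mem_image.1 hq2
    exact ⟨j, fun h ↦ hq1 (congrArg f h), rfl⟩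
  · obtain ⟨i, j, hij, hne⟩ := Function.not_injective_iff.1 hinj
    refine ⟨i, convexHull_mono ?_ hy⟩
    rintro _ ⟨k, rfl⟩
    by_cases hk : k = i
    · exact ⟨j, fun h ↦ hne h.symm, by rw [hk, hij]⟩
    · exact ⟨k, hk, rfl⟩

open Module in
/-- If `z` is not in the convex hull of `d + 1` points of a `d`-dimensional space, the nearest
point `y` to `z` of that hull is in the hull of `d` of the points. -/
theorem exists_mem_convexHull_image_compl_of_inner_nonneg {E ι : Type*} [NormedAddCommGroup E]
    [InnerProductSpace ℝ E] [FiniteDimensional ℝ E] [Fintype ι]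
    (hι : Fintype.card ι = finrank ℝ E + 1) {f : ι → E} {y z : E} (hne : y ≠ z)
    (hy : y ∈ convexHull ℝ (Set.range f)) (hf : ∀ i, 0 ≤ inner ℝ (y - z) (f i - y)) :
    ∃ i, y ∈ convexHull ℝ (f '' {i}ᶜ) := by
  by_cases hind : AffineIndependent ℝ f
  · have htop := hind.affineSpan_eq_top_iff_card_eq_finrank_add_one.2 hι
    have hex : ∃ i, inner ℝ (y - z) (f i) ≠ inner ℝ (y - z) y := by
      by_contra! hall
      have hle : affineSpan ℝ (Set.range f) ≤ AffineSubspace.mk' y (ℝ ∙ (y - z))ᗮ := by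
        rw [affineSpan_le]
        rintro _ ⟨i, rfl⟩
        simp [AffineSubspace.mem_mk', Submodule.mem_orthogonal_singleton_iff_inner_right,
          inner_sub_right, hall i]
      have hz : z ∈ AffineSubspace.mk' y (ℝ ∙ (y - z))ᗮ := hle (htop ▸ AffineSubspace.mem_top ℝ E z)
      rw [AffineSubspace.mem_mk', Submodule.mem_orthogonal_singleton_iff_inner_right,
        vsub_eq_sub, ← neg_sub y z, inner_neg_right, neg_eq_zero, inner_self_eq_zero] at hz
      exact hne (sub_eq_zero.1 hz)
    obtain ⟨i, hi⟩ := hex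
    refine ⟨i, convexHull_mono (Set.image_mono ?_) (mem_convexHull_image_of_forall_le hy
      (innerₛₗ ℝ (y - z)) fun j ↦ ?_)⟩
    · rintro j hj rfl
      exact hi hj
    · have := hf j
      rw [inner_sub_right] at this
      exact sub_nonneg.1 this
  · exact exists_mem_convexHull_image_compl hind hy

open Module in
/-- **Colorful Carathéodory theorem** in a Euclidean space. -/
theorem exists_transversal_mem_convexHull_of_innerProductSpace {E ι : Type*}
    [NormedAddCommGroup E] [InnerProductSpace ℝ E] [FiniteDimensional ℝ E] [Fintype ι]
    (hι : Fintype.card ι = finrank ℝ E + 1) (M : ι → Finset E) {z : E}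
    (hz : ∀ i, z ∈ convexHull ℝ (M i : Set E)) :
    ∃ f : ι → E, (∀ i, f i ∈ M i) ∧ z ∈ convexHull ℝ (Set.range f) := by
  classical
  have hMne : ∀ i, (M i).Nonempty := fun i ↦ by
    simpa using convexHull_nonempty_iff.1 ⟨z, hz i⟩
  have : Nonempty ι := Fintype.card_pos_iff.1 (by omega)
  set U : Set E := ⋃ f ∈ Fintype.piFinset M, convexHull ℝ (Set.range f) with hU
  have hUc : IsCompact U := (Fintype.piFinset M).finite_toSet.isCompact_biUnion fun f _ ↦
    (Set.finite_range f).isCompact_convexHull ℝ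
  have hmemU : ∀ {f : ι → E} {x : E}, (∀ i, f i ∈ M i) → x ∈ convexHull ℝ (Set.range f) →
      x ∈ U := fun hf hx ↦ Set.mem_biUnion (Fintype.mem_piFinset.2 hf) hx
  have hUne : U.Nonempty := by
    choose f hf using hMne
    exact (Set.range_nonempty f).convexHull.mono fun x hx ↦ hmemU hf hx
  obtain ⟨y, hyU, hymin⟩ := hUc.exists_isMinOn hUne
    (f := fun x ↦ ‖z - x‖) (by fun_prop)
  have hinner : ∀ {f : ι → E}, (∀ i, f i ∈ M i) → y ∈ convexHull ℝ (Set.range f) →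
      ∀ i, 0 ≤ inner ℝ (y - z) (f i - y) := by
    intro f hf hy i
    have hinf : ‖z - y‖ = ⨅ w : convexHull ℝ (Set.range f), ‖z - w‖ := by
      have : Nonempty (convexHull ℝ (Set.range f)) := ⟨⟨y, hy⟩⟩
      refine le_antisymm (le_ciInf fun w ↦ hymin (hmemU hf w.2)) ?_
      exact ciInf_le (f := fun w : convexHull ℝ (Set.range f) ↦ ‖z - w‖)
        ⟨0, by rintro _ ⟨w, rfl⟩; positivity⟩ ⟨y, hy⟩
    have := (norm_eq_iInf_iff_real_inner_le_zero (convex_convexHull ℝ _) hy).1 hinf (f i)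
      (subset_convexHull ℝ _ ⟨i, rfl⟩)
    rw [← neg_sub z y, inner_neg_left]
    linarith
  obtain ⟨f, hf, hy⟩ := Set.mem_iUnion₂.1 hyU
  rw [Fintype.mem_piFinset] at hf
  by_cases hne : y = z
  · exact ⟨f, hf, hne ▸ hy⟩
  exfalso
  obtain ⟨i, hi⟩ := exists_mem_convexHull_image_compl_of_inner_nonneg hι hne hy (hinner hf hy)
  obtain ⟨q, hqM, hq⟩ : ∃ q ∈ M i, inner ℝ (y - z) q ≤ inner ℝ (y - z) z := by
    by_contra! hall
    have hsub : convexHull ℝ (M i : Set E) ⊆ {x | inner ℝ (y - z) z < inner ℝ (y - z) x} :=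
      convexHull_min hall (convex_halfSpace_gt (innerₛₗ ℝ (y - z)).isLinear _)
    exact lt_irrefl (inner ℝ (y - z) z) (hsub (hz i))
  have hf' : ∀ j, Function.update f i q j ∈ M j := by
    intro j
    obtain rfl | hj := eq_or_ne j i
    · simpa using hqM
    · simpa [hj] using hf j
  have hy' : y ∈ convexHull ℝ (Set.range (Function.update f i q)) := by
    refine convexHull_mono ?_ hi
    rintro _ ⟨j, hj, rfl⟩
    exact ⟨j, Function.update_of_ne hj _ _⟩
  have h1 := hinner hf' hy' i
  have h2 : 0 < inner ℝ (y - z) (y - z) := real_inner_self_pos.2 (sub_ne_zero.2 hne)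
  rw [Function.update_self, inner_sub_right] at h1
  rw [inner_sub_right] at h2
  linarith

open Module in
/-- **Colorful Carathéodory theorem**: if `z` is in the convex hull of each of `d + 1` finite sets
in a `d`-dimensional space, then it is in the convex hull of a transversal of these sets. -/
theorem exists_transversal_mem_convexHull {E ι : Type*} [AddCommGroup E] [Module ℝ E]
    [FiniteDimensional ℝ E] [Fintype ι] (hι : Fintype.card ι = finrank ℝ E + 1)
    (M : ι → Finset E) {z : E} (hz : ∀ i, z ∈ convexHull ℝ (M i : Set E)) :
    ∃ f : ι → E, (∀ i, f i ∈ M i) ∧ z ∈ convexHull ℝ (Set.range f) := by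
  classical
  let e : E ≃ₗ[ℝ] EuclideanSpace ℝ (Fin (finrank ℝ E)) :=
    LinearEquiv.ofFinrankEq _ _ (by simp)
  obtain ⟨f, hf, hzf⟩ := exists_transversal_mem_convexHull_of_innerProductSpace
    (by simpa using hι) (fun i ↦ (M i).image e) (z := e z) fun i ↦ by
      rw [Finset.coe_image]
      exact e.toLinearMap.image_convexHull (M i : Set E) ▸ Set.mem_image_of_mem e (hz i)
  refine ⟨fun i ↦ e.symm (f i), fun i ↦ ?_, ?_⟩
  · obtain ⟨x, hx, hxe⟩ := Finset.mem_image.1 (hf i)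
    simpa [← hxe] using hx
  · have h := Set.mem_image_of_mem e.symm hzf
    have h' := e.symm.toLinearMap.image_convexHull (Set.range f)
    rw [LinearEquiv.coe_coe] at h'
    rw [h', ← Set.range_comp, LinearEquiv.symm_apply_apply] at h
    exact h

open Module in
/-- If `P` has at least `q * (d + 1) ^ 3` points in dimension `d`, then some point is in the
convex hull of at least `q ^ (d + 1)` of the `(d + 1)`-element subsets of `P`. -/
theorem exists_pow_le_ncard_mem_convexHull {E : Type*} [AddCommGroup E] [Module ℝ E]
    [FiniteDimensional ℝ E] (P : Finset E) (q : ℕ) (hq : q * (finrank ℝ E + 1) ^ 3 ≤ P.card) :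
    ∃ z : E, q ^ (finrank ℝ E + 1) ≤ {S : Finset E | S ⊆ P ∧ S.card = finrank ℝ E + 1 ∧
      z ∈ convexHull ℝ (S : Set E)}.ncard := by
  classical
  set d := finrank ℝ E with hd
  obtain ⟨z, M, hdisj, hM⟩ := exists_pairwise_disjoint_mem_convexHull (ι := Fin (d + 1) × Fin q) P
    (by
      rw [← hd]
      refine le_of_eq_of_le ?_ hq
      simp only [Fintype.card_prod, Fintype.card_fin]
      ring)
  have hM_eq : ∀ {a b x}, x ∈ M a → x ∈ M b → a = b := fun {a b x} ha hb ↦ by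
    by_contra hab
    exact Finset.disjoint_left.1 (hdisj hab) ha hb
  choose f hf hzf using fun g : Fin (d + 1) → Fin q ↦
    exists_transversal_mem_convexHull (ι := Fin (d + 1)) (by simp [hd])
      (fun i ↦ M (i, g i)) fun i ↦ (hM (i, g i)).2
  have hfinj : ∀ g, Function.Injective (f g) := fun g i j hij ↦
    congrArg Prod.fst (hM_eq (hf g i) (hij ▸ hf g j))
  refine ⟨z, ?_⟩
  have hfin : {S : Finset E | S ⊆ P ∧ S.card = d + 1 ∧ z ∈ convexHull ℝ (S : Set E)}.Finite :=
    P.powerset.finite_toSet.subset fun S hS ↦ by simpa using hS.1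
  have hmem : ∀ g, Finset.univ.image (f g) ∈
      {S : Finset E | S ⊆ P ∧ S.card = d + 1 ∧ z ∈ convexHull ℝ (S : Set E)} := by
    refine fun g ↦ ⟨fun x hx ↦ ?_, ?_, ?_⟩
    · obtain ⟨i, -, rfl⟩ := Finset.mem_image.1 hx
      exact (hM (i, g i)).1 (hf g i)
    · simp [Finset.card_image_of_injective _ (hfinj g)]
    · simpa using hzf g
  have hinj : Function.Injective fun g ↦ Finset.univ.image (f g) := by
    intro g h hgh
    funext i
    have hi : f g i ∈ Finset.univ.image (f h) := by
      rw [← show Finset.univ.image (f g) = Finset.univ.image (f h) from hgh]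
      exact Finset.mem_image_of_mem _ (Finset.mem_univ i)
    obtain ⟨j, -, hj⟩ := Finset.mem_image.1 hi
    obtain ⟨rfl, hval⟩ := Prod.mk.inj (hM_eq (hf g i) (hj ▸ hf h j))
    exact hval
  have hle := Set.ncard_le_ncard_of_injOn (s := (Set.univ : Set (Fin (d + 1) → Fin q))) _
    (fun g _ ↦ hmem g) hinj.injOn hfin
  simpa [Set.ncard_univ] using hle

/-- Bárány: for every `d ≥ 1` there is `C_d > 0` such that for every
finite set `P ⊆ ℝ^d` of `n` points there is a point `z ∈ ℝ^d` lying in the convex hull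
of at least `C_d·C(n,d+1)` of the `(d+1)`-element subsets of `P`. -/
theorem barany_point_selection (d : ℕ) (hd : 1 ≤ d) :
    ∃ C : ℝ, 0 < C ∧
      ∀ P : Finset (Fin d → ℝ), ∃ z : Fin d → ℝ,
        C * (P.card.choose (d + 1) : ℝ) ≤
          ({S : Finset (Fin d → ℝ) | S ⊆ P ∧ S.card = d + 1 ∧
              z ∈ convexHull ℝ (S : Set (Fin d → ℝ))}).ncard := by
  have hdim : Module.finrank ℝ (Fin d → ℝ) = d := by simp
  have hB : (0 : ℝ) < (2 * ((d : ℝ) + 1) ^ 3) ^ (d + 1) := by positivity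
  refine ⟨((2 * ((d : ℝ) + 1) ^ 3) ^ (d + 1))⁻¹, by positivity, fun P ↦ ?_⟩
  obtain hlt | hge := lt_or_ge P.card (d + 1)
  · exact ⟨0, by simp [Nat.choose_eq_zero_of_lt hlt]⟩
  suffices H : ∃ (z : Fin d → ℝ) (m : ℕ), P.card ≤ 2 * (d + 1) ^ 3 * m ∧
      m ^ (d + 1) ≤ {S : Finset (Fin d → ℝ) | S ⊆ P ∧ S.card = d + 1 ∧
        z ∈ convexHull ℝ (S : Set (Fin d → ℝ))}.ncard by
    obtain ⟨z, m, hm, hcount⟩ := H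
    refine ⟨z, ?_⟩
    rw [inv_mul_le_iff₀ hB]
    have h1 : P.card.choose (d + 1) ≤ (2 * (d + 1) ^ 3) ^ (d + 1) *
        {S : Finset (Fin d → ℝ) | S ⊆ P ∧ S.card = d + 1 ∧
          z ∈ convexHull ℝ (S : Set (Fin d → ℝ))}.ncard :=
      calc P.card.choose (d + 1) ≤ P.card ^ (d + 1) := Nat.choose_le_pow _ _
        _ ≤ (2 * (d + 1) ^ 3 * m) ^ (d + 1) := Nat.pow_le_pow_left hm _
        _ = (2 * (d + 1) ^ 3) ^ (d + 1) * m ^ (d + 1) := mul_pow _ _ _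
        _ ≤ _ := Nat.mul_le_mul_left _ hcount
    exact_mod_cast h1
  have hdiv := Nat.div_mul_le_self P.card ((d + 1) ^ 3)
  have hlt_div := Nat.lt_mul_div_succ P.card (b := (d + 1) ^ 3) (by positivity)
  set q := P.card / (d + 1) ^ 3
  obtain hq | hq := Nat.eq_zero_or_pos q
  · obtain ⟨S, hSP, hS⟩ := Finset.exists_subset_card_eq hge
    obtain ⟨p, hp⟩ : S.Nonempty := Finset.card_pos.1 (by omega)
    refine ⟨p, 1, ?_, ?_⟩
    · rw [hq] at hlt_div
      linarith
    · rw [one_pow, Nat.one_le_iff_ne_zero, ← Nat.pos_iff_ne_zero, Set.ncard_pos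
        (P.powerset.finite_toSet.subset fun S hS ↦ by simpa using hS.1)]
      exact ⟨S, hSP, hS, subset_convexHull ℝ _ hp⟩
  · obtain ⟨z, hz⟩ := exists_pow_le_ncard_mem_convexHull P q (by rwa [hdim])
    rw [hdim] at hz
    refine ⟨z, q, ?_, hz⟩
    nlinarith [Nat.mul_le_mul_left ((d + 1) ^ 3) hq]
end
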